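/- Every flow-admissible signed graph (G,σ) with m edges whose minimum signature has ε_N negative edges admits a signed circuit cover of total length at most (11/3)·m − (5/3)·ε_N. In particular, every flow-admissible signed graph on m edges has a signed circuit cover of total length at most (11/3)·m. -/

import Mathlib

open Finset
open scoped Classical

noncomputable section

namespace SignedCircuitCover

variable {V E : Type} [Fintype V] [Fintype E] [DecidableEq V] [DecidableEq E]

/-- `e` is a loop. -/
def IsLoop (ends : E → Sym2 V) (e : E) : Prop := (ends e).IsDiag

/-- The vertices incident with an edge of `F`. -/
def support (ends : E → Sym2 V) (F : Finset E) : Finset V :=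
  Finset.univ.filter fun v => ∃ e ∈ F, v ∈ ends e

/-- Degree of `v` in the subgraph with edge set `F` (a loop counts twice). -/
def degree (ends : E → Sym2 V) (F : Finset E) (v : V) : ℕ :=
  ∑ e ∈ F, (if ends e = Sym2.diag v then 2 else if v ∈ ends e then 1 else 0)

/-- Reachability inside the edge set `F`. -/
def Reach (ends : E → Sym2 V) (F : Finset E) : V → V → Prop :=
  Relation.ReflTransGen fun a b => ∃ e ∈ F, ends e = s(a, b)

/-- The subgraph with edge set `F` is connected. -/
def ConnectedOn (ends : E → Sym2 V) (F : Finset E) : Prop :=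
  ∀ u ∈ support ends F, ∀ v ∈ support ends F, Reach ends F u v

/-- The whole graph is connected. -/
def Connected (ends : E → Sym2 V) : Prop :=
  ∀ u v : V, Reach ends (Finset.univ : Finset E) u v

/-- `F` is the edge set of a circuit (connected, 2-regular; a loop is a circuit). -/
def IsCircuit (ends : E → Sym2 V) (F : Finset E) : Prop :=
  F.Nonempty ∧ ConnectedOn ends F ∧ ∀ v ∈ support ends F, degree ends F v = 2

/-- `F` is the edge set of an Eulerian subgraph (connected, all degrees even). -/
def IsEulerianOn (ends : E → Sym2 V) (F : Finset E) : Prop :=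
  ConnectedOn ends F ∧ ∀ v ∈ support ends F, Even (degree ends F v)

/-- Negative edges of `F` (`sgn e = true` means `e` is negative). -/
def negEdges (sgn : E → Bool) (F : Finset E) : Finset E := F.filter fun e => sgn e = true

def IsBalancedCircuit (ends : E → Sym2 V) (sgn : E → Bool) (F : Finset E) : Prop :=
  IsCircuit ends F ∧ Even (negEdges sgn F).card

def IsUnbalancedCircuit (ends : E → Sym2 V) (sgn : E → Bool) (F : Finset E) : Prop :=
  IsCircuit ends F ∧ Odd (negEdges sgn F).card

/-- `P` is the edge set of a path with (distinct) end-vertices `u` and `v`. -/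
def IsPath (ends : E → Sym2 V) (P : Finset E) (u v : V) : Prop :=
  P.Nonempty ∧ ConnectedOn ends P ∧ u ≠ v ∧
    u ∈ support ends P ∧ v ∈ support ends P ∧
    degree ends P u = 1 ∧ degree ends P v = 1 ∧
    ∀ w ∈ support ends P, w ≠ u → w ≠ v → degree ends P w = 2

/-- A short barbell: two unbalanced circuits meeting at exactly one vertex. -/
def IsShortBarbell (ends : E → Sym2 V) (sgn : E → Bool) (F : Finset E) : Prop :=
  ∃ C₁ C₂ : Finset E, Disjoint C₁ C₂ ∧ F = C₁ ∪ C₂ ∧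
    IsUnbalancedCircuit ends sgn C₁ ∧ IsUnbalancedCircuit ends sgn C₂ ∧
    ∃ v : V, support ends C₁ ∩ support ends C₂ = {v}

/-- A long barbell: two disjoint unbalanced circuits joined by a path meeting
them only at its end-vertices. -/
def IsLongBarbell (ends : E → Sym2 V) (sgn : E → Bool) (F : Finset E) : Prop :=
  ∃ (C₁ C₂ P : Finset E) (u v : V),
    Disjoint C₁ C₂ ∧ Disjoint C₁ P ∧ Disjoint C₂ P ∧ F = C₁ ∪ C₂ ∪ P ∧
    IsUnbalancedCircuit ends sgn C₁ ∧ IsUnbalancedCircuit ends sgn C₂ ∧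
    Disjoint (support ends C₁) (support ends C₂) ∧
    IsPath ends P u v ∧
    support ends P ∩ support ends C₁ = {u} ∧
    support ends P ∩ support ends C₂ = {v}

def IsBarbell (ends : E → Sym2 V) (sgn : E → Bool) (F : Finset E) : Prop :=
  IsShortBarbell ends sgn F ∨ IsLongBarbell ends sgn F

/-- A signed circuit: a balanced circuit, a short barbell or a long barbell. -/
def IsSignedCircuit (ends : E → Sym2 V) (sgn : E → Bool) (F : Finset E) : Prop :=
  IsBalancedCircuit ends sgn F ∨ IsShortBarbell ends sgn F ∨ IsLongBarbell ends sgn F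

/-- `e` is a bridge (cut-edge) of the subgraph with edge set `F`. -/
def IsBridgeIn (ends : E → Sym2 V) (F : Finset E) (e : E) : Prop :=
  e ∈ F ∧ ∀ a b : V, ends e = s(a, b) → ¬ Reach ends (F.erase e) a b

/-- The bridges of the whole graph. -/
def bridges (ends : E → Sym2 V) : Finset E :=
  Finset.univ.filter fun e => IsBridgeIn ends Finset.univ e

/-- The non-bridge edges of the whole graph. -/
def nonbridges (ends : E → Sym2 V) : Finset E := Finset.univ \ bridges ends

/-- Reachability inside `F` avoiding the vertex `x`. -/
def ReachAvoid (ends : E → Sym2 V) (F : Finset E) (x : V) : V → V → Prop :=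
  Relation.ReflTransGen fun a b => a ≠ x ∧ b ≠ x ∧ ∃ e ∈ F, ends e = s(a, b)

/-- `x` is a cut-vertex of the subgraph with edge set `F`. -/
def IsCutVertexOn (ends : E → Sym2 V) (F : Finset E) (x : V) : Prop :=
  ∃ a ∈ support ends F, ∃ b ∈ support ends F,
    a ≠ x ∧ b ≠ x ∧ Reach ends F a b ∧ ¬ ReachAvoid ends F x a b

/-- The subgraph with edge set `F` is 2-connected (connected and without cut-vertices). -/
def TwoConnectedOn (ends : E → Sym2 V) (F : Finset E) : Prop :=
  ConnectedOn ends F ∧ ∀ x : V, ¬ IsCutVertexOn ends F x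

/-- The whole graph is 2-connected. -/
def TwoConnected (ends : E → Sym2 V) : Prop :=
  Connected ends ∧ ∀ x : V, ¬ IsCutVertexOn ends (Finset.univ : Finset E) x

/-- Total length of a collection of subgraphs. -/
def totalLength (𝒞 : List (Finset E)) : ℕ := (𝒞.map Finset.card).sum

/-- The width of the edge `e` with respect to the collection `𝒞`. -/
def widthAt (𝒞 : List (Finset E)) (e : E) : ℕ := (𝒞.filter fun C => e ∈ C).length

/-- `𝒞` covers every edge of the graph. -/
def CoversAll (𝒞 : List (Finset E)) : Prop := ∀ e : E, ∃ C ∈ 𝒞, e ∈ C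

/-- A tree of Eulerian graphs: connected, and after deleting all bridges every
component is Eulerian (equivalently all degrees in the bridgeless part are even). -/
def IsTreeOfEulerian (ends : E → Sym2 V) : Prop :=
  Connected ends ∧ ∀ v : V, Even (degree ends (nonbridges ends) v)

/-- Non-bridge non-loop edges. -/
def nbnl (ends : E → Sym2 V) : Finset E :=
  (nonbridges ends).filter fun e => ¬ IsLoop ends e

/-- A tree of circuits: connected, and after deleting all bridges and loops every
vertex has degree 0 or 2 (each component is an isolated vertex or a circuit). -/
def IsTreeOfCircuits (ends : E → Sym2 V) : Prop :=
  Connected ends ∧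
    ∀ v : V, degree ends (nbnl ends) v = 0 ∨ degree ends (nbnl ends) v = 2

/-- The balloon containing `v`: the edge set of the component of `v` in the
graph of non-bridge non-loop edges. -/
def compBalloon (ends : E → Sym2 V) (v : V) : Finset E :=
  (nbnl ends).filter fun e => ∃ w ∈ ends e, Reach ends (nbnl ends) v w

/-- Valency of the balloon of `v`: the number of bridges and loops incident
with its component. -/
def balloonValency (ends : E → Sym2 V) (v : V) : ℕ :=
  (Finset.univ.filter fun e =>
    (IsBridgeIn ends Finset.univ e ∨ IsLoop ends e) ∧
      ∃ w ∈ ends e, Reach ends (nbnl ends) v w).card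

/-- A balloon consisting of a single negative loop. -/
def IsNegLoopBalloon (ends : E → Sym2 V) (sgn : E → Bool) (B : Finset E) : Prop :=
  ∃ e : E, IsLoop ends e ∧ sgn e = true ∧ B = {e}

/-- A leaf balloon: a negative loop, or a nontrivial balloon of valency 1. -/
def IsLeafBalloon (ends : E → Sym2 V) (sgn : E → Bool) (B : Finset E) : Prop :=
  IsNegLoopBalloon ends sgn B ∨
    ∃ v : V, B = compBalloon ends v ∧ B.Nonempty ∧ balloonValency ends v = 1

/-- A leaf circuit: a negative loop, or a balloon of valency 1 which is a circuit. -/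
def IsLeafCircuit (ends : E → Sym2 V) (sgn : E → Bool) (B : Finset E) : Prop :=
  IsNegLoopBalloon ends sgn B ∨
    ∃ v : V, B = compBalloon ends v ∧ IsCircuit ends B ∧ balloonValency ends v = 1

/-- An inner circuit: a balloon of valency at least 2 which is a circuit. -/
def IsInnerCircuit (ends : E → Sym2 V) (B : Finset E) : Prop :=
  ∃ v : V, B = compBalloon ends v ∧ IsCircuit ends B ∧ 2 ≤ balloonValency ends v

/-- Number of unbalanced circuits of a tree of circuits: negative loops together
with the unbalanced (nontrivial) balloons. -/
def numUnbalancedCircuits (ends : E → Sym2 V) (sgn : E → Bool) : ℕ :=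
  (Finset.univ.filter fun e : E => IsLoop ends e ∧ sgn e = true).card +
    Set.ncard {B : Finset E |
      (∃ v : V, B = compBalloon ends v) ∧ B.Nonempty ∧ Odd (negEdges sgn B).card}

/-- Flow-admissibility: every edge lies in a signed circuit (Bouchet). -/
def FlowAdmissible (ends : E → Sym2 V) (sgn : E → Bool) : Prop :=
  ∀ e : E, ∃ C : Finset E, IsSignedCircuit ends sgn C ∧ e ∈ C

/-- `e` has exactly one end-vertex in `U`. -/
def crosses (ends : E → Sym2 V) (U : Finset V) (e : E) : Prop :=
  ∃ a b : V, ends e = s(a, b) ∧ ((a ∈ U ∧ b ∉ U) ∨ (a ∉ U ∧ b ∈ U))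

/-- Switching the signature at the vertex set `U`. -/
def switch (ends : E → Sym2 V) (U : Finset V) (sgn : E → Bool) : E → Bool :=
  fun e => if crosses ends U e then ! (sgn e) else sgn e

/-- The number of negative edges of a signature. -/
def negCount (sgn : E → Bool) : ℕ := (Finset.univ.filter fun e => sgn e = true).card

/-- `sgn` is a minimum signature: no equivalent (switched) signature has fewer
negative edges. -/
def IsMinSignature (ends : E → Sym2 V) (sgn : E → Bool) : Prop :=
  ∀ U : Finset V, negCount sgn ≤ negCount (switch ends U sgn)

/-- `{e₁, e₂}` is a 2-edge-cut of the subgraph with edge set `F`. -/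
def IsTwoEdgeCut (ends : E → Sym2 V) (F : Finset E) (e₁ e₂ : E) : Prop :=
  e₁ ≠ e₂ ∧ e₁ ∈ F ∧ e₂ ∈ F ∧ ¬ IsBridgeIn ends F e₁ ∧ ¬ IsBridgeIn ends F e₂ ∧
    (∀ a b : V, ends e₁ = s(a, b) → ¬ Reach ends ((F.erase e₁).erase e₂) a b) ∧
    (∀ a b : V, ends e₂ = s(a, b) → ¬ Reach ends ((F.erase e₁).erase e₂) a b)

/-- `b` is a bridge of `F` whose removal leaves two parts which are both unbalanced. -/
def SeparatesUnbalanced (ends : E → Sym2 V) (sgn : E → Bool) (F : Finset E) (b : E) : Prop :=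
  IsBridgeIn ends F b ∧
    ∀ a c : V, ends b = s(a, c) →
      (∃ C ⊆ F.erase b, IsUnbalancedCircuit ends sgn C ∧
        ∃ w ∈ support ends C, Reach ends (F.erase b) a w) ∧
      (∃ C ⊆ F.erase b, IsUnbalancedCircuit ends sgn C ∧
        ∃ w ∈ support ends C, Reach ends (F.erase b) c w)

/-- `T` is a spanning tree of the whole graph: spanning, connected and acyclic. -/
def IsSpanningTree (ends : E → Sym2 V) (T : Finset E) : Prop :=
  (∀ u v : V, Reach ends T u v) ∧ ∀ C ⊆ T, ¬ IsCircuit ends C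

set_option linter.unusedSectionVars false
set_option linter.unusedSimpArgs false
set_option linter.unusedVariables false
set_option linter.unnecessarySimpa false
set_option linter.unusedDecidableInType false
set_option linter.unusedFintypeInType false

/-! ### Core infrastructure -/

/-- The incidence map given by two end functions. -/
def en (p q : E → V) : E → Sym2 V := fun e => s(p e, q e)

/-- Boundary operator. -/
def bd {A : Type} [AddCommGroup A] (p q : E → V) : (E → A) →+ (V → A) where
  toFun g v := ∑ e, ((if q e = v then g e else 0) - (if p e = v then g e else 0))
  map_zero' := by ext v; simp
  map_add' g h := by
    ext v
    simp only [Pi.add_apply, ← Finset.sum_add_distrib]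
    refine Finset.sum_congr rfl fun e _ => ?_
    split_ifs <;> abel

theorem bd_apply {A : Type} [AddCommGroup A] (p q : E → V) (g : E → A) (v : V) :
    bd p q g v = ∑ e, ((if q e = v then g e else 0) - (if p e = v then g e else 0)) := rfl

theorem cut_sum {A : Type} [AddCommGroup A] (p q : E → V) (g : E → A) (X : Finset V) :
    ∑ v ∈ X, bd p q g v =
      ∑ e, ((if q e ∈ X then g e else 0) - (if p e ∈ X then g e else 0)) := by
  simp only [bd_apply]
  rw [Finset.sum_comm]
  refine Finset.sum_congr rfl fun e _ => ?_
  rw [Finset.sum_sub_distrib, Finset.sum_ite_eq, Finset.sum_ite_eq]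

theorem bd_single {A : Type} [AddCommGroup A] (p q : E → V) (e : E) (x : A) :
    bd p q (Pi.single e x) = Pi.single (q e) x - Pi.single (p e) x := by
  ext v
  rw [bd_apply, Finset.sum_eq_single e]
  · simp [Pi.single_apply, eq_comm]
  · intro e' _ h; simp [Pi.single_apply, h]
  · simp

/-- `X` is closed under the edges of `F`. -/
def Cl (p q : E → V) (F : Finset E) (X : Finset V) : Prop := ∀ e ∈ F, (p e ∈ X ↔ q e ∈ X)

theorem reach_edge {p q : E → V} {F : Finset E} {e : E} (h : e ∈ F) :
    Reach (en p q) F (p e) (q e) := Relation.ReflTransGen.single ⟨e, h, rfl⟩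

theorem reach_symm {ends : E → Sym2 V} {F : Finset E} {u v : V} (h : Reach ends F u v) :
    Reach ends F v u := by
  induction h with
  | refl => exact Relation.ReflTransGen.refl
  | tail _ h ih =>
    obtain ⟨e, he, h⟩ := h
    exact Relation.ReflTransGen.head ⟨e, he, by rw [h, Sym2.eq_swap]⟩ ih

theorem reach_mono {ends : E → Sym2 V} {F F' : Finset E} (hF : F ⊆ F') {u v : V}
    (h : Reach ends F u v) : Reach ends F' u v := by
  induction h with
  | refl => exact Relation.ReflTransGen.refl
  | tail _ h ih =>
    obtain ⟨e, he, h⟩ := h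
    exact Relation.ReflTransGen.tail ih ⟨e, hF he, h⟩

theorem reach_cl {p q : E → V} {F : Finset E} {X : Finset V} (hX : Cl p q F X) {u v : V}
    (h : Reach (en p q) F u v) : u ∈ X ↔ v ∈ X := by
  induction h with
  | refl => rfl
  | tail _ h ih =>
    rw [ih]
    obtain ⟨e, he, h⟩ := h
    have := hX e he
    simp only [en, Sym2.eq_iff] at h
    rcases h with ⟨h1, h2⟩ | ⟨h1, h2⟩
    · rw [← h1, ← h2, this]
    · rw [← h1, ← h2, this]

/-- The set of vertices reachable from `u`. -/
def rs (p q : E → V) (F : Finset E) (u : V) : Finset V :=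
  Finset.univ.filter fun v => Reach (en p q) F u v

theorem mem_rs {p q : E → V} {F : Finset E} {u v : V} :
    v ∈ rs p q F u ↔ Reach (en p q) F u v := by simp [rs]

theorem self_mem_rs {p q : E → V} {F : Finset E} {u : V} : u ∈ rs p q F u :=
  mem_rs.2 Relation.ReflTransGen.refl

theorem cl_rs (p q : E → V) (F : Finset E) (u : V) : Cl p q F (rs p q F u) := by
  intro e he
  rw [mem_rs, mem_rs]
  exact ⟨fun h => h.trans (reach_edge he), fun h => h.trans (reach_symm (reach_edge he))⟩

theorem Cl.mono {p q : E → V} {F F' : Finset E} {X : Finset V} (h : Cl p q F X) (hF : F' ⊆ F) :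
    Cl p q F' X := fun e he => h e (hF he)

theorem unit_path {A : Type} [AddCommGroup A] {p q : E → V} {F : Finset E} {u v : V}
    (h : Reach (en p q) F u v) (x : A) :
    ∃ g : E → A, (∀ e, e ∉ F → g e = 0) ∧ bd p q g = Pi.single v x - Pi.single u x := by
  induction h with
  | refl => exact ⟨0, by simp, by simp⟩
  | tail _ h ih =>
    obtain ⟨g, h0, hg⟩ := ih
    obtain ⟨e, he, h⟩ := h
    simp only [en, Sym2.eq_iff] at h
    rcases h with ⟨h1, h2⟩ | ⟨h1, h2⟩
    · refine ⟨g + Pi.single e x, ?_, ?_⟩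
      · intro e' he'
        have : e' ≠ e := by rintro rfl; exact he' he
        simp [h0 e' he', this]
      · rw [map_add, hg, bd_single, h1, h2]; abel
    · refine ⟨g - Pi.single e x, ?_, ?_⟩
      · intro e' he'
        have : e' ≠ e := by rintro rfl; exact he' he
        simp [h0 e' he', this]
      · rw [map_sub, hg, bd_single, h1, h2]; abel

/-- Indicator in `ZMod 2`. -/
def ind (F : Finset E) : E → ZMod 2 := fun e => if e ∈ F then 1 else 0

theorem ind_inj {F G : Finset E} (h : ind F = ind G) : F = G := by
  ext e
  have := congrFun h e
  simp only [ind] at this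
  by_cases h1 : e ∈ F <;> by_cases h2 : e ∈ G <;> simp_all

theorem ind_symmDiff (F G : Finset E) : ind (symmDiff F G) = ind F + ind G := by
  ext e
  simp only [ind, Finset.mem_symmDiff, Pi.add_apply]
  by_cases h1 : e ∈ F <;> by_cases h2 : e ∈ G <;> simp [h1, h2]
  decide

theorem ind_union {F G : Finset E} (h : Disjoint F G) : ind (F ∪ G) = ind F + ind G := by
  ext e
  simp only [ind, Finset.mem_union, Pi.add_apply]
  have hh : e ∈ F → e ∉ G := fun h1 => Finset.disjoint_left.1 h h1
  by_cases h1 : e ∈ F <;> by_cases h2 : e ∈ G <;> simp_all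

theorem ind_sdiff {F G : Finset E} (h : G ⊆ F) : ind (F \ G) = ind F + ind G := by
  have : F \ G = symmDiff F G := by
    ext e; simp only [Finset.mem_sdiff, Finset.mem_symmDiff]
    have := @h e; tauto
  rw [this, ind_symmDiff]

theorem ind_singleton (e : E) : ind ({e} : Finset E) = Pi.single e 1 := by
  ext e'; simp [ind, Pi.single_apply]

theorem exists_ind (g : E → ZMod 2) : ∃ F : Finset E, ind F = g ∧ ∀ e, e ∈ F ↔ g e ≠ 0 := by
  refine ⟨Finset.univ.filter fun e => g e ≠ 0, ?_, by simp⟩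
  ext e
  simp only [ind, Finset.mem_filter, Finset.mem_univ, true_and]
  generalize g e = x
  revert x; decide

theorem ind_ne {F : Finset E} {e : E} : ind F e ≠ 0 ↔ e ∈ F := by
  simp [ind]

/-- Boundary mod 2 of an edge set. -/
def bz (p q : E → V) (F : Finset E) : V → ZMod 2 := bd p q (ind F)

/-- Even edge set. -/
def Ev (p q : E → V) (F : Finset E) : Prop := bz p q F = 0

theorem bz_symmDiff (p q : E → V) (F G : Finset E) :
    bz p q (symmDiff F G) = bz p q F + bz p q G := by simp [bz, ind_symmDiff]

theorem bz_union (p q : E → V) {F G : Finset E} (h : Disjoint F G) :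
    bz p q (F ∪ G) = bz p q F + bz p q G := by simp [bz, ind_union h]

theorem bz_sdiff (p q : E → V) {F G : Finset E} (h : G ⊆ F) :
    bz p q (F \ G) = bz p q F + bz p q G := by simp [bz, ind_sdiff h]

theorem bz_empty (p q : E → V) : bz p q ∅ = 0 := by
  have : ind (∅ : Finset E) = 0 := by ext; simp [ind]
  simp [bz, this]

theorem bz_singleton (p q : E → V) (e : E) :
    bz p q {e} = Pi.single (q e) 1 - Pi.single (p e) 1 := by
  rw [bz, ind_singleton, bd_single]

theorem z2_add_self (x : V → ZMod 2) : x + x = 0 := by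
  ext v; exact CharTwo.add_self_eq_zero _

theorem z2_sub (x y : V → ZMod 2) : x - y = x + y := by
  ext v; exact CharTwo.sub_eq_add _ _

theorem degree_eq (p q : E → V) (F : Finset E) (v : V) :
    degree (en p q) F v =
      ∑ e ∈ F, ((if q e = v then 1 else 0) + (if p e = v then 1 else 0)) := by
  unfold degree
  refine Finset.sum_congr rfl fun e _ => ?_
  have : (Sym2.diag v : Sym2 V) = s(v, v) := rfl
  simp only [en, this, Sym2.eq_iff, Sym2.mem_iff]
  by_cases h1 : p e = v <;> by_cases h2 : q e = v <;> simp [h1, h2, eq_comm]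
  exact ⟨fun h => h1 h.symm, fun h => h2 h.symm⟩

theorem degree_cast (p q : E → V) (F : Finset E) (v : V) :
    ((degree (en p q) F v : ℕ) : ZMod 2) = bz p q F v := by
  rw [degree_eq, bz, bd_apply]
  push_cast
  rw [← Finset.sum_subset (Finset.subset_univ F)]
  · refine Finset.sum_congr rfl fun e he => ?_
    rw [CharTwo.sub_eq_add]
    simp [ind, he]
  · intro e _ he; simp [ind, he]

theorem ev_iff (p q : E → V) (F : Finset E) : Ev p q F ↔ ∀ v, Even (degree (en p q) F v) := by
  constructor
  · intro h v
    rw [← ZMod.natCast_eq_zero_iff_even, degree_cast, h]; rfl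
  · intro h
    ext v
    rw [← degree_cast, ZMod.natCast_eq_zero_iff_even.2 (h v)]; rfl

theorem Ev.symmDiff {p q : E → V} {F G : Finset E} (hF : Ev p q F) (hG : Ev p q G) :
    Ev p q (symmDiff F G) := by
  unfold Ev at *; rw [bz_symmDiff, hF, hG, add_zero]

theorem Ev.sdiff {p q : E → V} {F G : Finset E} (hF : Ev p q F) (hG : Ev p q G) (h : G ⊆ F) :
    Ev p q (F \ G) := by
  unfold Ev at *; rw [bz_sdiff p q h, hF, hG, add_zero]

theorem Ev.union {p q : E → V} {F G : Finset E} (hF : Ev p q F) (hG : Ev p q G)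
    (h : Disjoint F G) : Ev p q (F ∪ G) := by
  unfold Ev at *; rw [bz_union p q h, hF, hG, add_zero]

theorem ev_empty (p q : E → V) : Ev p q ∅ := bz_empty p q

/-- Crossing edges. -/
def cr (p q : E → V) (X : Finset V) (e : E) : Prop := ¬ (p e ∈ X ↔ q e ∈ X)

theorem cut_parity (p q : E → V) (F : Finset E) (X : Finset V) :
    ∑ v ∈ X, bz p q F v = ((F.filter (cr p q X)).card : ZMod 2) := by
  rw [bz, cut_sum, Finset.card_filter]
  push_cast
  rw [← Finset.sum_subset (Finset.subset_univ F)]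
  · refine Finset.sum_congr rfl fun e he => ?_
    by_cases h1 : p e ∈ X <;> by_cases h2 : q e ∈ X <;> simp [ind, he, cr, h1, h2]
  · intro e _ he; simp [ind, he]

theorem cut_even {p q : E → V} {F : Finset E} (hF : Ev p q F) (X : Finset V) :
    Even (F.filter (cr p q X)).card := by
  rw [← ZMod.natCast_eq_zero_iff_even, ← cut_parity, hF]; simp

theorem cr_swap {p q : E → V} {X : Finset V} {e : E} :
    cr p q X e ↔ (p e ∈ X ∧ q e ∉ X) ∨ (p e ∉ X ∧ q e ∈ X) := by
  unfold cr; tauto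

/-- Either `e` lies in an even subset of `F`, or it is a cut edge. -/
theorem even_or_cut (p q : E → V) (F : Finset E) (e : E) (he : e ∈ F) :
    (∃ C, C ⊆ F ∧ Ev p q C ∧ e ∈ C) ∨
      ¬ Reach (en p q) (F.erase e) (p e) (q e) := by
  by_cases h : Reach (en p q) (F.erase e) (p e) (q e)
  · left
    obtain ⟨g, h0, hg⟩ := unit_path h (1 : ZMod 2)
    obtain ⟨P, hP, hP'⟩ := exists_ind g
    have heP : e ∉ P := by rw [hP', h0 e (by simp)]; simp
    refine ⟨insert e P, ?_, ?_, by simp⟩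
    · intro e' he'
      rcases Finset.mem_insert.1 he' with rfl | h'
      · exact he
      · by_contra hh
        exact (hP' e').1 h' (h0 e' (by simp [hh]))
    · have : insert e P = {e} ∪ P := rfl
      rw [Ev, this, bz_union p q (by simpa using heP), bz_singleton]
      rw [bz, hP, hg, z2_add_self]
  · exact Or.inr h

theorem not_ev_of_cut {p q : E → V} {F : Finset E} {e : E}
    (h : ¬ Reach (en p q) (F.erase e) (p e) (q e)) {C : Finset E} (hC : C ⊆ F)
    (hE : Ev p q C) : e ∉ C := by
  intro he
  have h1 := cut_even hE (rs p q (F.erase e) (p e))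
  have : C.filter (cr p q (rs p q (F.erase e) (p e))) = {e} := by
    ext e'
    simp only [Finset.mem_filter, Finset.mem_singleton]
    constructor
    · rintro ⟨h1, h2⟩
      by_contra hne
      exact h2 (cl_rs p q (F.erase e) (p e) e' (by simp [hne, hC h1]))
    · rintro rfl
      refine ⟨he, ?_⟩
      unfold cr
      rw [mem_rs, mem_rs]
      intro hh
      exact h (hh.1 Relation.ReflTransGen.refl)
  rw [this] at h1
  simp at h1


/-! ### Paths and circuits -/

inductive DPath (st : E → V → V → Prop) : V → V → Finset E → Finset V → Prop
  | nil (v : V) : DPath st v v ∅ {v}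
  | cons {e : E} {u w v : V} {P : Finset E} {S : Finset V} : st e u w → DPath st w v P S → u ∉ S →
      DPath st u v (insert e P) (insert u S)

theorem DPath.left_mem {st : E → V → V → Prop} {u v : V} {P : Finset E} {S : Finset V}
    (h : DPath st u v P S) : u ∈ S := by cases h <;> simp

theorem DPath.right_mem {st : E → V → V → Prop} {u v : V} {P : Finset E} {S : Finset V}
    (h : DPath st u v P S) : v ∈ S := by
  induction h with
  | nil => simp
  | cons _ _ _ ih => simp [ih]

theorem DPath.suffix {st : E → V → V → Prop} {u v : V} {P : Finset E} {S : Finset V}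
    (h : DPath st u v P S) {x : V} (hx : x ∈ S) :
    ∃ P' S', P' ⊆ P ∧ S' ⊆ S ∧ DPath st x v P' S' := by
  induction h with
  | nil v =>
    rw [Finset.mem_singleton] at hx; subst hx
    exact ⟨∅, {x}, by simp, by simp, DPath.nil x⟩
  | cons h1 h2 h3 ih =>
    rcases Finset.mem_insert.1 hx with rfl | hx
    · exact ⟨_, _, subset_rfl, subset_rfl, DPath.cons h1 h2 h3⟩
    · obtain ⟨P', S', a, b, c⟩ := ih hx
      exact ⟨P', S', a.trans (Finset.subset_insert _ _), b.trans (Finset.subset_insert _ _), c⟩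

theorem DPath.exists {st : E → V → V → Prop} {u v : V}
    (h : Relation.ReflTransGen (fun a b => ∃ e, st e a b) u v) : ∃ P S, DPath st u v P S := by
  induction h using Relation.ReflTransGen.head_induction_on with
  | refl => exact ⟨_, _, DPath.nil v⟩
  | head h _ ih =>
    rename_i a c _
    obtain ⟨P, S, h'⟩ := ih
    obtain ⟨e, he⟩ := h
    by_cases ha : a ∈ S
    · obtain ⟨P', S', _, _, h⟩ := h'.suffix ha
      exact ⟨P', S', h⟩
    · exact ⟨_, _, DPath.cons he h' ha⟩

theorem DPath.edge {st : E → V → V → Prop} {u v : V} {P : Finset E} {S : Finset V}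
    (h : DPath st u v P S) {e : E} (he : e ∈ P) : ∃ a b, st e a b ∧ a ∈ S ∧ b ∈ S ∧ a ≠ b := by
  induction h with
  | nil => simp at he
  | cons h1 h2 h3 ih =>
    rcases Finset.mem_insert.1 he with rfl | he
    · refine ⟨_, _, h1, by simp, by simp [h2.left_mem], ?_⟩
      rintro rfl; exact h3 h2.left_mem
    · obtain ⟨a, b, x, y, z, t⟩ := ih he
      exact ⟨a, b, x, by simp [y], by simp [z], t⟩

theorem DPath.firstHit {st : E → V → V → Prop} {u v : V} {P : Finset E} {S : Finset V}
    (h : DPath st u v P S) (W : Finset V) (hv : v ∈ W) :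
    ∃ z P' S', P' ⊆ P ∧ S' ⊆ S ∧ DPath st u z P' S' ∧ S' ∩ W = {z} := by
  induction h with
  | nil v => exact ⟨v, ∅, {v}, by simp, by simp, DPath.nil v, by simp [hv]⟩
  | cons h1 h2 h3 ih =>
    rename_i e u w v P S
    by_cases hu : u ∈ W
    · exact ⟨u, ∅, {u}, by simp, by simp, DPath.nil u, by simp [hu]⟩
    · obtain ⟨z, P', S', a, b, c, d⟩ := ih hv
      refine ⟨z, insert e P', insert u S', Finset.insert_subset_insert _ a,
        Finset.insert_subset_insert _ b, DPath.cons h1 c fun h => h3 (b h), ?_⟩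
      rw [Finset.insert_inter_of_notMem hu, d]

theorem DPath.lastHit {st : E → V → V → Prop} {u v : V} {P : Finset E} {S : Finset V}
    (h : DPath st u v P S) (W : Finset V) (hW : ∃ x ∈ S, x ∈ W) :
    ∃ z P' S', P' ⊆ P ∧ S' ⊆ S ∧ DPath st z v P' S' ∧ S' ∩ W = {z} := by
  induction h with
  | nil v =>
    obtain ⟨x, hx, hx'⟩ := hW
    rw [Finset.mem_singleton] at hx; subst hx
    exact ⟨x, ∅, {x}, by simp, by simp, DPath.nil x, by simp [hx']⟩
  | cons h1 h2 h3 ih =>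
    rename_i e u w v P S
    by_cases hS : ∃ x ∈ S, x ∈ W
    · obtain ⟨z, P', S', a, b, c, d⟩ := ih hS
      exact ⟨z, P', S', a.trans (Finset.subset_insert _ _), b.trans (Finset.subset_insert _ _), c, d⟩
    · refine ⟨u, _, _, subset_rfl, subset_rfl, DPath.cons h1 h2 h3, ?_⟩
      obtain ⟨x, hx, hx'⟩ := hW
      have hxu : x = u := by
        rcases Finset.mem_insert.1 hx with h | h
        · exact h
        · exact absurd ⟨x, h, hx'⟩ hS
      subst hxu
      rw [Finset.insert_inter_of_mem hx']
      have : S ∩ W = ∅ := by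
        ext y; simp only [Finset.mem_inter, Finset.notMem_empty, iff_false]
        rintro ⟨h, h'⟩; exact hS ⟨y, h, h'⟩
      rw [this]; rfl

theorem DPath.ear {st : E → V → V → Prop} {u v : V} {P : Finset E} {S : Finset V}
    (h : DPath st u v P S) (W : Finset V) (huv : u ≠ v) (hu : u ∈ W) (hv : v ∈ W) :
    ∃ z P' S', P' ⊆ P ∧ S' ⊆ S ∧ DPath st u z P' S' ∧ S' ∩ W = {u, z} ∧ u ≠ z := by
  cases h with
  | nil => exact absurd rfl huv
  | cons h1 h2 h3 =>
    rename_i e w P S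
    obtain ⟨z, P', S', a, b, c, d⟩ := h2.firstHit W hv
    have hz : z ∈ S' := c.right_mem
    refine ⟨z, insert e P', insert u S', Finset.insert_subset_insert _ a,
        Finset.insert_subset_insert _ b, DPath.cons h1 c fun h => h3 (b h), ?_, ?_⟩
    · rw [Finset.insert_inter_of_mem hu, d]
    · rintro rfl; exact h3 (b hz)

theorem DPath.chi {p q : E → V} {st : E → V → V → Prop}
    (hst : ∀ e a b, st e a b → en p q e = s(a, b)) {u v : V} {P : Finset E} {S : Finset V}
    (h : DPath st u v P S) : ∃ χ : E → ℤ, (∀ e, e ∉ P → χ e = 0) ∧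
      (∀ e ∈ P, (χ e = 1 ∧ st e (p e) (q e)) ∨ (χ e = -1 ∧ st e (q e) (p e))) ∧
      bd p q χ = Pi.single v 1 - Pi.single u 1 := by
  induction h with
  | nil => exact ⟨0, by simp, by simp, by simp⟩
  | cons h1 h2 h3 ih =>
    rename_i e u w v P S
    obtain ⟨χ, ha, hb, hc⟩ := ih
    have heP : e ∉ P := by
      intro he
      obtain ⟨a, b, h4, h5, h6, _⟩ := h2.edge he
      have := (hst _ _ _ h1).symm.trans (hst _ _ _ h4)
      rw [Sym2.eq_iff] at this
      rcases this with ⟨rfl, rfl⟩ | ⟨rfl, rfl⟩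
      · exact h3 h5
      · exact h3 h6
    have h4 := hst _ _ _ h1
    simp only [en, Sym2.eq_iff] at h4
    rcases h4 with ⟨rfl, rfl⟩ | ⟨rfl, rfl⟩
    · refine ⟨χ + Pi.single e 1, ?_, ?_, ?_⟩
      · intro e' he'
        simp only [Finset.mem_insert, not_or] at he'
        simp [ha e' he'.2, he'.1]
      · intro e' he'
        by_cases hee : e' = e
        · subst hee
          left; simp [ha e' heP, h1]
        · have := hb e' ((Finset.mem_insert.1 he').resolve_left hee)
          simpa [hee] using this
      · rw [map_add, hc, bd_single]; abel
    · refine ⟨χ - Pi.single e 1, ?_, ?_, ?_⟩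
      · intro e' he'
        simp only [Finset.mem_insert, not_or] at he'
        simp [ha e' he'.2, he'.1]
      · intro e' he'
        by_cases hee : e' = e
        · subst hee
          right; simp [ha e' heP, h1]
        · have := hb e' ((Finset.mem_insert.1 he').resolve_left hee)
          simpa [hee] using this
      · rw [map_sub, hc, bd_single]; abel

/-- Undirected steps in `F`. -/
def us (p q : E → V) (F : Finset E) : E → V → V → Prop := fun e a b => e ∈ F ∧ en p q e = s(a, b)

theorem DPath.sub {p q : E → V} {F : Finset E} {u v : V} {P : Finset E} {S : Finset V}
    (h : DPath (us p q F) u v P S) : P ⊆ F := fun _ he => by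
  obtain ⟨a, b, x, _⟩ := h.edge he; exact x.1

theorem DPath.of_reach {p q : E → V} {F : Finset E} {u v : V} (h : Reach (en p q) F u v) :
    ∃ P S, DPath (us p q F) u v P S := DPath.exists h

theorem DPath.ends_mem {p q : E → V} {F : Finset E} {u v : V} {P : Finset E} {S : Finset V}
    (h : DPath (us p q F) u v P S) {e : E} (he : e ∈ P) : p e ∈ S ∧ q e ∈ S ∧ p e ≠ q e := by
  obtain ⟨a, b, h1, h2, h3, h4⟩ := h.edge he
  have := h1.2
  simp only [en, Sym2.eq_iff] at this
  rcases this with ⟨rfl, rfl⟩ | ⟨rfl, rfl⟩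
  · exact ⟨h2, h3, h4⟩
  · exact ⟨h3, h2, h4.symm⟩

theorem DPath.reach {p q : E → V} {F : Finset E} {u v : V} {P : Finset E} {S : Finset V}
    (h : DPath (us p q F) u v P S) {x : V} (hx : x ∈ S) : Reach (en p q) P x v := by
  induction h generalizing x with
  | nil v => rw [Finset.mem_singleton] at hx; subst hx; exact Relation.ReflTransGen.refl
  | cons h1 h2 h3 ih =>
    rcases Finset.mem_insert.1 hx with rfl | hx
    · exact Relation.ReflTransGen.head ⟨_, Finset.mem_insert_self _ _, h1.2⟩
        (reach_mono (Finset.subset_insert _ _) (ih h2.left_mem))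
    · exact reach_mono (Finset.subset_insert _ _) (ih hx)

theorem mem_support {p q : E → V} {F : Finset E} {v : V} :
    v ∈ support (en p q) F ↔ ∃ e ∈ F, v = p e ∨ v = q e := by
  simp [support, en]

theorem support_mono {p q : E → V} {F G : Finset E} (h : F ⊆ G) :
    support (en p q) F ⊆ support (en p q) G := by
  intro v; rw [mem_support, mem_support]
  rintro ⟨e, he, h'⟩; exact ⟨e, h he, h'⟩

theorem support_union {p q : E → V} {F G : Finset E} :
    support (en p q) (F ∪ G) = support (en p q) F ∪ support (en p q) G := by
  ext v; simp only [Finset.mem_union, mem_support]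
  constructor
  · rintro ⟨e, he | he, h⟩
    · exact Or.inl ⟨e, he, h⟩
    · exact Or.inr ⟨e, he, h⟩
  · rintro (⟨e, he, h⟩ | ⟨e, he, h⟩)
    · exact ⟨e, Or.inl he, h⟩
    · exact ⟨e, Or.inr he, h⟩

theorem degree_union {p q : E → V} {F G : Finset E} (h : Disjoint F G) (v : V) :
    degree (en p q) (F ∪ G) v = degree (en p q) F v + degree (en p q) G v := by
  simp only [degree_eq, Finset.sum_union h]

theorem degree_insert {p q : E → V} {F : Finset E} {e : E} (h : e ∉ F) {a b : V}
    (hab : en p q e = s(a, b)) (v : V) :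
    degree (en p q) (insert e F) v =
      degree (en p q) F v + (if v = a then 1 else 0) + (if v = b then 1 else 0) := by
  simp only [degree_eq, Finset.sum_insert h]
  simp only [en, Sym2.eq_iff] at hab
  rcases hab with ⟨rfl, rfl⟩ | ⟨rfl, rfl⟩ <;> simp only [eq_comm (a := v)] <;> ring

theorem degree_pos {p q : E → V} {F : Finset E} {v : V} :
    0 < degree (en p q) F v ↔ v ∈ support (en p q) F := by
  rw [degree_eq, Finset.sum_pos_iff, mem_support]
  refine exists_congr fun e => and_congr_right fun _ => ?_
  by_cases h1 : q e = v <;> by_cases h2 : p e = v <;> simp [h1, h2, eq_comm]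
  exact ⟨fun h => h2 h.symm, fun h => h1 h.symm⟩

theorem DPath.degree {p q : E → V} {F : Finset E} {u v : V} {P : Finset E} {S : Finset V}
    (h : DPath (us p q F) u v P S) (x : V) :
    SignedCircuitCover.degree (en p q) P x + (if x = u then 1 else 0) + (if x = v then 1 else 0) =
      if x ∈ S then 2 else 0 := by
  induction h with
  | nil v =>
    by_cases h : x = v <;> simp [degree_eq, h]
  | cons h1 h2 h3 ih =>
    rename_i e u w v P S
    have heP : e ∉ P := by
      intro he
      have h4 := h2.ends_mem he
      have := h1.2
      simp only [en, Sym2.eq_iff] at this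
      rcases this with ⟨rfl, rfl⟩ | ⟨rfl, rfl⟩
      · exact h3 h4.1
      · exact h3 h4.2.1
    rw [degree_insert heP h1.2]
    by_cases hx : x = u
    · subst hx
      simp only [h3, Finset.mem_insert_self, if_true, if_false] at ih ⊢
      omega
    · simp only [Finset.mem_insert, hx, false_or, if_false] at ih ⊢
      omega

theorem DPath.support_sub {p q : E → V} {F : Finset E} {u v : V} {P : Finset E} {S : Finset V}
    (h : DPath (us p q F) u v P S) : SignedCircuitCover.support (en p q) P ⊆ S := by
  intro x hx
  rw [mem_support] at hx
  obtain ⟨e, he, h1 | h1⟩ := hx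
  · rw [h1]; exact (h.ends_mem he).1
  · rw [h1]; exact (h.ends_mem he).2.1

theorem DPath.support_eq {p q : E → V} {F : Finset E} {u v : V} {P : Finset E} {S : Finset V}
    (h : DPath (us p q F) u v P S) (huv : u ≠ v) :
    SignedCircuitCover.support (en p q) P = S := by
  refine h.support_sub.antisymm fun x hx => ?_
  rw [← degree_pos]
  have := h.degree x
  rw [if_pos hx] at this
  split_ifs at this with h1 h2
  · exact absurd (h1.symm.trans h2) huv
  all_goals omega

theorem DPath.bz {p q : E → V} {F : Finset E} {u v : V} {P : Finset E} {S : Finset V}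
    (h : DPath (us p q F) u v P S) :
    SignedCircuitCover.bz p q P = Pi.single u 1 + Pi.single v 1 := by
  ext x
  have h1 := congrArg (Nat.cast : ℕ → ZMod 2) (h.degree x)
  have h2 : (((if x ∈ S then 2 else 0 : ℕ)) : ZMod 2) = 0 := by
    split_ifs <;> rfl
  rw [h2] at h1
  push_cast at h1
  rw [degree_cast] at h1
  have h3 := eq_neg_of_add_eq_zero_left (by rw [← add_assoc]; exact h1 :
    SignedCircuitCover.bz p q P x + ((if x = u then (1 : ZMod 2) else 0) + if x = v then 1 else 0) = 0)
  rw [h3, CharTwo.neg_eq]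
  simp [Pi.single_apply]

theorem DPath.isPath {p q : E → V} {F : Finset E} {u v : V} {P : Finset E} {S : Finset V}
    (h : DPath (us p q F) u v P S) (huv : u ≠ v) : IsPath (en p q) P u v := by
  have hs := h.support_eq huv
  have hu : u ∈ SignedCircuitCover.support (en p q) P := by rw [hs]; exact h.left_mem
  refine ⟨?_, ?_, huv, hu, ?_, ?_, ?_, ?_⟩
  · obtain ⟨e, he, _⟩ := mem_support.1 hu; exact ⟨e, he⟩
  · intro a ha b hb
    rw [hs] at ha hb
    exact (h.reach ha).trans (reach_symm (h.reach hb))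
  · rw [hs]; exact h.right_mem
  · have := h.degree u
    simp [huv, h.left_mem] at this; exact this
  · have := h.degree v
    simp [huv.symm, h.right_mem] at this; exact this
  · intro w hw h1 h2
    rw [hs] at hw
    have := h.degree w
    simpa [h1, h2, hw] using this

theorem DPath.circ_two {p q : E → V} {F F' : Finset E} {u v : V} {P P' : Finset E} {S S' : Finset V}
    (h : DPath (us p q F) u v P S) (h' : DPath (us p q F') u v P' S') (huv : u ≠ v)
    (hS : ∀ x, x ∈ S → x ∈ S' → x = u ∨ x = v) (hP : Disjoint P P') :
    IsCircuit (en p q) (P ∪ P') := by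
  have hs := h.support_eq huv
  have hs' := h'.support_eq huv
  refine ⟨?_, ?_, ?_⟩
  · exact (h.isPath huv).1.mono Finset.subset_union_left
  · have : ∀ x ∈ SignedCircuitCover.support (en p q) (P ∪ P'), Reach (en p q) (P ∪ P') x v := by
      intro x hx
      rw [support_union, hs, hs', Finset.mem_union] at hx
      rcases hx with hx | hx
      · exact reach_mono Finset.subset_union_left (h.reach hx)
      · exact reach_mono Finset.subset_union_right (h'.reach hx)
    intro a ha b hb
    exact (this a ha).trans (reach_symm (this b hb))
  · intro x hx
    rw [support_union, hs, hs', Finset.mem_union] at hx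
    rw [degree_union hP]
    have h1 := h.degree x
    have h2 := h'.degree x
    by_cases hxu : x = u
    · subst hxu
      simp [huv, h.left_mem, h'.left_mem] at h1 h2; omega
    by_cases hxv : x = v
    · subst hxv
      simp [huv.symm, h.right_mem, h'.right_mem] at h1 h2; omega
    simp only [hxu, hxv, if_false, add_zero] at h1 h2
    by_cases ha : x ∈ S <;> by_cases hb : x ∈ S'
    · rcases hS x ha hb with h | h
      · exact absurd h hxu
      · exact absurd h hxv
    · simp [ha, hb] at h1 h2; omega
    · simp [ha, hb] at h1 h2; omega
    · exact absurd hx (by simp [ha, hb])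

theorem DPath.circ_close {p q : E → V} {F : Finset E} {u v : V} {P : Finset E} {S : Finset V}
    (h : DPath (us p q F) u v P S) {e : E} (he : e ∉ P) (hab : en p q e = s(u, v)) :
    IsCircuit (en p q) (insert e P) := by
  have hd : ∀ x, SignedCircuitCover.degree (en p q) (insert e P) x = if x ∈ S then 2 else 0 := by
    intro x; rw [degree_insert he hab, h.degree]
  have hs : ∀ x, x ∈ SignedCircuitCover.support (en p q) (insert e P) ↔ x ∈ S := by
    intro x; rw [← degree_pos, hd]; by_cases hx : x ∈ S <;> simp [hx]
  refine ⟨⟨e, by simp⟩, ?_, ?_⟩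
  · intro a ha b hb
    rw [hs] at ha hb
    exact reach_mono (Finset.subset_insert _ _) ((h.reach ha).trans (reach_symm (h.reach hb)))
  · intro x hx
    rw [hd, if_pos ((hs x).1 hx)]

theorem IsCircuit.ev {p q : E → V} {C : Finset E} (h : IsCircuit (en p q) C) : Ev p q C := by
  rw [ev_iff]
  intro v
  by_cases hv : v ∈ support (en p q) C
  · rw [h.2.2 v hv]; decide
  · rw [← degree_pos] at hv
    rw [Nat.eq_zero_of_not_pos hv]; decide

theorem IsCircuit.minimal {p q : E → V} {C : Finset E} (h : IsCircuit (en p q) C) {F : Finset E}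
    (hF : F ⊆ C) (hne : F.Nonempty) (hE : Ev p q F) : F = C := by
  have key : ∀ v ∈ support (en p q) F, ∀ e ∈ C, v = p e ∨ v = q e → e ∈ F := by
    intro v hv e he hve
    by_contra hn
    have h1 := degree_union (p := p) (q := q) (F := F) (G := C \ F) Finset.disjoint_sdiff v
    rw [Finset.union_sdiff_of_subset hF, h.2.2 v (support_mono hF hv)] at h1
    have h2 : 0 < degree (en p q) F v := degree_pos.2 hv
    have h3 : 0 < degree (en p q) (C \ F) v :=
      degree_pos.2 (mem_support.2 ⟨e, by simp [he, hn], hve⟩)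
    have h4 := (ev_iff p q F).1 hE v
    obtain ⟨k, hk⟩ := h4
    omega
  have hcl : Cl p q C (support (en p q) F) := by
    intro e he
    constructor
    · intro h1
      exact mem_support.2 ⟨e, key _ h1 e he (Or.inl rfl), Or.inr rfl⟩
    · intro h1
      exact mem_support.2 ⟨e, key _ h1 e he (Or.inr rfl), Or.inl rfl⟩
  refine hF.antisymm fun e he => ?_
  obtain ⟨f, hf⟩ := hne
  have hf' : p f ∈ support (en p q) F := mem_support.2 ⟨f, hf, Or.inl rfl⟩
  have he' : p e ∈ support (en p q) C := mem_support.2 ⟨e, he, Or.inl rfl⟩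
  have := (reach_cl hcl (h.2.1 _ (support_mono hF hf') _ he')).1 hf'
  exact key _ this e he (Or.inl rfl)

theorem exists_circuit {p q : E → V} {F : Finset E} (hF : Ev p q F) {e : E} (he : e ∈ F) :
    ∃ C ⊆ F, IsCircuit (en p q) C ∧ e ∈ C := by
  by_cases h : Reach (en p q) (F.erase e) (p e) (q e)
  · obtain ⟨P, S, hP⟩ := DPath.of_reach h
    have hs := hP.sub
    refine ⟨insert e P, ?_, hP.circ_close (fun h => by simpa using hs h) rfl, by simp⟩
    exact Finset.insert_subset he (hs.trans (Finset.erase_subset _ _))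
  · exact absurd he (not_ev_of_cut h subset_rfl hF)

/-- Veblen decomposition. -/
theorem veblen {p q : E → V} (F : Finset E) (hF : Ev p q F) :
    ∃ 𝒟 : Finset (Finset E), (∀ D ∈ 𝒟, IsCircuit (en p q) D) ∧
      (∀ D ∈ 𝒟, ∀ D' ∈ 𝒟, D ≠ D' → Disjoint D D') ∧ F = 𝒟.biUnion id := by
  induction hn : F.card using Nat.strong_induction_on generalizing F with
  | _ n ih =>
    rcases F.eq_empty_or_nonempty with rfl | ⟨e, he⟩
    · exact ⟨∅, by simp, by simp, by simp⟩
    obtain ⟨C, hC, hc, heC⟩ := exists_circuit hF he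
    obtain ⟨𝒟, h1, h2, h3⟩ := ih (F \ C).card (by
      rw [← hn]; exact Finset.card_lt_card ((Finset.ssubset_iff_of_subset Finset.sdiff_subset).2
        ⟨e, he, by simp [heC]⟩)) (F \ C) (hF.sdiff hc.ev hC) rfl
    have hd : ∀ D ∈ 𝒟, Disjoint C D := by
      intro D hD
      have : D ⊆ F \ C := by rw [h3]; exact Finset.subset_biUnion_of_mem id hD
      exact Finset.disjoint_of_subset_right this Finset.disjoint_sdiff
    refine ⟨insert C 𝒟, ?_, ?_, ?_⟩
    · intro D hD
      rcases Finset.mem_insert.1 hD with rfl | hD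
      · exact hc
      · exact h1 D hD
    · intro D hD D' hD' hne
      rcases Finset.mem_insert.1 hD with rfl | hE <;> rcases Finset.mem_insert.1 hD' with rfl | hE'
      · exact absurd rfl hne
      · exact hd _ hE'
      · exact (hd _ hE).symm
      · exact h2 _ hE _ hE' hne
    · rw [Finset.biUnion_insert, ← h3]; simp [Finset.union_sdiff_of_subset hC]

theorem reach_of_bz {p q : E → V} {D : Finset E} {u z : V}
    (h : bz p q D = Pi.single u 1 + Pi.single z 1) : Reach (en p q) D u z := by
  by_contra hn
  have h1 := cut_parity p q D (rs p q D u)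
  have h2 : D.filter (cr p q (rs p q D u)) = ∅ := by
    ext e; simp only [Finset.mem_filter, Finset.notMem_empty, iff_false]
    rintro ⟨he, hc⟩; exact hc (cl_rs p q D u e he)
  rw [h2, h] at h1
  simp only [Pi.add_apply, Finset.sum_add_distrib, Finset.sum_pi_single', self_mem_rs, if_true,
    mem_rs, hn, if_false] at h1
  simp at h1


/-! ### Lifting modular flows, halving -/

theorem bd_map {A B : Type} [AddCommGroup A] [AddCommGroup B] (f : A →+ B) (p q : E → V)
    (g : E → A) (v : V) : f (bd p q g v) = bd p q (fun e => f (g e)) v := by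
  rw [bd_apply, bd_apply, map_sum]
  refine Finset.sum_congr rfl fun e _ => ?_
  rw [map_sub]; split_ifs <;> simp

theorem bd_cast (n : ℕ) (p q : E → V) (g : E → ℤ) (v : V) :
    ((bd p q g v : ℤ) : ZMod n) = bd p q (fun e => (g e : ZMod n)) v :=
  bd_map (Int.castAddHom (ZMod n)) p q g v

theorem tutte (p q : E → V) (k : ℤ) (hk : 0 < k) (f : E → ℤ) (hf : ∀ e, 0 ≤ f e ∧ f e < k)
    (hd : ∀ v, k ∣ bd p q f v) :
    ∃ g : E → ℤ, bd p q g = 0 ∧ ∀ e, g e = f e ∨ (g e = f e - k ∧ f e ≠ 0) := by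
  have key : ∀ n : ℕ, ∀ g : E → ℤ, (∀ v, k ∣ bd p q g v) →
      (∀ e, g e = f e ∨ (g e = f e - k ∧ f e ≠ 0)) → ∑ v, (bd p q g v).natAbs = n →
      ∃ g : E → ℤ, bd p q g = 0 ∧ ∀ e, g e = f e ∨ (g e = f e - k ∧ f e ≠ 0) := by
    intro n
    induction n using Nat.strong_induction_on with
    | _ n ih =>
      intro g hg hL hn
      by_cases h0 : bd p q g = 0
      · exact ⟨g, h0, hL⟩
      have hneg : ∃ v, bd p q g v < 0 := by
        by_contra hcon
        push Not at hcon
        have hs := cut_sum p q g Finset.univ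
        simp only [Finset.mem_univ, if_true, sub_self, Finset.sum_const_zero] at hs
        apply h0
        ext v
        exact (Finset.sum_eq_zero_iff_of_nonneg (fun v _ => hcon v)).1 hs v (Finset.mem_univ v)
      obtain ⟨v, hv⟩ := hneg
      let st : E → V → V → Prop := fun e a b =>
        (p e = a ∧ q e = b ∧ 0 < g e) ∨ (q e = a ∧ p e = b ∧ g e < 0)
      have hst : ∀ e a b, st e a b → en p q e = s(a, b) := by
        rintro e a b (⟨rfl, rfl, _⟩ | ⟨rfl, rfl, _⟩)
        · rfl
        · exact Sym2.eq_swap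
      let X : Finset V := Finset.univ.filter fun w =>
        Relation.ReflTransGen (fun a b => ∃ e, st e a b) v w
      have hX : ∀ w, w ∈ X ↔ Relation.ReflTransGen (fun a b => ∃ e, st e a b) v w := by
        intro w; simp [X]
      have hcut : 0 ≤ ∑ w ∈ X, bd p q g w := by
        rw [cut_sum]
        refine Finset.sum_nonneg fun e _ => ?_
        by_cases h1 : q e ∈ X <;> by_cases h2 : p e ∈ X <;> simp only [h1, h2, if_true, if_false]
        · simp
        · by_contra hh
          exact h2 ((hX _).2 (((hX _).1 h1).tail ⟨e, Or.inr ⟨rfl, rfl, by omega⟩⟩))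
        · by_contra hh
          exact h1 ((hX _).2 (((hX _).1 h2).tail ⟨e, Or.inl ⟨rfl, rfl, by omega⟩⟩))
        · simp
      have hvX : v ∈ X := (hX v).2 Relation.ReflTransGen.refl
      have hw : ∃ w ∈ X, 0 < bd p q g w := by
        by_contra hcon
        push Not at hcon
        have := Finset.sum_lt_sum hcon ⟨v, hvX, hv⟩
        simp at this
        omega
      obtain ⟨w, hwX, hw⟩ := hw
      obtain ⟨P, S, hP⟩ := DPath.exists ((hX w).1 hwX)
      obtain ⟨χ, c1, c2, c3⟩ := hP.chi hst
      have hvw : v ≠ w := by rintro rfl; omega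
      have hbd : ∀ u, bd p q (g - k • χ) u =
          bd p q g u - (if u = w then k else 0) + (if u = v then k else 0) := by
        intro u
        rw [map_sub, map_zsmul, c3]
        simp only [Pi.sub_apply, Pi.smul_apply, Pi.single_apply, smul_eq_mul]
        split_ifs <;> ring
      have hdv : k ≤ - bd p q g v := Int.le_of_dvd (by omega) ((dvd_neg).2 (hg v))
      have hdw : k ≤ bd p q g w := Int.le_of_dvd hw (hg w)
      refine ih _ ?_ (g - k • χ) ?_ ?_ rfl
      · rw [← hn]
        refine Finset.sum_lt_sum ?_ ⟨v, Finset.mem_univ _, ?_⟩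
        · intro u _
          rw [hbd]
          by_cases h1 : u = w
          · subst h1; simp only [if_true, hvw.symm, if_false]; omega
          · by_cases h2 : u = v
            · subst h2; simp only [if_true, hvw, if_false]; omega
            · simp [h1, h2]
        · rw [hbd]; simp only [if_true, hvw, if_false]; omega
      · intro u
        rw [hbd]
        refine dvd_add (dvd_sub (hg u) ?_) ?_ <;> split_ifs <;> simp
      · intro e
        simp only [Pi.sub_apply, Pi.smul_apply, smul_eq_mul]
        by_cases he : e ∈ P
        · obtain ⟨a, b, x1, _, _, x2⟩ := hP.edge he
          have hpq : p e ≠ q e := by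
            rcases x1 with ⟨rfl, rfl, _⟩ | ⟨rfl, rfl, _⟩
            · exact x2
            · exact x2.symm
          have hfe := hf e
          have hLe := hL e
          rcases c2 e he with ⟨x3, x4⟩ | ⟨x3, x4⟩
          · have : 0 < g e := by
              rcases x4 with ⟨_, _, h⟩ | ⟨h, _⟩
              · exact h
              · exact absurd h.symm hpq
            right; rw [x3]; omega
          · have : g e < 0 := by
              rcases x4 with ⟨h, _⟩ | ⟨_, _, h⟩
              · exact absurd h hpq
              · exact h
            left; rw [x3]; omega
        · rw [c1 e he]; simpa using hL e
  exact key _ f hd (fun e => Or.inl rfl) rfl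

theorem pm_flow {p q : E → V} {C : Finset E} (hC : Ev p q C) :
    ∃ c : E → ℤ, bd p q c = 0 ∧ (∀ e ∈ C, c e = 1 ∨ c e = -1) ∧ ∀ e, e ∉ C → c e = 0 := by
  obtain ⟨g, h1, h2⟩ := tutte p q 2 (by norm_num) (fun e => if e ∈ C then 1 else 0)
    (by intro e; split_ifs <;> simp) (by
      intro v
      have := bd_cast 2 p q (fun e => if e ∈ C then 1 else 0) v
      have h3 : (fun e => (((if e ∈ C then 1 else 0 : ℤ)) : ZMod 2)) = ind C := by
        ext e; simp only [ind]; split_ifs <;> simp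
      rw [h3] at this
      have h4 : bd p q (ind C) v = 0 := congrFun hC v
      rw [h4] at this
      exact (ZMod.intCast_zmod_eq_zero_iff_dvd _ 2).1 this)
  refine ⟨g, h1, ?_, ?_⟩
  · intro e he
    have := h2 e
    simp only [he, if_true] at this
    omega
  · intro e he
    have := h2 e
    simpa [he] using this

theorem odd_ev {p q : E → V} {g : E → ℤ} (hg : bd p q g = 0) :
    ∃ A : Finset E, Ev p q A ∧ ∀ e, e ∈ A ↔ Odd (g e) := by
  obtain ⟨A, h1, h2⟩ := exists_ind (fun e => ((g e : ℤ) : ZMod 2))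
  refine ⟨A, ?_, ?_⟩
  · ext v
    rw [bz, h1, ← bd_cast, hg]; simp
  · intro e
    rw [h2, Ne, ← Int.not_even_iff_odd, ZMod.intCast_eq_zero_iff_even]

theorem z3_split {p q : E → V} {g : E → ZMod 3} (hg : bd p q g = 0) :
    ∃ A B : Finset E, Ev p q A ∧ Ev p q B ∧ ∀ e, (e ∈ A ∨ e ∈ B) ↔ g e ≠ 0 := by
  have hval : (fun e => ((((g e).val : ℕ) : ℤ) : ZMod 3)) = g := by
    ext e; simp
  obtain ⟨f, f1, f2⟩ := tutte p q 3 (by norm_num) (fun e => ((g e).val : ℤ))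
    (by intro e; have := ZMod.val_lt (g e); omega) (by
      intro v
      have := bd_cast 3 p q (fun e => (((g e).val : ℕ) : ℤ)) v
      rw [hval, hg] at this
      exact (ZMod.intCast_zmod_eq_zero_iff_dvd _ 3).1 this)
  have f0 : ∀ e, g e = 0 → f e = 0 := by
    intro e he
    have := f2 e
    simpa [he] using this
  have f3 : ∀ e, g e ≠ 0 → f e = 1 ∨ f e = -1 ∨ f e = 2 ∨ f e = -2 := by
    intro e he
    have h1 := ZMod.val_lt (g e)
    have h2 : (g e).val ≠ 0 := by rwa [Ne, ZMod.val_eq_zero]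
    have := f2 e
    omega
  obtain ⟨A, hA, hA'⟩ := odd_ev f1
  obtain ⟨c, c1, c2, c3⟩ := pm_flow hA
  have hev : ∀ e, 2 * ((f e + c e) / 2) = f e + c e := by
    intro e
    apply Int.mul_ediv_cancel'
    by_cases he : e ∈ A
    · have := (hA' e).1 he
      obtain ⟨m, hm⟩ := this
      rcases c2 e he with h | h <;> rw [h, hm] <;> omega
    · have := mt (hA' e).2 he
      rw [Int.not_odd_iff_even] at this
      obtain ⟨m, hm⟩ := this
      rw [c3 e he, hm]; omega
  have hψ : bd p q (fun e => (f e + c e) / 2) = 0 := by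
    have h2 : (2 : ℤ) • (fun e => (f e + c e) / 2) = f + c := by
      ext e; simpa using hev e
    have h3 := congrArg (bd p q) h2
    rw [map_zsmul, map_add, f1, c1] at h3
    ext v
    have := congrFun h3 v
    simpa using this
  obtain ⟨B, hB, hB'⟩ := odd_ev hψ
  refine ⟨A, B, hA, hB, ?_⟩
  intro e
  rw [hB', hA']
  constructor
  · intro h hz
    have h1 := f0 e hz
    have h2 : e ∉ A := by rw [hA', h1]; decide
    rw [h1, c3 e h2] at h
    revert h; decide
  · intro h
    rcases f3 e h with h | h | h | h
    · left; rw [h]; decide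
    · left; rw [h]; decide
    · right
      have h2 : e ∉ A := by rw [hA', h]; decide
      rw [h, c3 e h2]; decide
    · right
      have h2 : e ∉ A := by rw [hA', h]; decide
      rw [h, c3 e h2]; decide

/-- Edges of `F` lying in an even subset of `F`. -/
def nb (p q : E → V) (F : Finset E) : Finset E := F.filter fun e => ∃ C ⊆ F, Ev p q C ∧ e ∈ C

theorem half (p q : E → V) (F J : Finset E) (hJ : J ⊆ F) :
    ∃ J' ⊆ F, bz p q J' = bz p q J ∧ 2 * (J' ∩ nb p q F).card ≤ (nb p q F).card := by
  let 𝒞 : Finset (Finset E) := F.powerset.filter fun C => Ev p q C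
  have h𝒞 : ∀ C, C ∈ 𝒞 ↔ C ⊆ F ∧ Ev p q C := by intro C; simp [𝒞]
  have hne : 𝒞.Nonempty := ⟨∅, (h𝒞 _).2 ⟨by simp, ev_empty p q⟩⟩
  have hedge : ∀ e ∈ nb p q F, 2 * (𝒞.filter fun C => e ∈ symmDiff J C).card = 𝒞.card := by
    intro e he
    obtain ⟨_, Y, hY1, hY2, hY3⟩ := Finset.mem_filter.1 he
    have : (𝒞.filter fun C => e ∈ symmDiff J C).card =
        (𝒞.filter fun C => ¬ e ∈ symmDiff J C).card := by
      have hmem : ∀ C ∈ 𝒞, symmDiff C Y ∈ 𝒞 := by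
        intro C hC
        rw [h𝒞] at hC ⊢
        refine ⟨?_, hC.2.symmDiff hY2⟩
        intro x hx
        rw [Finset.mem_symmDiff] at hx
        rcases hx with hx | hx
        · exact hC.1 hx.1
        · exact hY1 hx.1
      refine Finset.card_bij' (fun C _ => symmDiff C Y) (fun C _ => symmDiff C Y) ?_ ?_ ?_ ?_
      · intro C hC
        rw [Finset.mem_filter] at hC ⊢
        refine ⟨hmem C hC.1, ?_⟩
        have := hC.2
        simp only [Finset.mem_symmDiff, hY3] at this ⊢
        tauto
      · intro C hC
        rw [Finset.mem_filter] at hC ⊢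
        refine ⟨hmem C hC.1, ?_⟩
        have := hC.2
        simp only [Finset.mem_symmDiff, hY3] at this ⊢
        tauto
      · intro C _; simp
      · intro C _; simp
    have h2 := Finset.card_filter_add_card_filter_not (s := 𝒞) (fun C => e ∈ symmDiff J C)
    omega
  have hsum : ∑ C ∈ 𝒞, 2 * (symmDiff J C ∩ nb p q F).card = ∑ C ∈ 𝒞, (nb p q F).card := by
    have h1 : ∀ C ∈ 𝒞, 2 * (symmDiff J C ∩ nb p q F).card =
        ∑ e ∈ nb p q F, 2 * (if e ∈ symmDiff J C then 1 else 0) := by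
      intro C _
      rw [← Finset.mul_sum, ← Finset.card_filter]
      congr 2
      ext e; simp [Finset.mem_inter, and_comm]
    rw [Finset.sum_congr rfl h1, Finset.sum_comm]
    have h2 : ∀ e ∈ nb p q F, ∑ C ∈ 𝒞, 2 * (if e ∈ symmDiff J C then 1 else 0) = 𝒞.card := by
      intro e he
      rw [← Finset.mul_sum, ← Finset.card_filter, hedge e he]
    rw [Finset.sum_congr rfl h2]
    simp [mul_comm]
  obtain ⟨C, hC, hle⟩ := Finset.exists_le_of_sum_le hne hsum.le
  rw [h𝒞] at hC
  refine ⟨symmDiff J C, ?_, ?_, hle⟩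
  · intro x hx
    rw [Finset.mem_symmDiff] at hx
    rcases hx with hx | hx
    · exact hJ hx.1
    · exact hC.1 hx.1
  · rw [bz_symmDiff, hC.2, add_zero]


/-! ### The six-flow theorem -/

/-- Restriction of `F` to the vertex set `X`. -/
def rst (p : E → V) (F : Finset E) (X : Finset V) : Finset E := F.filter fun e => p e ∈ X

theorem bz_rst {p q : E → V} {F : Finset E} {X : Finset V} (h : Cl p q F X) (v : V) :
    bz p q (rst p F X) v = if v ∈ X then bz p q F v else 0 := by
  by_cases hv : v ∈ X
  · rw [if_pos hv, bz, bz, bd_apply, bd_apply]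
    refine Finset.sum_congr rfl fun e _ => ?_
    by_cases he : e ∈ F
    · have := h e he
      by_cases h1 : p e ∈ X
      · simp [ind, rst, he, h1]
      · have h2 : q e ∉ X := fun hh => h1 (this.2 hh)
        have h3 : p e ≠ v := by rintro rfl; exact h1 hv
        have h4 : q e ≠ v := by rintro rfl; exact h2 hv
        simp [h3, h4]
    · simp [ind, rst, he]
  · rw [if_neg hv, bz, bd_apply]
    refine Finset.sum_eq_zero fun e _ => ?_
    by_cases he : e ∈ rst p F X
    · have h1 : p e ∈ X := (Finset.mem_filter.1 he).2
      have h2 : q e ∈ X := (h e (Finset.mem_filter.1 he).1).1 h1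
      have h3 : p e ≠ v := by rintro rfl; exact hv h1
      have h4 : q e ≠ v := by rintro rfl; exact hv h2
      simp [h3, h4]
    · simp [ind, he]

theorem reach_rst {p q : E → V} {F : Finset E} {X : Finset V} (h : Cl p q F X) {u v : V}
    (hu : u ∈ X) (hr : Reach (en p q) F u v) : Reach (en p q) (rst p F X) u v := by
  induction hr with
  | refl => exact Relation.ReflTransGen.refl
  | tail hr h' ih =>
    rename_i b c
    have hb : b ∈ X := (reach_cl h hr).1 hu
    obtain ⟨e, he, hab⟩ := h'
    refine ih.tail ⟨e, ?_, hab⟩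
    simp only [en, Sym2.eq_iff] at hab
    rw [rst, Finset.mem_filter]
    refine ⟨he, ?_⟩
    rcases hab with ⟨rfl, rfl⟩ | ⟨rfl, rfl⟩
    · exact hb
    · exact (h e he).2 hb

theorem rst_sub {p : E → V} {F : Finset E} {X : Finset V} : rst p F X ⊆ F :=
  Finset.filter_subset _ _

theorem rst_ends {p q : E → V} {F : Finset E} {X : Finset V} (h : Cl p q F X) {e : E}
    (he : e ∈ rst p F X) : p e ∈ X ∧ q e ∈ X := by
  rw [rst, Finset.mem_filter] at he
  exact ⟨he.2, (h e he.1).1 he.2⟩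

theorem Ev.rst {p q : E → V} {F : Finset E} {X : Finset V} (h : Cl p q F X) (hF : Ev p q F) :
    Ev p q (rst p F X) := by
  ext v; rw [bz_rst h, hF]; simp

/-- the core exchange step of the even-connection lemma -/
theorem evenConn_aux {p q : E → V} {C : Finset E} (hC : Ev p q C) {a b x : V}
    (hb : Reach (en p q) C a b) (hx : Reach (en p q) C a x) :
    ∃ D ⊆ C, bz p q D = Pi.single b 1 + Pi.single x 1 ∧
      (Reach (en p q) D a b ∨ Reach (en p q) D a x) := by
  obtain ⟨R, S, hR⟩ := DPath.of_reach ((reach_symm hb).trans hx)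
  have hRC := hR.sub
  have hbR := hR.bz
  have hbD : bz p q (C \ R) = Pi.single b 1 + Pi.single x 1 := by
    rw [bz_sdiff p q hRC, hC, hbR, zero_add]
  by_cases h : Reach (en p q) (C \ R) a b ∨ Reach (en p q) (C \ R) a x
  · exact ⟨C \ R, Finset.sdiff_subset, hbD, h⟩
  push Not at h
  set X := rs p q (C \ R) a with hX
  have hcl : Cl p q (C \ R) X := cl_rs _ _ _ _
  have hKR : Disjoint R (rst p (C \ R) X) :=
    Finset.disjoint_of_subset_right rst_sub Finset.disjoint_sdiff
  refine ⟨R ∪ rst p (C \ R) X, ?_, ?_, Or.inr ?_⟩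
  · exact Finset.union_subset hRC (rst_sub.trans Finset.sdiff_subset)
  · rw [bz_union p q hKR, hbR]
    have : bz p q (rst p (C \ R) X) = 0 := by
      ext v
      rw [bz_rst hcl, hbD]
      split_ifs with hv
      · have h1 : v ≠ b := by rintro rfl; exact h.1 (mem_rs.1 hv)
        have h2 : v ≠ x := by rintro rfl; exact h.2 (mem_rs.1 hv)
        simp [h1, h2]
      · rfl
    rw [this, add_zero]
  · by_cases hs : ∃ s ∈ S, s ∈ X
    · obtain ⟨s, hs, hsX⟩ := hs
      have h1 := reach_rst hcl self_mem_rs (mem_rs.1 hsX)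
      exact (reach_mono Finset.subset_union_right h1).trans
        (reach_mono Finset.subset_union_left (hR.reach hs))
    · exfalso
      have hcl' : Cl p q C X := by
        intro e he
        by_cases heR : e ∈ R
        · have := hR.ends_mem heR
          exact ⟨fun hh => absurd ⟨_, this.1, hh⟩ hs, fun hh => absurd ⟨_, this.2.1, hh⟩ hs⟩
        · exact hcl e (by simp [he, heR])
      exact h.1 (mem_rs.1 ((reach_cl hcl' hb).1 self_mem_rs))

theorem evenConn {p q : E → V} {H : Finset E} {X : Finset V}
    (hH : ∀ e ∈ H, p e ∈ X ∧ q e ∈ X)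
    (hcut : ∀ Y ⊆ X, Y.Nonempty → Y ≠ X → 2 ≤ (H.filter (cr p q Y)).card)
    {a b : V} (ha : a ∈ X) (hb : b ∈ X) :
    ∃ C ⊆ H, Ev p q C ∧ Reach (en p q) C a b := by
  let Y : Finset V := X.filter fun b => ∃ C ⊆ H, Ev p q C ∧ Reach (en p q) C a b
  have hYX : Y ⊆ X := Finset.filter_subset _ _
  have haY : a ∈ Y :=
    Finset.mem_filter.2 ⟨ha, ∅, by simp, ev_empty p q, Relation.ReflTransGen.refl⟩
  by_cases hY : Y = X
  · rw [← hY] at hb; exact (Finset.mem_filter.1 hb).2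
  exfalso
  have h2 := hcut Y hYX ⟨a, haY⟩ hY
  obtain ⟨e, he⟩ := Finset.card_pos.1 (show 0 < (H.filter (cr p q Y)).card by omega)
  rw [Finset.mem_filter] at he
  obtain ⟨heH, hec⟩ := he
  have hor : ∃ u y, en p q e = s(u, y) ∧ u ∈ Y ∧ y ∉ Y ∧ y ∈ X := by
    rcases cr_swap.1 hec with ⟨h1, h2⟩ | ⟨h1, h2⟩
    · exact ⟨p e, q e, rfl, h1, h2, (hH e heH).2⟩
    · exact ⟨q e, p e, Sym2.eq_swap, h2, h1, (hH e heH).1⟩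
  obtain ⟨u, y, huy, hu, hy, hyX⟩ := hor
  obtain ⟨_, C0, hC0, hC0e, hC0r⟩ := Finset.mem_filter.1 hu
  set A := rs p q C0 a with hA
  have hclA : Cl p q C0 A := cl_rs _ _ _ _
  set C := rst p C0 A with hC
  have hCe : Ev p q C := hC0e.rst hclA
  have hCH : C ⊆ H := rst_sub.trans hC0
  have hXH : Cl p q H X := fun f hf => ⟨fun _ => (hH f hf).2, fun _ => (hH f hf).1⟩
  have hAX : A ⊆ X := fun v hv => (reach_cl (hXH.mono hC0) (mem_rs.1 hv)).1 ha
  have hAY : A ⊆ Y := fun v hv => Finset.mem_filter.2 ⟨hAX hv, C0, hC0, hC0e, mem_rs.1 hv⟩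
  have hCr : ∀ v ∈ A, Reach (en p q) C a v := fun v hv =>
    reach_rst hclA self_mem_rs (mem_rs.1 hv)
  have huA : u ∈ A := mem_rs.2 hC0r
  have hyA : y ∉ A := fun h => hy (hAY h)
  -- the ear
  have hear : ∃ x ∈ A, Reach (en p q) (H.erase e) y x := by
    by_contra hcon
    push Not at hcon
    have hZX : rs p q (H.erase e) y ⊆ X := fun v hv =>
      (reach_cl (hXH.mono (Finset.erase_subset _ _)) (mem_rs.1 hv)).1 hyX
    have hne : rs p q (H.erase e) y ≠ X := by
      intro hh
      have : u ∈ rs p q (H.erase e) y := by rw [hh]; exact hYX hu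
      exact hcon u huA (mem_rs.1 this)
    have h3 := hcut _ hZX ⟨y, self_mem_rs⟩ hne
    have h4 : H.filter (cr p q (rs p q (H.erase e) y)) ⊆ {e} := by
      intro f hf
      rw [Finset.mem_filter] at hf
      by_contra hfe
      rw [Finset.mem_singleton] at hfe
      exact hf.2 (cl_rs p q (H.erase e) y f (by simp [hfe, hf.1]))
    have := Finset.card_le_card h4
    simp at this
    omega
  obtain ⟨x0, hx0, hr⟩ := hear
  obtain ⟨P0, S0, hP0⟩ := DPath.of_reach hr
  obtain ⟨x, P, S, hPP, hSS, hP, hint⟩ := hP0.firstHit A hx0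
  have hxA : x ∈ A := by
    have : x ∈ S ∩ A := by rw [hint]; simp
    exact (Finset.mem_inter.1 this).2
  have hPC : Disjoint P C := by
    rw [Finset.disjoint_left]
    intro f hf hfC
    have h1 := hP.ends_mem hf
    have h2 := rst_ends hclA hfC
    have h3 : p f ∈ S ∩ A := Finset.mem_inter.2 ⟨h1.1, h2.1⟩
    have h4 : q f ∈ S ∩ A := Finset.mem_inter.2 ⟨h1.2.1, h2.2⟩
    rw [hint, Finset.mem_singleton] at h3 h4
    exact h1.2.2 (h3.trans h4.symm)
  have heP : e ∉ P := fun h => by simpa using hP.sub h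
  have heC : e ∉ C := by
    intro h
    have h1 := rst_ends hclA h
    simp only [en, Sym2.eq_iff] at huy
    rcases huy with ⟨_, h2⟩ | ⟨h2, _⟩
    · exact hyA (h2 ▸ h1.2)
    · exact hyA (h2 ▸ h1.1)
  obtain ⟨D, hDC, hDb, hDr⟩ := evenConn_aux hCe (hCr u huA) (hCr x hxA)
  have hPD : Disjoint P D := Finset.disjoint_of_subset_right hDC hPC
  have hePD : Disjoint ({e} : Finset E) (P ∪ D) := by
    rw [Finset.disjoint_singleton_left, Finset.mem_union]
    rintro (h | h)
    · exact heP h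
    · exact heC (hDC h)
  have hbe : bz p q {e} = Pi.single u 1 + Pi.single y 1 := by
    rw [bz_singleton, z2_sub]
    simp only [en, Sym2.eq_iff] at huy
    rcases huy with ⟨rfl, rfl⟩ | ⟨rfl, rfl⟩
    · rw [add_comm]
    · rfl
  apply hy
  refine Finset.mem_filter.2 ⟨hyX, {e} ∪ (P ∪ D), ?_, ?_, ?_⟩
  · refine Finset.union_subset (by simpa using heH) (Finset.union_subset ?_ (hDC.trans hCH))
    exact hP.sub.trans (Finset.erase_subset _ _)
  · rw [Ev, bz_union p q hePD, bz_union p q hPD, hbe, hP.bz, hDb]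
    have h1 := z2_add_self (Pi.single u 1 : V → ZMod 2)
    have h2 := z2_add_self (Pi.single y 1 : V → ZMod 2)
    have h3 := z2_add_self (Pi.single x 1 : V → ZMod 2)
    calc _ = ((Pi.single u 1 : V → ZMod 2) + Pi.single u 1) + (Pi.single y 1 + Pi.single y 1) +
          (Pi.single x 1 + Pi.single x 1) := by abel
      _ = 0 := by rw [h1, h2, h3]; simp
  · rcases hDr with h | h
    · refine (reach_mono ?_ h).tail ⟨e, by simp, huy⟩
      intro f hf; simp [hf]
    · refine (reach_mono ?_ h).trans (reach_mono ?_ (reach_symm (hP.reach hP.left_mem)))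
      · intro f hf; simp [hf]
      · intro f hf; simp [hf]


/-- Local nowhere-zero completion property. -/
def Good (p q : E → V) (F C S : Finset E) : Prop :=
  C ⊆ S ∧ Ev p q C ∧ ∀ g : E → ZMod 3, bd p q g = 0 → (∀ e, e ∉ F → g e = 0) →
    ∃ g' : E → ZMod 3, bd p q g' = 0 ∧ (∀ e, e ∉ F → g' e = 0) ∧ (∀ e, e ∉ S → g' e = g e) ∧
      ∀ e ∈ S, e ∉ C → g' e ≠ 0

theorem Good.add_even {p q : E → V} {F C S C' : Finset E} (h : Good p q F C S)
    (hC' : Ev p q C') (hd : Disjoint S C') : Good p q F (C ∪ C') (S ∪ C') := by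
  obtain ⟨h1, h2, h3⟩ := h
  refine ⟨Finset.union_subset_union_left h1,
    h2.union hC' (Finset.disjoint_of_subset_left h1 hd), ?_⟩
  intro g hg hF
  obtain ⟨g', a, b, c, d⟩ := h3 g hg hF
  refine ⟨g', a, b, ?_, ?_⟩
  · intro e he
    exact c e fun h => he (Finset.mem_union_left _ h)
  · intro e he he'
    simp only [Finset.mem_union, not_or] at he he'
    rcases he with he | he
    · exact d e he he'.1
    · exact absurd he he'.2

theorem z3_choose : ∀ x y s t : ZMod 3, s ≠ 0 → t ≠ 0 → ∃ k : ZMod 3, x + k * s ≠ 0 ∧ y + k * t ≠ 0 := by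
  decide

theorem bd_mul (p q : E → V) (k : ZMod 3) (g : E → ZMod 3) (hg : bd p q g = 0) :
    bd p q (fun e => k * g e) = 0 := by
  ext v
  have := bd_map (AddMonoidHom.mulLeft k) p q g v
  simp only [AddMonoidHom.coe_mulLeft, hg] at this
  rw [← this]; simp

theorem Good.add_two {p q : E → V} {F C S : Finset E} (h : Good p q F C S) {ξ : E → ZMod 3}
    (hξ : bd p q ξ = 0) (ea eb : E) (hS : S ⊆ F) (hea : ea ∈ F) (heb : eb ∈ F)
    (ha : ea ∉ S) (hb : eb ∉ S) (hξa : ξ ea ≠ 0) (hξb : ξ eb ≠ 0)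
    (hξS : ∀ e, e ∉ S → e ≠ ea → e ≠ eb → ξ e = 0) :
    Good p q F C (S ∪ {ea, eb}) := by
  obtain ⟨h1, h2, h3⟩ := h
  refine ⟨h1.trans Finset.subset_union_left, h2, ?_⟩
  intro g hg hF
  obtain ⟨k, hk1, hk2⟩ := z3_choose (g ea) (g eb) (ξ ea) (ξ eb) hξa hξb
  obtain ⟨g', a, b, c, d⟩ := h3 (g + fun e => k * ξ e)
    (by rw [map_add, hg, bd_mul p q k ξ hξ, add_zero]) (by
      intro e he
      have : ξ e = 0 := hξS e (fun h => he (hS h)) (by rintro rfl; exact he hea)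
        (by rintro rfl; exact he heb)
      simp [hF e he, this])
  refine ⟨g', a, b, ?_, ?_⟩
  · intro e he
    simp only [Finset.mem_union, Finset.mem_insert, Finset.mem_singleton, not_or] at he
    rw [c e he.1]
    simp [hξS e he.1 he.2.1 he.2.2]
  · intro e he heC
    by_cases heS : e ∈ S
    · exact d e heS heC
    · simp only [Finset.mem_union, Finset.mem_insert, Finset.mem_singleton, heS, false_or] at he
      rw [c e heS]
      rcases he with rfl | rfl
      · exact hk1
      · exact hk2

theorem Good.complete {p q : E → V} {F C : Finset E} : ∀ (n : ℕ) (S : Finset E), Good p q F C S →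
    S ⊆ F → (∀ u v, Reach (en p q) F u v → Reach (en p q) S u v) → (F \ S).card = n →
    Good p q F C F := by
  intro n
  induction n with
  | zero =>
    intro S h hS _ hn
    rw [Finset.card_eq_zero, Finset.sdiff_eq_empty_iff_subset] at hn
    rwa [hS.antisymm hn] at h
  | succ n ih =>
    intro S h hS hr hn
    obtain ⟨f, hf⟩ := Finset.card_pos.1 (by omega : 0 < (F \ S).card)
    rw [Finset.mem_sdiff] at hf
    obtain ⟨g, hg1, hg2⟩ := unit_path (hr _ _ (reach_symm (reach_edge hf.1))) (1 : ZMod 3)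
    refine ih (S ∪ {f, f}) (h.add_two (ξ := g + Pi.single f 1) ?_ f f hS hf.1 hf.1 hf.2 hf.2 ?_ ?_ ?_)
      ?_ ?_ ?_
    · rw [map_add, hg2, bd_single]; abel
    · simp [hg1 f hf.2]
    · simp [hg1 f hf.2]
    · intro e he h1 _
      simp [hg1 e he, h1]
    · exact Finset.union_subset hS (by simp [hf.1])
    · intro u v huv
      exact reach_mono Finset.subset_union_left (hr u v huv)
    · have : F \ S = insert f (F \ (S ∪ {f, f})) := by
        ext e; simp only [Finset.mem_sdiff, Finset.mem_insert, Finset.mem_union,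
          Finset.mem_singleton]
        by_cases he : e = f
        · subst he; simp [hf]
        · simp [he]
      rw [this, Finset.card_insert_of_notMem (by simp)] at hn
      omega

/-- partial structure used in the proof of the six flow theorem -/
def Struct (p q : E → V) (F : Finset E) (U : Finset V) : Prop :=
  ∃ C S : Finset E, Good p q F C S ∧ S ⊆ F ∧ (∀ e ∈ S, p e ∈ U ∧ q e ∈ U) ∧
    ∀ u ∈ U, ∀ v ∈ U, Reach (en p q) F u v → Reach (en p q) S u v

set_option maxHeartbeats 2000000 in
theorem struct_step {p q : E → V} {F : Finset E}
    (hc : ∀ X : Finset V, (F.filter (cr p q X)).Nonempty → 3 ≤ (F.filter (cr p q X)).card)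
    {U : Finset V} (hU : Struct p q F U) (hne : U ≠ Finset.univ) :
    ∃ U', Struct p q F U' ∧ U.card < U'.card := by
  obtain ⟨C, S, hG, hSF, hSU, hr⟩ := hU
  by_cases h0 : (F.filter (cr p q U)).Nonempty
  swap
  · -- nothing leaves U
    have hcl : Cl p q F U := by
      intro e he
      by_contra hh
      exact h0 ⟨e, Finset.mem_filter.2 ⟨he, hh⟩⟩
    obtain ⟨w, hw⟩ : ∃ w, w ∉ U := by
      by_contra hh; push Not at hh
      exact hne (Finset.eq_univ_iff_forall.2 hh)
    refine ⟨insert w U, ⟨C, S, hG, hSF, ?_, ?_⟩, ?_⟩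
    · intro e he
      have := hSU e he
      simp [this.1, this.2]
    · intro u hu v hv huv
      rcases Finset.mem_insert.1 hu with rfl | hu1 <;> rcases Finset.mem_insert.1 hv with rfl | hv1
      · exact Relation.ReflTransGen.refl
      · exact absurd ((reach_cl hcl huv).2 hv1) hw
      · exact absurd ((reach_cl hcl huv).1 hu1) hw
      · exact hr u hu1 v hv1 huv
    · rw [Finset.card_insert_of_notMem hw]; omega
  -- candidates
  let K : Finset E := F.filter fun e => p e ∉ U ∧ q e ∉ U
  let cand : Finset V → Prop := fun X =>
    Disjoint X U ∧ (K.filter (cr p q X)).card ≤ 1 ∧ (F.filter (cr p q X)).Nonempty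
  have hex : ∃ X, cand X := by
    refine ⟨Uᶜ, disjoint_compl_left, ?_, ?_⟩
    · have : K.filter (cr p q Uᶜ) = ∅ := by
        ext e; simp only [K, Finset.mem_filter, cr, Finset.mem_compl, Finset.notMem_empty, iff_false]
        tauto
      rw [this]; simp
    · obtain ⟨e, he⟩ := h0
      refine ⟨e, ?_⟩
      rw [Finset.mem_filter] at he ⊢
      refine ⟨he.1, ?_⟩
      have := he.2
      simp only [cr, Finset.mem_compl] at this ⊢
      tauto
  obtain ⟨X, hX, hmin⟩ := exists_minimalFor_of_wellFoundedLT cand Finset.card hex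
  obtain ⟨hXU, hXK, hXF⟩ := hX
  have hXF3 := hc X hXF
  have hmin' : ∀ Y, cand Y → X.card ≤ Y.card := by
    intro Y hY
    by_contra hlt
    have := hmin hY (by omega)
    omega
  have hXU' : ∀ v ∈ X, v ∉ U := fun v hv => Finset.disjoint_left.1 hXU hv
  -- two edges into U
  have h2 : 1 < ((F.filter (cr p q X)).filter fun e => ¬ (p e ∉ U ∧ q e ∉ U)).card := by
    have h := Finset.card_filter_add_card_filter_not (s := F.filter (cr p q X))
      (fun e => p e ∉ U ∧ q e ∉ U)
    have h' : (F.filter (cr p q X)).filter (fun e => p e ∉ U ∧ q e ∉ U) = K.filter (cr p q X) := by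
      ext e; simp only [K, Finset.mem_filter]; tauto
    rw [h'] at h
    omega
  obtain ⟨ea, hea, eb, heb, hab⟩ := Finset.one_lt_card.1 h2
  have hends : ∀ e, e ∈ ((F.filter (cr p q X)).filter fun e => ¬ (p e ∉ U ∧ q e ∉ U)) →
      e ∈ F ∧ ∃ a a', en p q e = s(a', a) ∧ a ∈ X ∧ a' ∈ U := by
    intro e he
    simp only [Finset.mem_filter] at he
    obtain ⟨⟨h1, h2⟩, h3⟩ := he
    refine ⟨h1, ?_⟩
    rcases cr_swap.1 h2 with ⟨h4, h5⟩ | ⟨h4, h5⟩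
    · refine ⟨p e, q e, Sym2.eq_swap, h4, ?_⟩
      have := hXU' _ h4
      tauto
    · refine ⟨q e, p e, rfl, h5, ?_⟩
      have := hXU' _ h5
      tauto
  obtain ⟨heaF, a, a', hea', haX, haU⟩ := hends ea hea
  obtain ⟨hebF, b, b', heb', hbX, hbU⟩ := hends eb heb
  -- edges inside X
  let H : Finset E := F.filter fun e => p e ∈ X ∧ q e ∈ X
  have hHF : H ⊆ F := Finset.filter_subset _ _
  have hcut : ∀ Y ⊆ X, Y.Nonempty → Y ≠ X → 2 ≤ (H.filter (cr p q Y)).card := by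
    intro Y hYX hYne hYX'
    by_contra hlt
    have hZne : (X \ Y).Nonempty := by
      rw [Finset.sdiff_nonempty]; intro h; exact hYX' (hYX.antisymm h)
    have hcY : Y.card + (X \ Y).card = X.card := by
      have := Finset.card_sdiff_add_card_eq_card hYX
      omega
    have hpY := hYne.card_pos
    have hpZ := hZne.card_pos
    have hne' : ∀ Z, Z ⊆ X → Z.Nonempty → Z ≠ X → (K.filter (cr p q Z)).card ≤ 1 → False := by
      intro Z hZX hZ1 hZ2 hZ3
      have hZs : Z.card < X.card := Finset.card_lt_card (hZX.ssubset_of_ne hZ2)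
      have hZ1 := hZ1.card_pos
      by_cases hZF : (F.filter (cr p q Z)).Nonempty
      · have := hmin' Z ⟨Finset.disjoint_of_subset_left hZX hXU, hZ3, hZF⟩
        omega
      · have hclZ : ∀ e ∈ F, (p e ∈ Z ↔ q e ∈ Z) := by
          intro e he
          by_contra hh
          exact hZF ⟨e, Finset.mem_filter.2 ⟨he, hh⟩⟩
        have hcr : ∀ e ∈ F, (cr p q (X \ Z) e ↔ cr p q X e) := by
          intro e he
          have := hclZ e he
          have h1 := @hZX (p e)
          have h2 := @hZX (q e)
          simp only [cr, Finset.mem_sdiff]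
          clear hmin hmin' hends hea heb hXK hr; grind
        have := hmin' (X \ Z) ⟨Finset.disjoint_of_subset_left Finset.sdiff_subset hXU, ?_, ?_⟩
        · have := Finset.card_sdiff_add_card_eq_card hZX
          omega
        · rw [Finset.filter_congr (fun e he => hcr e (Finset.mem_filter.1 he).1)]; exact hXK
        · rw [Finset.filter_congr hcr]; exact hXF
    have hZX' : X \ Y ≠ X := by
      intro h; rw [h] at hcY; omega
    by_cases hout : ∃ e ∈ K.filter (cr p q X), p e ∈ Y ∨ q e ∈ Y
    · refine hne' (X \ Y) Finset.sdiff_subset hZne hZX' ?_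
      obtain ⟨f, hf, hfY⟩ := hout
      refine (Finset.card_le_card (t := H.filter (cr p q Y)) ?_).trans (by omega)
      intro e he
      simp only [H, K, Finset.mem_filter] at he hf ⊢
      have h1 := @hYX (p e)
      have h2 := @hYX (q e)
      have h3 := @hYX (p f)
      have h4 := @hYX (q f)
      by_cases hcX : cr p q X e
      · have : e = f := by
          refine Finset.card_le_one.1 hXK e ?_ f ?_
          · simp only [K, Finset.mem_filter]; exact ⟨he.1, hcX⟩
          · simp only [K, Finset.mem_filter]; exact hf
        subst this
        exfalso
        have h5 := he.2
        simp only [cr, Finset.mem_sdiff] at h5 hcX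
        clear hmin hmin' hends hea heb hne' hXK
        grind
      · have h5 := he.2
        refine ⟨⟨he.1.1, ?_⟩, ?_⟩ <;> simp only [cr, Finset.mem_sdiff] at h5 hcX ⊢ <;> clear hmin hmin' hends hea heb hne' hXK <;> grind
    · refine hne' Y hYX hYne hYX' ?_
      refine (Finset.card_le_card (t := H.filter (cr p q Y)) ?_).trans (by omega)
      intro e he
      have h1 := @hYX (p e)
      have h2 := @hYX (q e)
      by_cases hcX : cr p q X e
      · exfalso
        apply hout
        refine ⟨e, ?_, ?_⟩
        · rw [Finset.mem_filter] at he ⊢; exact ⟨he.1, hcX⟩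
        · have h5 := (Finset.mem_filter.1 he).2
          simp only [cr] at h5
          clear hmin hmin' hends hea heb hne' hXK; grind
      · simp only [H, K, Finset.mem_filter] at he ⊢
        have h5 := he.2
        refine ⟨⟨he.1.1, ?_⟩, h5⟩
        simp only [cr] at h5 hcX
        clear hmin hmin' hends hea heb hne' hXK; grind
  obtain ⟨C0, hC0H, hC0e, hC0r⟩ := evenConn (p := p) (q := q) (H := H) (X := X)
    (fun e he => (Finset.mem_filter.1 he).2) hcut haX hbX
  set A := rs p q C0 a with hA
  have hclA : Cl p q C0 A := cl_rs _ _ _ _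
  set C1 := rst p C0 A with hC1
  have hC1e : Ev p q C1 := hC0e.rst hclA
  have hC1H : C1 ⊆ H := rst_sub.trans hC0H
  have hC1r : ∀ v ∈ A, Reach (en p q) C1 a v := fun v hv =>
    reach_rst hclA self_mem_rs (mem_rs.1 hv)
  have hclX : Cl p q C0 X := by
    intro e he
    have := (Finset.mem_filter.1 (hC0H he)).2
    simp [this.1, this.2]
  have hAX : A ⊆ X := fun v hv => (reach_cl hclX (mem_rs.1 hv)).1 haX
  have hbA : b ∈ A := mem_rs.2 hC0r
  have haA : a ∈ A := self_mem_rs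
  have hdis : Disjoint S C1 := by
    rw [Finset.disjoint_left]
    intro e he he1
    exact hXU' _ (Finset.mem_filter.1 (hC1H he1)).2.1 (hSU e he).1
  have hG1 := hG.add_even hC1e hdis
  have hnot : ∀ e x y, en p q e = s(x, y) → y ∈ X → x ∈ U → e ∉ S ∪ C1 := by
    intro e x y hxy hy hx he
    simp only [en, Sym2.eq_iff] at hxy
    rcases Finset.mem_union.1 he with he | he
    · have := hSU e he
      have hyU := hXU' y hy
      rcases hxy with ⟨rfl, rfl⟩ | ⟨rfl, rfl⟩ <;> tauto
    · have := (Finset.mem_filter.1 (hC1H he)).2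
      have hxX : x ∉ X := fun h => hXU' x h hx
      rcases hxy with ⟨rfl, rfl⟩ | ⟨rfl, rfl⟩ <;> tauto
  have hnea := hnot ea a' a hea' haX haU
  have hneb := hnot eb b' b heb' hbX hbU
  -- the flow ξ
  have hra : Reach (en p q) F a' a := Relation.ReflTransGen.single ⟨ea, heaF, hea'⟩
  have hrb : Reach (en p q) F b' b := Relation.ReflTransGen.single ⟨eb, hebF, heb'⟩
  have hrab : Reach (en p q) F a b := reach_mono (hC1H.trans hHF) (hC1r b hbA)
  have hrS : Reach (en p q) S b' a' :=
    hr b' hbU a' haU (hrb.trans ((reach_symm hrab).trans (reach_symm hra)))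
  obtain ⟨g1, g1a, g1b⟩ := unit_path (hC1r b hbA) (1 : ZMod 3)
  obtain ⟨g2, g2a, g2b⟩ := unit_path hrS (1 : ZMod 3)
  have hsgn : ∀ e x y, en p q e = s(x, y) → ∃ c : ZMod 3, c ≠ 0 ∧
      bd p q (Pi.single e c) = Pi.single y 1 - Pi.single x 1 := by
    intro e x y hxy
    simp only [en, Sym2.eq_iff] at hxy
    rcases hxy with ⟨rfl, rfl⟩ | ⟨rfl, rfl⟩
    · exact ⟨1, by decide, by rw [bd_single]⟩
    · refine ⟨-1, by decide, ?_⟩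
      rw [bd_single, Pi.single_neg, Pi.single_neg]; abel
  obtain ⟨ca, ca0, hca⟩ := hsgn ea a' a hea'
  obtain ⟨cb, cb0, hcb⟩ := hsgn eb b b' (heb'.trans Sym2.eq_swap)
  rw [Finset.mem_union, not_or] at hnea hneb
  have hG2 := hG1.add_two (ξ := Pi.single ea ca + g1 + Pi.single eb cb + g2) (by
      rw [map_add, map_add, map_add, hca, hcb, g1b, g2b]; abel) ea eb
      (Finset.union_subset hSF (hC1H.trans hHF)) heaF hebF (by simpa using hnea) (by simpa using hneb)
      (by simp [g1a ea hnea.2, g2a ea hnea.1, hab, ca0])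
      (by simp [g1a eb hneb.2, g2a eb hneb.1, hab.symm, cb0])
      (by
        intro e he h1 h2
        rw [Finset.mem_union, not_or] at he
        simp [g1a e he.2, g2a e he.1, h1, h2])
  have hS'F : S ∪ C1 ∪ {ea, eb} ⊆ F := by
    refine Finset.union_subset (Finset.union_subset hSF (hC1H.trans hHF)) ?_
    intro e he; simp at he; rcases he with rfl | rfl <;> assumption
  refine ⟨U ∪ A, ⟨C ∪ C1, S ∪ C1 ∪ {ea, eb}, hG2, hS'F, ?_, ?_⟩, ?_⟩
  · intro e he
    simp only [Finset.mem_union, Finset.mem_insert, Finset.mem_singleton] at he ⊢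
    have hgen : ∀ e x y, en p q e = s(x, y) → x ∈ U → y ∈ A → (p e ∈ U ∨ p e ∈ A) ∧ (q e ∈ U ∨ q e ∈ A) := by
      intro e x y hxy hx hy
      simp only [en, Sym2.eq_iff] at hxy
      rcases hxy with ⟨rfl, rfl⟩ | ⟨rfl, rfl⟩ <;> tauto
    rcases he with (he | he) | rfl | rfl
    · have := hSU e he; tauto
    · have := rst_ends hclA he; tauto
    · exact hgen _ _ _ hea' haU haA
    · exact hgen _ _ _ heb' hbU hbA
  · have hrep : ∀ v ∈ U ∪ A, ∃ w ∈ U, Reach (en p q) (S ∪ C1 ∪ {ea, eb}) v w := by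
      intro v hv
      rcases Finset.mem_union.1 hv with hv | hv
      · exact ⟨v, hv, Relation.ReflTransGen.refl⟩
      · refine ⟨a', haU, ?_⟩
        refine (reach_mono ?_ (reach_symm (hC1r v hv))).tail ⟨ea, by simp, hea'.trans Sym2.eq_swap⟩
        intro e he; simp [he]
    intro u hu v hv huv
    obtain ⟨u', hu', hru⟩ := hrep u hu
    obtain ⟨v', hv', hrv⟩ := hrep v hv
    have h1 := hr u' hu' v' hv' ((reach_symm (reach_mono hS'F hru)).trans
      (huv.trans (reach_mono hS'F hrv)))
    refine hru.trans ((reach_mono ?_ h1).trans (reach_symm hrv))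
    intro e he; simp [he]
  · refine Finset.card_lt_card ((Finset.ssubset_iff_of_subset Finset.subset_union_left).2
      ⟨a, Finset.mem_union_right _ haA, hXU' a haX⟩)


theorem bd_contract {A : Type} [AddCommGroup A] (p q : E → V) (π : V → V) (g : E → A) (w : V) :
    bd (π ∘ p) (π ∘ q) g w = ∑ v ∈ Finset.univ.filter (fun v => π v = w), bd p q g v := by
  rw [cut_sum, bd_apply]; simp

/-- identify `q e` with `p e` -/
def ctr (p q : E → V) (e : E) : V → V := fun x => if x = q e then p e else x

theorem lift_contract {A : Type} [AddCommGroup A] {p q : E → V} {e : E} (hne : p e ≠ q e)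
    {g : E → A} (hg : bd (ctr p q e ∘ p) (ctr p q e ∘ q) g = 0) :
    ∃ x, bd p q (g + Pi.single e x) = 0 := by
  have h1 : ∀ w, w ≠ p e → w ≠ q e → bd p q g w = 0 := by
    intro w h1 h2
    have := congrFun hg w
    rw [bd_contract] at this
    have h3 : Finset.univ.filter (fun v => ctr p q e v = w) = {w} := by
      ext v; rw [Finset.mem_filter]; simp only [Finset.mem_univ, true_and, Finset.mem_singleton, ctr]
      split_ifs with h
      · constructor
        · intro h'; exact absurd h'.symm h1
        · intro h'; exact absurd (h'.symm.trans h) h2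
      · rfl
    rw [h3, Finset.sum_singleton] at this
    exact this
  have h2 : bd p q g (p e) + bd p q g (q e) = 0 := by
    have := congrFun hg (p e)
    rw [bd_contract] at this
    have h3 : Finset.univ.filter (fun v => ctr p q e v = p e) = {p e, q e} := by
      ext v; rw [Finset.mem_filter]; simp only [Finset.mem_univ, true_and, Finset.mem_singleton, ctr,
        Finset.mem_insert]
      split_ifs with h
      · simp [h]
      · simp [h]
    rw [h3, Finset.sum_pair hne] at this
    exact this
  refine ⟨bd p q g (p e), ?_⟩
  rw [map_add, bd_single]
  ext v
  simp only [Pi.add_apply, Pi.sub_apply, Pi.single_apply, Pi.zero_apply]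
  by_cases hv : v = p e
  · subst hv; simp [hne]
  · by_cases hv' : v = q e
    · subst hv'; simp [hne.symm]; rw [add_comm]; exact h2
    · simp [hv, hv', h1 v hv hv']

theorem bd_ctr_single {A : Type} [AddCommGroup A] (p q : E → V) (e : E) (x : A) :
    bd (ctr p q e ∘ p) (ctr p q e ∘ q) (Pi.single e x) = 0 := by
  rw [bd_single]; simp [ctr]

set_option maxHeartbeats 2000000 in
theorem sixflow : ∀ (n : ℕ) (p q : E → V) (F : Finset E), F.card = n →
    (∀ e ∈ F, ∃ C ⊆ F, Ev p q C ∧ e ∈ C) →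
    ∃ C ⊆ F, Ev p q C ∧ ∃ g : E → ZMod 3, bd p q g = 0 ∧ (∀ e, e ∉ F → g e = 0) ∧
      ∀ e ∈ F, e ∉ C → g e ≠ 0 := by
  intro n
  induction n with
  | zero =>
    intro p q F hn _
    rw [Finset.card_eq_zero] at hn
    subst hn
    exact ⟨∅, by simp, ev_empty p q, 0, by simp, by simp, by simp⟩
  | succ n ih =>
  intro p q F hn hF
  by_cases h2 : ∃ X, (F.filter (cr p q X)).card = 2
  · obtain ⟨X, hX⟩ := h2
    obtain ⟨e, e', hee, hX⟩ := Finset.card_eq_two.1 hX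
    have heX : e ∈ F.filter (cr p q X) := by rw [hX]; simp
    have heX' : e' ∈ F.filter (cr p q X) := by rw [hX]; simp
    have hout : ∀ f ∈ F, f ≠ e → f ≠ e' → ¬ cr p q X f := by
      intro f hf h1 h2 h3
      have : f ∈ F.filter (cr p q X) := Finset.mem_filter.2 ⟨hf, h3⟩
      rw [hX] at this; simp [h1, h2] at this
    rw [Finset.mem_filter] at heX heX'
    have hne : p e ≠ q e := by
      intro h; have := heX.2; rw [cr, h] at this; exact this Iff.rfl
    obtain ⟨C', hC'F, hC'e, g', hg', hg'0, hg'1⟩ := ih (ctr p q e ∘ p) (ctr p q e ∘ q) (F.erase e)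
      (by rw [Finset.card_erase_of_mem heX.1]; omega) (by
        intro f hf
        rw [Finset.mem_erase] at hf
        obtain ⟨C, hC, hCe, hfC⟩ := hF f hf.2
        refine ⟨C.erase e, Finset.erase_subset_erase _ hC, ?_, by simp [hf.1, hfC]⟩
        have h1 : bd (ctr p q e ∘ p) (ctr p q e ∘ q) (ind C) = 0 := by
          ext w
          rw [bd_contract]
          refine Finset.sum_eq_zero fun v _ => ?_
          exact congrFun hCe v
        have h2 : ind C = ind (C.erase e) + Pi.single e (ind C e) := by
          ext f'
          by_cases h : f' = e
          · subst h; simp [ind]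
          · simp [ind, h]
        rw [h2, map_add, bd_ctr_single, add_zero] at h1
        exact h1)
    have heC' : e ∉ C' := fun h => by simpa using hC'F h
    obtain ⟨y, hy⟩ := lift_contract hne hg'
    obtain ⟨x, hx⟩ := lift_contract hne (g := ind C') hC'e
    have hg'e : g' e = 0 := hg'0 e (by simp)
    obtain ⟨g, hgd⟩ : ∃ g : E → ZMod 3, g = g' + (Pi.single e y : E → ZMod 3) := ⟨_, rfl⟩
    rw [← hgd] at hy
    have hgne : ∀ f, f ≠ e → g f = g' f := by
      intro f hf; rw [hgd]; simp [hf]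
    obtain ⟨C, hC, hCm⟩ := exists_ind (ind C' + Pi.single e x)
    have hCC' : ∀ f, f ≠ e → (f ∈ C ↔ f ∈ C') := by
      intro f hf
      rw [hCm, ← ind_ne]; simp [hf]
    have hCF : C ⊆ F := by
      intro f hf
      by_cases h : f = e
      · rw [h]; exact heX.1
      · exact Finset.mem_of_mem_erase (hC'F ((hCC' f h).1 hf))
    have hCe : Ev p q C := by rw [Ev, bz, hC]; exact hx
    refine ⟨C, hCF, hCe, g, hy, ?_, ?_⟩
    · intro f hf
      have : f ≠ e := by rintro rfl; exact hf heX.1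
      rw [hgne f this]; exact hg'0 f (by simp [hf])
    · intro f hf hfC
      by_cases hfe : f = e
      · subst hfe
        have he'C : e' ∉ C := by
          intro h
          have h1 := cut_even hCe X
          have h3 : C.filter (cr p q X) = {e'} := by
            ext f'
            simp only [Finset.mem_filter, Finset.mem_singleton]
            constructor
            · rintro ⟨h4, h5⟩
              by_contra h6
              refine hout f' (hCF h4) ?_ h6 h5
              rintro rfl; exact hfC h4
            · rintro rfl; exact ⟨h, heX'.2⟩
          rw [h3] at h1; simp at h1
        have hge' : g' e' ≠ 0 :=
          hg'1 e' (by simp [hee.symm, heX'.1]) (fun h => he'C ((hCC' e' hee.symm).2 h))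
        intro hzero
        have hcs := cut_sum p q g X
        rw [hy] at hcs
        rw [Finset.sum_eq_single e'] at hcs
        · have h7 : g e' = g' e' := hgne _ hee.symm
          rw [h7] at hcs
          have := heX'.2
          rcases cr_swap.1 this with ⟨h8, h9⟩ | ⟨h8, h9⟩
          · simp [h8, h9] at hcs; exact hge' hcs
          · simp [h8, h9] at hcs; exact hge' hcs.symm
        · intro f' _ hf'
          by_cases h8 : f' = f
          · subst h8; rw [hzero]; simp
          · by_cases h9 : f' ∈ F
            · have h10 := hout f' h9 h8 hf'
              rw [cr, not_not] at h10
              by_cases h11 : p f' ∈ X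
              · simp [h11, h10.1 h11]
              · have : q f' ∉ X := fun h => h11 (h10.2 h)
                simp [h11, this]
            · have : g f' = 0 := by
                rw [hgne f' h8]; exact hg'0 f' (by simp [h9])
              rw [this]; simp
        · simp
      · have := hg'1 f (by simp [hf, hfe]) (fun h => hfC ((hCC' f hfe).2 h))
        rw [hgne f hfe]; exact this
  · have hc : ∀ X : Finset V, (F.filter (cr p q X)).Nonempty → 3 ≤ (F.filter (cr p q X)).card := by
      intro X hX
      have h0 := hX.card_pos
      have h2' : (F.filter (cr p q X)).card ≠ 2 := fun h => h2 ⟨X, h⟩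
      have h1 : (F.filter (cr p q X)).card ≠ 1 := by
        intro h1
        obtain ⟨e, he⟩ := Finset.card_eq_one.1 h1
        have heF : e ∈ F.filter (cr p q X) := by rw [he]; simp
        rw [Finset.mem_filter] at heF
        obtain ⟨C, hC, hCe, heC⟩ := hF e heF.1
        have h3 := cut_even hCe X
        have h4 : C.filter (cr p q X) = {e} := by
          rw [← he]
          ext f
          simp only [Finset.mem_filter]
          constructor
          · rintro ⟨h5, h6⟩; exact ⟨hC h5, h6⟩
          · intro h5
            have : f ∈ F.filter (cr p q X) := Finset.mem_filter.2 h5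
            rw [he, Finset.mem_singleton] at this
            subst this; exact ⟨heC, h5.2⟩
        rw [h4] at h3; simp at h3
      omega
    have hgood0 : Good p q F ∅ ∅ :=
      ⟨by simp, ev_empty p q, fun g hg hg' => ⟨g, hg, hg', fun _ _ => rfl, by simp⟩⟩
    have hs0 : Struct p q F ∅ := ⟨∅, ∅, hgood0, by simp, by simp, by simp⟩
    have hall : ∀ k, ∃ U, Struct p q F U ∧ (U = Finset.univ ∨ k ≤ U.card) := by
      intro k
      induction k with
      | zero => exact ⟨∅, hs0, Or.inr (by simp)⟩
      | succ k ihk =>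
        obtain ⟨U, hU, h⟩ := ihk
        by_cases hun : U = Finset.univ
        · exact ⟨U, hU, Or.inl hun⟩
        · obtain ⟨U', hU', hlt⟩ := struct_step hc hU hun
          refine ⟨U', hU', Or.inr ?_⟩
          have := h.resolve_left hun
          omega
    obtain ⟨U, hU, h⟩ := hall (Fintype.card V + 1)
    have hun : U = Finset.univ := by
      rcases h with h | h
      · exact h
      · have := Finset.card_le_univ U; omega
    subst hun
    obtain ⟨C, S, hG, hSF, _, hr⟩ := hU
    have hfin := Good.complete _ S hG hSF (fun u v => hr u (Finset.mem_univ _) v (Finset.mem_univ _)) rfl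
    obtain ⟨h3, h4, h5⟩ := hfin
    obtain ⟨g, a, b, _, d⟩ := h5 0 (by simp) (by simp)
    exact ⟨C, h3, h4, g, a, b, d⟩


/-! ### The 5/3 cover of a bridgeless graph -/

theorem exists_circuit_list {p q : E → V} {Q : Finset E} (L : List (Finset E))
    (hL : ∀ S ∈ L, Ev p q S ∧ S ⊆ Q) :
    ∃ L' : List (Finset E), (∀ C ∈ L', IsCircuit (en p q) C ∧ C ⊆ Q) ∧
      totalLength L' = totalLength L ∧ ∀ S ∈ L, ∀ e ∈ S, ∃ C ∈ L', e ∈ C := by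
  induction L with
  | nil => exact ⟨[], by simp, rfl, by simp⟩
  | cons S L ih =>
    obtain ⟨L', h1, h2, h3⟩ := ih fun T hT => hL T (by simp [hT])
    obtain ⟨hS, hSQ⟩ := hL S (by simp)
    obtain ⟨𝒟, d1, d2, d3⟩ := veblen S hS
    refine ⟨𝒟.toList ++ L', ?_, ?_, ?_⟩
    · intro C hC
      rw [List.mem_append, Finset.mem_toList] at hC
      rcases hC with hC | hC
      · refine ⟨d1 C hC, ?_⟩
        refine Finset.Subset.trans ?_ hSQ
        rw [d3]; exact Finset.subset_biUnion_of_mem id hC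
      · exact h1 C hC
    · have : (𝒟.toList.map Finset.card).sum = S.card := by
        rw [Finset.sum_map_toList, d3, Finset.card_biUnion]
        · rfl
        · intro a ha b hb hab; exact d2 a ha b hb hab
      unfold totalLength at h2 ⊢
      simp [this, h2]
    · intro T hT e he
      rcases List.mem_cons.1 hT with rfl | hT
      · rw [d3, Finset.mem_biUnion] at he
        obtain ⟨C, hC, heC⟩ := he
        exact ⟨C, by simp [hC], heC⟩
      · obtain ⟨C, hC, heC⟩ := h3 T hT e he
        exact ⟨C, by simp [hC], heC⟩

theorem card_as_sum {Q S : Finset E} (h : S ⊆ Q) : S.card = ∑ e ∈ Q, (if e ∈ S then 1 else 0) := by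
  rw [← Finset.card_filter]
  congr 1
  ext e; simp only [Finset.mem_filter]
  exact ⟨fun he => ⟨h he, he⟩, fun he => he.2⟩

/-- six times accumulated cost -/
def cost6 (C A B : Finset E) : ℕ :=
  3 * C.card + 4 * (A.card + B.card + (symmDiff A B).card) +
    ((symmDiff C A).card + (symmDiff C B).card + (symmDiff C (symmDiff A B)).card)

theorem symmDiff_sub {A B Q : Finset E} (hA : A ⊆ Q) (hB : B ⊆ Q) : symmDiff A B ⊆ Q := by
  intro e he
  rw [Finset.mem_symmDiff] at he
  rcases he with h | h
  · exact hA h.1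
  · exact hB h.1

theorem cost6_eq {Q C A B : Finset E} (hC : C ⊆ Q) (hA : A ⊆ Q) (hB : B ⊆ Q) :
    cost6 C A B = ∑ e ∈ Q, (if e ∈ C then (if e ∈ A ∨ e ∈ B then 12 else 6)
      else (if e ∈ A ∨ e ∈ B then 10 else 0)) := by
  rw [cost6, card_as_sum hC, card_as_sum hA, card_as_sum hB, card_as_sum (symmDiff_sub hA hB),
    card_as_sum (symmDiff_sub hC hA), card_as_sum (symmDiff_sub hC hB),
    card_as_sum (symmDiff_sub hC (symmDiff_sub hA hB))]
  simp only [Finset.mul_sum, ← Finset.sum_add_distrib]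
  refine Finset.sum_congr rfl fun e _ => ?_
  simp only [Finset.mem_symmDiff]
  by_cases h1 : e ∈ C <;> by_cases h2 : e ∈ A <;> by_cases h3 : e ∈ B <;> simp [h1, h2, h3]

theorem pick6 {p q : E → V} {Q C A B : Finset E} (hC : Ev p q C) (hA : Ev p q A) (hB : Ev p q B)
    (hCQ : C ⊆ Q) (hAQ : A ⊆ Q) (hBQ : B ⊆ Q) (hcov : ∀ e ∈ Q, e ∈ C ∨ e ∈ A ∨ e ∈ B)
    (hcost : cost6 C A B ≤ 10 * Q.card) :
    ∃ L : List (Finset E), (∀ S ∈ L, Ev p q S ∧ S ⊆ Q) ∧ (∀ e ∈ Q, ∃ S ∈ L, e ∈ S) ∧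
      3 * totalLength L ≤ 5 * Q.card := by
  have hA' := hA.symmDiff hB
  have hAQ' := symmDiff_sub hAQ hBQ
  have gen : ∀ X Y Z : Finset E, Ev p q X → Ev p q Y → Ev p q Z → X ⊆ Q → Y ⊆ Q → Z ⊆ Q →
      (∀ e ∈ Q, e ∈ X ∨ e ∈ Y ∨ e ∈ Z) → 3 * (X.card + Y.card + Z.card) ≤ 5 * Q.card →
      ∃ L : List (Finset E), (∀ S ∈ L, Ev p q S ∧ S ⊆ Q) ∧ (∀ e ∈ Q, ∃ S ∈ L, e ∈ S) ∧
      3 * totalLength L ≤ 5 * Q.card := by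
    intro X Y Z h1 h2 h3 h4 h5 h6 h7 h8
    refine ⟨[X, Y, Z], ?_, ?_, ?_⟩
    · simp [h1, h2, h3, h4, h5, h6]
    · intro e he; simpa using h7 e he
    · simpa [totalLength, add_assoc] using h8
  by_contra hcon
  have hcov' : ∀ X Y Z : Finset E,
      (∀ e, (e ∈ C ∨ e ∈ A ∨ e ∈ B) → (e ∈ X ∨ e ∈ Y ∨ e ∈ Z)) → ∀ e ∈ Q, e ∈ X ∨ e ∈ Y ∨ e ∈ Z :=
    fun X Y Z h e he => h e (hcov e he)
  have c1 := mt (gen C A B hC hA hB hCQ hAQ hBQ hcov) hcon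
  have c2 := mt (gen C A _ hC hA hA' hCQ hAQ hAQ' (hcov' _ _ _ (by
    intro e; simp only [Finset.mem_symmDiff]; tauto))) hcon
  have c3 := mt (gen C B _ hC hB hA' hCQ hBQ hAQ' (hcov' _ _ _ (by
    intro e; simp only [Finset.mem_symmDiff]; tauto))) hcon
  have c4 := mt (gen _ A B (hC.symmDiff hA) hA hB (symmDiff_sub hCQ hAQ) hAQ hBQ (hcov' _ _ _ (by
    intro e; simp only [Finset.mem_symmDiff]; tauto))) hcon
  have c5 := mt (gen _ B _ (hC.symmDiff hB) hB hA' (symmDiff_sub hCQ hBQ) hBQ hAQ' (hcov' _ _ _ (by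
    intro e; simp only [Finset.mem_symmDiff]; tauto))) hcon
  have c6 := mt (gen _ _ A (hC.symmDiff hA') hA' hA (symmDiff_sub hCQ hAQ') hAQ' hAQ (hcov' _ _ _ (by
    intro e; simp only [Finset.mem_symmDiff]; tauto))) hcon
  unfold cost6 at hcost
  omega

theorem z3_line : ∀ g c : ZMod 3, c ≠ 0 →
    ((g ≠ 0 ∧ g + c ≠ 0 ∧ g + 2 * c = 0) ∨ (g ≠ 0 ∧ g + c = 0 ∧ g + 2 * c ≠ 0) ∨
      (g = 0 ∧ g + c ≠ 0 ∧ g + 2 * c ≠ 0)) := by decide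

theorem fivethirds (p q : E → V) (Q : Finset E) (hQ : ∀ e ∈ Q, ∃ C ⊆ Q, Ev p q C ∧ e ∈ C) :
    ∃ L : List (Finset E), (∀ C ∈ L, IsCircuit (en p q) C ∧ C ⊆ Q) ∧ (∀ e ∈ Q, ∃ C ∈ L, e ∈ C) ∧
      3 * totalLength L ≤ 5 * Q.card := by
  suffices h : ∃ L : List (Finset E), (∀ S ∈ L, Ev p q S ∧ S ⊆ Q) ∧ (∀ e ∈ Q, ∃ S ∈ L, e ∈ S) ∧
      3 * totalLength L ≤ 5 * Q.card by
    obtain ⟨L, h1, h2, h3⟩ := h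
    obtain ⟨L', h4, h5, h6⟩ := exists_circuit_list L h1
    refine ⟨L', h4, ?_, by rw [h5]; exact h3⟩
    intro e he
    obtain ⟨S, hS, heS⟩ := h2 e he
    exact h6 S hS e heS
  obtain ⟨C, hCQ, hC, g, hg, hg0, hg1⟩ := sixflow _ p q Q rfl hQ
  obtain ⟨c0, hc0, hc1, hc2⟩ := pm_flow hC
  obtain ⟨c, hcd⟩ : ∃ c : E → ZMod 3, c = fun e => (c0 e : ZMod 3) := ⟨_, rfl⟩
  have hc : bd p q c = 0 := by
    ext v; rw [hcd, ← bd_cast, hc0]; simp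
  have hcC : ∀ e ∈ C, c e ≠ 0 := by
    intro e he
    rw [hcd]
    rcases hc1 e he with h | h <;> simp only [h] <;> decide
  have hcN : ∀ e, e ∉ C → c e = 0 := by
    intro e he; rw [hcd]; simp [hc2 e he]
  have step : ∀ k : ZMod 3, ∃ A B : Finset E, Ev p q A ∧ Ev p q B ∧ A ⊆ Q ∧ B ⊆ Q ∧
      ∀ e, (e ∈ A ∨ e ∈ B) ↔ g e + k * c e ≠ 0 := by
    intro k
    obtain ⟨A, B, hA, hB, hAB⟩ := z3_split (p := p) (q := q) (g := g + fun e => k * c e)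
      (by rw [map_add, hg, bd_mul p q k c hc, add_zero])
    have hQ' : ∀ e, (e ∈ A ∨ e ∈ B) → e ∈ Q := by
      intro e he
      by_contra hn
      refine (hAB e).1 he ?_
      simp [hg0 e hn, hcN e (fun h => hn (hCQ h))]
    exact ⟨A, B, hA, hB, fun e he => hQ' e (Or.inl he), fun e he => hQ' e (Or.inr he), hAB⟩
  choose A B hA hB hAQ hBQ hAB using step
  have hsum : cost6 C (A 0) (B 0) + cost6 C (A 1) (B 1) + cost6 C (A 2) (B 2) = 30 * Q.card := by
    rw [cost6_eq hCQ (hAQ 0) (hBQ 0), cost6_eq hCQ (hAQ 1) (hBQ 1), cost6_eq hCQ (hAQ 2) (hBQ 2),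
      ← Finset.sum_add_distrib, ← Finset.sum_add_distrib]
    rw [Finset.sum_congr rfl (g := fun _ => 30)]
    · simp [mul_comm]
    · intro e he
      simp only [hAB, zero_mul, add_zero, one_mul]
      by_cases heC : e ∈ C
      · rcases z3_line (g e) (c e) (hcC e heC) with ⟨a, b, d⟩ | ⟨a, b, d⟩ | ⟨a, b, d⟩
        · simp only [heC, if_true]; rw [if_pos a, if_pos b, if_neg (by simpa using d)]
        · simp only [heC, if_true]; rw [if_pos a, if_neg (by simpa using b), if_pos d]
        · simp only [heC, if_true]; rw [if_neg (by simpa using a), if_pos b, if_pos d]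
      · simp [heC, hcN e heC, hg1 e he heC]
  have hcov : ∀ k, ∀ e ∈ Q, e ∈ C ∨ e ∈ A k ∨ e ∈ B k := by
    intro k e he
    by_cases heC : e ∈ C
    · exact Or.inl heC
    · right; rw [hAB, hcN e heC]; simpa using hg1 e he heC
  have : ∃ k : ZMod 3, cost6 C (A k) (B k) ≤ 10 * Q.card := by
    by_contra hh; push Not at hh
    have h0 := hh 0; have h1 := hh 1; have h2 := hh 2
    omega
  obtain ⟨k, hk⟩ := this
  exact pick6 hC (hA k) (hB k) hCQ (hAQ k) (hBQ k) (hcov k) hk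


/-! ### Theta lemma, barbells, pairing -/

theorem neg_union {sgn : E → Bool} {A B : Finset E} (h : Disjoint A B) :
    (negEdges sgn (A ∪ B)).card = (negEdges sgn A).card + (negEdges sgn B).card := by
  rw [negEdges, Finset.filter_union, Finset.card_union_of_disjoint]
  · rfl
  · exact Finset.disjoint_filter_filter h

theorem theta {p q : E → V} {sgn : E → Bool} {D₁ D₂ : Finset E}
    (h₁ : IsCircuit (en p q) D₁) (h₂ : IsCircuit (en p q) D₂)
    (hd : Disjoint D₁ D₂)
    (hnb : ∀ C ⊆ D₁ ∪ D₂, IsCircuit (en p q) C → Odd (negEdges sgn C).card) {u v : V}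
    (hu₁ : u ∈ support (en p q) D₁) (hu₂ : u ∈ support (en p q) D₂)
    (hv₁ : v ∈ support (en p q) D₁) (hv₂ : v ∈ support (en p q) D₂) : u = v := by
  by_contra huv
  obtain ⟨P, S, hP⟩ := DPath.of_reach (h₂.2.1 u hu₂ v hv₂)
  obtain ⟨z, P', S', hP', -, hpath, hSW, huz⟩ := hP.ear (support (en p q) D₁) huv hu₁ hv₁
  have hz : z ∈ support (en p q) D₁ := by
    have : z ∈ S' ∩ support (en p q) D₁ := by rw [hSW]; simp
    exact (Finset.mem_inter.1 this).2
  obtain ⟨A, S₁, hA⟩ := DPath.of_reach (h₁.2.1 u hu₁ z hz)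
  have hA1 := hA.sub
  have hb : bz p q (D₁ \ A) = Pi.single u 1 + Pi.single z 1 := by
    rw [bz_sdiff p q hA1, hA.bz, h₁.ev, zero_add]
  obtain ⟨B, S₂, hB⟩ := DPath.of_reach (reach_of_bz hb)
  have hB1 := hB.sub
  have hAB : Disjoint A B := Finset.disjoint_left.2 fun e he he' =>
    (Finset.mem_sdiff.1 (hB1 he')).2 he
  have hBD : B ⊆ D₁ := hB1.trans Finset.sdiff_subset
  have hEq : A ∪ B = D₁ := by
    refine h₁.minimal (Finset.union_subset hA1 hBD) ?_ ?_
    · exact (hA.isPath huz).1.mono Finset.subset_union_left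
    · rw [Ev, bz_union p q hAB, hA.bz, hB.bz, z2_add_self]
  have hP'D : P' ⊆ D₂ := hpath.sub
  have key : ∀ (G A' : Finset E) (T : Finset V), DPath (us p q G) u z A' T → A' ⊆ D₁ →
      Odd ((negEdges sgn A').card + (negEdges sgn P').card) := by
    intro G A' T hT hs
    have hdis : Disjoint A' P' := Finset.disjoint_of_subset_left hs
      (Finset.disjoint_of_subset_right hP'D hd)
    rw [← neg_union hdis]
    refine hnb _ (Finset.union_subset_union hs hP'D) (hT.circ_two hpath huz ?_ hdis)
    intro x hx hx'
    have : x ∈ S' ∩ support (en p q) D₁ := by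
      rw [Finset.mem_inter]
      refine ⟨hx', support_mono hs ?_⟩
      rw [hT.support_eq huz]; exact hx
    rw [hSW] at this
    simpa using this
  have k1 := key _ _ _ hA hA1
  have k2 := key _ _ _ hB hBD
  have k3 := hnb D₁ Finset.subset_union_left h₁
  rw [← hEq, neg_union hAB] at k3
  grind

theorem barbell {p q : E → V} {sgn : E → Bool} {D₁ D₂ : Finset E}
    (h₁ : IsCircuit (en p q) D₁) (h₂ : IsCircuit (en p q) D₂) (hd : Disjoint D₁ D₂)
    (hnb : ∀ C ⊆ D₁ ∪ D₂, IsCircuit (en p q) C → Odd (negEdges sgn C).card) {r₁ r₂ : V}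
    (hr₁ : r₁ ∈ support (en p q) D₁) (hr₂ : r₂ ∈ support (en p q) D₂) {R : Finset E}
    (hR : Reach (en p q) R r₁ r₂) :
    ∃ S, IsSignedCircuit (en p q) sgn S ∧ D₁ ⊆ S ∧ D₂ ⊆ S ∧ S.card ≤ D₁.card + D₂.card + R.card ∧
      Reach (en p q) S r₁ r₂ := by
  have u₁ : IsUnbalancedCircuit (en p q) sgn D₁ := ⟨h₁, hnb _ Finset.subset_union_left h₁⟩
  have u₂ : IsUnbalancedCircuit (en p q) sgn D₂ := ⟨h₂, hnb _ Finset.subset_union_right h₂⟩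
  by_cases hm : ∃ w, w ∈ support (en p q) D₁ ∧ w ∈ support (en p q) D₂
  · obtain ⟨w, hw1, hw2⟩ := hm
    refine ⟨D₁ ∪ D₂, Or.inr (Or.inl ⟨D₁, D₂, hd, rfl, u₁, u₂, w, ?_⟩), Finset.subset_union_left,
      Finset.subset_union_right, (Finset.card_union_le _ _).trans (by omega), ?_⟩
    · ext x
      simp only [Finset.mem_inter, Finset.mem_singleton]
      constructor
      · rintro ⟨ha, hb⟩; exact theta h₁ h₂ hd hnb ha hb hw1 hw2
      · rintro rfl; exact ⟨hw1, hw2⟩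
    · exact (reach_mono Finset.subset_union_left (h₁.2.1 _ hr₁ _ hw1)).trans
        (reach_mono Finset.subset_union_right (h₂.2.1 _ hw2 _ hr₂))
  · have hdis : Disjoint (support (en p q) D₁) (support (en p q) D₂) :=
      Finset.disjoint_left.2 fun x hx hx' => hm ⟨x, hx, hx'⟩
    obtain ⟨P, S, hP⟩ := DPath.of_reach hR
    obtain ⟨a, P', S', -, -, hP', hSa⟩ := hP.lastHit (support (en p q) D₁) ⟨r₁, hP.left_mem, hr₁⟩
    obtain ⟨b, T, U, -, hU, hT, hSb⟩ := hP'.firstHit (support (en p q) D₂) hr₂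
    have hT' := hT.sub
    have ha : a ∈ support (en p q) D₁ := by
      have : a ∈ S' ∩ support (en p q) D₁ := by rw [hSa]; simp
      exact (Finset.mem_inter.1 this).2
    have hb : b ∈ support (en p q) D₂ := by
      have : b ∈ U ∩ support (en p q) D₂ := by rw [hSb]; simp
      exact (Finset.mem_inter.1 this).2
    have hab : a ≠ b := by rintro rfl; exact hm ⟨a, ha, hb⟩
    have hUa : U ∩ support (en p q) D₁ = {a} := by
      ext x
      constructor
      · intro hx
        rw [← hSa]; rw [Finset.mem_inter] at hx ⊢; exact ⟨hU hx.1, hx.2⟩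
      · intro hx
        rw [Finset.mem_singleton] at hx; subst hx
        exact Finset.mem_inter.2 ⟨hT.left_mem, ha⟩
    have disj : ∀ (D : Finset E) (c : V), U ∩ support (en p q) D = {c} → Disjoint D T := by
      intro D c hc
      refine Finset.disjoint_left.2 fun e he he' => ?_
      obtain ⟨x1, x2, x3⟩ := hT.ends_mem he'
      have y1 : p e ∈ U ∩ support (en p q) D :=
        Finset.mem_inter.2 ⟨x1, mem_support.2 ⟨e, he, Or.inl rfl⟩⟩
      have y2 : q e ∈ U ∩ support (en p q) D :=
        Finset.mem_inter.2 ⟨x2, mem_support.2 ⟨e, he, Or.inr rfl⟩⟩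
      rw [hc, Finset.mem_singleton] at y1 y2
      exact x3 (y1.trans y2.symm)
    have hs := hT.support_eq hab
    refine ⟨D₁ ∪ D₂ ∪ T, Or.inr (Or.inr ⟨D₁, D₂, T, a, b, hd, disj _ _ hUa, disj _ _ hSb, rfl, u₁, u₂,
      hdis, hT.isPath hab, by rw [hs, hUa], by rw [hs, hSb]⟩), ?_, ?_, ?_, ?_⟩
    · exact Finset.subset_union_left.trans Finset.subset_union_left
    · exact Finset.subset_union_right.trans Finset.subset_union_left
    · have := Finset.card_le_card hT'
      have h3 := Finset.card_union_le (D₁ ∪ D₂) T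
      have h4 := Finset.card_union_le D₁ D₂
      omega
    · refine (reach_mono ?_ (h₁.2.1 _ hr₁ _ ha)).trans
        ((reach_mono ?_ (hT.reach hT.left_mem)).trans (reach_mono ?_ (h₂.2.1 _ hb _ hr₂)))
      · exact Finset.subset_union_left.trans Finset.subset_union_left
      · exact Finset.subset_union_right
      · exact Finset.subset_union_right.trans Finset.subset_union_left

theorem pairing {p q : E → V} {sgn : E → Bool} {J : Finset E}
    (hnb : ∀ C ⊆ J, IsCircuit (en p q) C → Odd (negEdges sgn C).card) (r : Finset E → V)
    (n : ℕ) (𝒟 : Finset (Finset E)) (hn : 𝒟.card = n)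
    (hc : ∀ D ∈ 𝒟, IsCircuit (en p q) D ∧ D ⊆ J ∧ r D ∈ support (en p q) D)
    (hdis : ∀ D ∈ 𝒟, ∀ D' ∈ 𝒟, D ≠ D' → Disjoint D D') (Z : Finset E)
    (hZ : bz p q Z = ∑ D ∈ 𝒟, Pi.single (r D) 1) :
    ∃ L : List (Finset E), (∀ S ∈ L, IsSignedCircuit (en p q) sgn S) ∧
      (∀ D ∈ 𝒟, ∃ S ∈ L, D ⊆ S) ∧ totalLength L ≤ ∑ D ∈ 𝒟, D.card + Z.card ∧
      ∀ b X, Cl p q (Finset.univ.erase b) X → (∀ S ∈ L, b ∉ S) →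
        Even (𝒟.filter fun D => r D ∈ X).card := by
  induction n using Nat.strong_induction_on generalizing 𝒟 Z with
  | _ n ih =>
    rcases 𝒟.eq_empty_or_nonempty with rfl | ⟨D, hD⟩
    · exact ⟨[], by simp, by simp, by simp [totalLength], by simp⟩
    have hX : Even (𝒟.filter fun D' => r D' ∈ rs p q Z (r D)).card := by
      rw [← ZMod.natCast_eq_zero_iff_even]
      have h1 : ∑ v ∈ rs p q Z (r D), bz p q Z v = 0 := by
        rw [cut_parity, Finset.filter_false_of_mem]
        · simp
        · intro e he h; exact h (cl_rs p q Z (r D) e he)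
      rw [hZ] at h1
      rw [← h1]
      simp only [Finset.sum_apply]
      rw [Finset.sum_comm, Finset.card_filter]
      push_cast
      refine Finset.sum_congr rfl fun D' _ => ?_
      simp [Pi.single_apply]
    have hDm : D ∈ 𝒟.filter fun D' => r D' ∈ rs p q Z (r D) :=
      Finset.mem_filter.2 ⟨hD, self_mem_rs⟩
    obtain ⟨D', hD', hne⟩ : ∃ D' ∈ 𝒟.filter fun D' => r D' ∈ rs p q Z (r D), D' ≠ D := by
      by_contra hh; push Not at hh
      have : (𝒟.filter fun D' => r D' ∈ rs p q Z (r D)) = {D} :=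
        Finset.eq_singleton_iff_unique_mem.2 ⟨hDm, hh⟩
      rw [this] at hX; simp at hX
    rw [Finset.mem_filter, mem_rs] at hD'
    obtain ⟨hD', hreach⟩ := hD'
    obtain ⟨T, U, hT⟩ := DPath.of_reach hreach
    have hTZ := hT.sub
    obtain ⟨S, hS1, hS2, hS3, hS4, hS5⟩ := barbell (hc D hD).1 (hc D' hD').1
      (hdis D hD D' hD' hne.symm)
      (fun C hC => hnb C (hC.trans (Finset.union_subset (hc D hD).2.1 (hc D' hD').2.1)))
      (hc D hD).2.2 (hc D' hD').2.2 (hT.reach hT.left_mem)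
    have hD'e : D' ∈ 𝒟.erase D := Finset.mem_erase.2 ⟨hne, hD'⟩
    have hsub : ∀ {X}, X ∈ (𝒟.erase D).erase D' → X ∈ 𝒟 :=
      fun h => Finset.mem_of_mem_erase (Finset.mem_of_mem_erase h)
    obtain ⟨L, hL1, hL2, hL3, hL4⟩ := ih ((𝒟.erase D).erase D').card (by
        rw [← hn, Finset.card_erase_of_mem hD'e, Finset.card_erase_of_mem hD]
        have := Finset.card_pos.2 ⟨D, hD⟩; omega) ((𝒟.erase D).erase D') rfl
      (fun X hX => hc X (hsub hX))
      (fun X hX Y hY => hdis X (hsub hX) Y (hsub hY)) (Z \ T) (by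
        rw [bz_sdiff p q hTZ, hT.bz, hZ, ← Finset.add_sum_erase _ _ hD,
          ← Finset.add_sum_erase _ _ hD'e]
        have := z2_add_self (Pi.single (r D) 1 : V → ZMod 2)
        have h2 := z2_add_self (Pi.single (r D') 1 : V → ZMod 2)
        linear_combination this + h2)
    refine ⟨S :: L, ?_, ?_, ?_, ?_⟩
    · intro X hX
      rcases List.mem_cons.1 hX with rfl | h
      · exact hS1
      · exact hL1 X h
    · intro X hX
      by_cases h1 : X = D
      · exact ⟨S, by simp, h1 ▸ hS2⟩
      by_cases h2 : X = D'
      · exact ⟨S, by simp, h2 ▸ hS3⟩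
      obtain ⟨Y, hY, hXY⟩ := hL2 X (by simp [h1, h2, hX])
      exact ⟨Y, by simp [hY], hXY⟩
    · rw [← Finset.add_sum_erase _ _ hD, ← Finset.add_sum_erase _ _ hD'e]
      have h3 := Finset.card_sdiff_add_card_eq_card hTZ
      simp only [totalLength, List.map_cons, List.sum_cons] at hL3 ⊢
      omega
    · intro b X hX hb
      have h5 := hL4 b X hX fun S hS => hb S (by simp [hS])
      have h6 : r D ∈ X ↔ r D' ∈ X := by
        refine reach_cl hX (reach_mono ?_ hS5)
        intro e he
        refine Finset.mem_erase.2 ⟨?_, Finset.mem_univ _⟩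
        rintro rfl; exact hb S (by simp) he
      rw [← Finset.insert_erase hD, ← Finset.insert_erase hD'e, Finset.filter_insert,
        Finset.filter_insert]
      by_cases h7 : r D ∈ X
      · rw [if_pos h7, if_pos (h6.1 h7), Finset.card_insert_of_notMem, Finset.card_insert_of_notMem]
        · grind
        · simp
        · simp [hne.symm]
      · rw [if_neg h7, if_neg (fun h => h7 (h6.2 h))]; exact h5


/-! ### Joins, peeling, and the main covering lemma -/

theorem join_exists {p q : E → V} {F : Finset E} (n : ℕ) (t : V → ZMod 2)
    (hn : (Finset.univ.filter fun v => t v ≠ 0).card = n)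
    (h : ∀ u, ∑ v ∈ rs p q F u, t v = 0) : ∃ Z ⊆ F, bz p q Z = t := by
  induction n using Nat.strong_induction_on generalizing t with
  | _ n ih =>
    by_cases h0 : ∃ u, t u ≠ 0
    · obtain ⟨u, hu⟩ := h0
      have h1 := h u
      obtain ⟨w, hw, hwu, hw0⟩ : ∃ w ∈ rs p q F u, w ≠ u ∧ t w ≠ 0 := by
        by_contra hh; push Not at hh
        rw [Finset.sum_eq_single u hh (fun h => absurd self_mem_rs h)] at h1
        exact hu h1
      have two : ∀ x : ZMod 2, x ≠ 0 → x = 1 := by decide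
      have hu1 := two _ hu
      have hw1 := two _ hw0
      obtain ⟨T, U, hT⟩ := DPath.of_reach (mem_rs.1 hw)
      obtain ⟨t', ht'⟩ : ∃ t' : V → ZMod 2, t' = t + (Pi.single u 1 + Pi.single w 1) := ⟨_, rfl⟩
      have key : (Finset.univ.filter fun v => t' v ≠ 0) ⊂ Finset.univ.filter fun v => t v ≠ 0 := by
        rw [Finset.ssubset_iff_of_subset]
        · refine ⟨u, by simp [hu], ?_⟩
          simp [ht', hu1, Pi.single_apply, hwu.symm]
          decide
        · intro v hv
          rw [Finset.mem_filter] at hv ⊢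
          refine ⟨hv.1, ?_⟩
          by_cases a : v = u
          · rw [a]; exact hu
          by_cases b : v = w
          · rw [b]; exact hw0
          have := hv.2
          simpa [ht', Pi.single_apply, a, b] using this
      obtain ⟨Z, hZ, hbz⟩ := ih _ (by rw [← hn]; exact Finset.card_lt_card key) t' rfl (by
        intro x
        have hiff : u ∈ rs p q F x ↔ w ∈ rs p q F x :=
          reach_cl (cl_rs p q F x) (mem_rs.1 hw)
        simp only [ht', Pi.add_apply, Finset.sum_add_distrib, h x, Finset.sum_pi_single', ← hiff]
        split_ifs <;> decide)
      refine ⟨symmDiff Z T, ?_, ?_⟩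
      · intro e he
        rcases Finset.mem_symmDiff.1 he with h | h
        · exact hZ h.1
        · exact hT.sub h.1
      · rw [bz_symmDiff, hbz, hT.bz, ht', add_assoc, z2_add_self, add_zero]
    · push Not at h0
      exact ⟨∅, by simp, by rw [bz_empty]; ext v; simp [h0]⟩

theorem circ_side {p q : E → V} {C : Finset E} {X : Finset V} (hC : IsCircuit (en p q) C)
    (hX : Cl p q C X) {r : V} (hr : r ∈ support (en p q) C) {e : E} (he : e ∈ C) :
    p e ∈ X ↔ r ∈ X :=
  reach_cl hX (hC.2.1 _ (mem_support.2 ⟨e, he, Or.inl rfl⟩) _ hr)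

/-- number of negative edges of `F` on the side `X`, mod 2 -/
def nx (p : E → V) (sgn : E → Bool) (X : Finset V) (F : Finset E) : ZMod 2 :=
  ∑ e ∈ F, if sgn e = true ∧ p e ∈ X then 1 else 0

theorem nx_union {p : E → V} {sgn : E → Bool} {X : Finset V} {F G : Finset E} (h : Disjoint F G) :
    nx p sgn X (F ∪ G) = nx p sgn X F + nx p sgn X G := Finset.sum_union h

theorem nx_circ {p q : E → V} {sgn : E → Bool} {C : Finset E} {X : Finset V}
    (hC : IsCircuit (en p q) C) (hX : Cl p q C X) {r : V} (hr : r ∈ support (en p q) C) :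
    nx p sgn X C = if r ∈ X then ((negEdges sgn C).card : ZMod 2) else 0 := by
  split_ifs with h
  · rw [nx, negEdges, Finset.card_filter]
    push_cast
    refine Finset.sum_congr rfl fun e he => ?_
    simp [(circ_side hC hX hr he).2 h]
  · refine Finset.sum_eq_zero fun e he => ?_
    rw [if_neg]
    rintro ⟨-, h2⟩
    exact h ((circ_side hC hX hr he).1 h2)

theorem IsCircuit.exists_mem {p q : E → V} {C : Finset E} (hC : IsCircuit (en p q) C) :
    ∃ r, r ∈ support (en p q) C := by
  obtain ⟨e, he⟩ := hC.1
  exact ⟨p e, mem_support.2 ⟨e, he, Or.inl rfl⟩⟩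

theorem peel {p q : E → V} (sgn : E → Bool) (n : ℕ) (J : Finset E) (hn : J.card = n)
    (hJ : Ev p q J) :
    ∃ (L : List (Finset E)) (J' : Finset E), J' ⊆ J ∧ Ev p q J' ∧
      (∀ C ∈ L, IsBalancedCircuit (en p q) sgn C) ∧
      (∀ C ⊆ J', IsCircuit (en p q) C → Odd (negEdges sgn C).card) ∧
      (∀ e ∈ J, e ∈ J' ∨ ∃ C ∈ L, e ∈ C) ∧ totalLength L + J'.card = J.card ∧
      ∀ X, Cl p q J X → nx p sgn X J = nx p sgn X J' := by
  induction n using Nat.strong_induction_on generalizing J with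
  | _ n ih =>
    by_cases h : ∃ C ⊆ J, IsBalancedCircuit (en p q) sgn C
    · obtain ⟨C, hCJ, hC⟩ := h
      have hcard := Finset.card_sdiff_add_card_eq_card hCJ
      have hpos := Finset.card_pos.2 hC.1.1
      obtain ⟨L, J', h1, h2, h3, h4, h5, h6, h7⟩ := ih (J \ C).card (by omega) (J \ C) rfl
        (hJ.sdiff hC.1.ev hCJ)
      refine ⟨C :: L, J', h1.trans Finset.sdiff_subset, h2, ?_, h4, ?_, ?_, ?_⟩
      · intro D hD
        rcases List.mem_cons.1 hD with rfl | h
        · exact hC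
        · exact h3 D h
      · intro e he
        by_cases heC : e ∈ C
        · exact Or.inr ⟨C, by simp, heC⟩
        · rcases h5 e (Finset.mem_sdiff.2 ⟨he, heC⟩) with h | ⟨D, hD, h⟩
          · exact Or.inl h
          · exact Or.inr ⟨D, by simp [hD], h⟩
      · simp only [totalLength, List.map_cons, List.sum_cons] at h6 ⊢
        omega
      · intro X hX
        rw [← h7 X (hX.mono Finset.sdiff_subset)]
        have e1 : nx p sgn X J = nx p sgn X (J \ C) + nx p sgn X C := by
          rw [← nx_union Finset.sdiff_disjoint, Finset.sdiff_union_of_subset hCJ]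
        obtain ⟨r, hr⟩ := hC.1.exists_mem
        rw [e1, nx_circ hC.1 (hX.mono hCJ) hr, (ZMod.natCast_eq_zero_iff_even).2 hC.2]
        simp
    · push Not at h
      refine ⟨[], J, subset_rfl, hJ, by simp, ?_, fun e he => Or.inl he, by simp [totalLength],
        fun X _ => rfl⟩
      intro C hC hcirc
      have := h C hC
      rw [← Nat.not_even_iff_odd]
      intro he
      exact this ⟨hcirc, he⟩

theorem nx_neg {p : E → V} {sgn : E → Bool} {X : Finset V} {M J₀ : Finset E}
    (hM : ∀ e ∈ M, sgn e = true) (hJ : ∀ e ∈ J₀, sgn e = false) (hd : Disjoint M J₀) :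
    nx p sgn X (M ∪ J₀) = ((M.filter fun e => p e ∈ X).card : ZMod 2) := by
  rw [nx_union hd]
  have : nx p sgn X J₀ = 0 := Finset.sum_eq_zero fun e he => by simp [hJ e he]
  rw [this, add_zero, nx, Finset.card_filter]
  push_cast
  refine Finset.sum_congr rfl fun e he => by simp [hM e he]

set_option maxHeartbeats 1000000 in
theorem lemA {p q : E → V} {sgn : E → Bool} {P : Finset E} (hP : ∀ e, e ∈ P ↔ sgn e = false)
    (hreach : ∀ e, sgn e = true → Reach (en p q) P (p e) (q e)) {M : Finset E}
    (hM : ∀ e ∈ M, sgn e = true)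
    (heven : ∀ u, Even (M.filter fun e => p e ∈ rs p q Finset.univ u).card) :
    ∃ J₀ ⊆ P, Ev p q (M ∪ J₀) ∧ ∃ L : List (Finset E),
      (∀ S ∈ L, IsSignedCircuit (en p q) sgn S) ∧ (∀ e ∈ M ∪ J₀, ∃ S ∈ L, e ∈ S) ∧
      (∀ b X, Cl p q (Finset.univ.erase b) X → (∀ S ∈ L, b ∉ S) →
        Even (M.filter fun e => p e ∈ X).card) ∧
      2 * totalLength L ≤ 3 * M.card + 2 * (nb p q P).card + 3 * (P \ nb p q P).card := by
  rcases isEmpty_or_nonempty V with hV | hV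
  · have hE : IsEmpty E := ⟨fun e => hV.false (p e)⟩
    refine ⟨∅, by simp, ?_, [], by simp, fun e => isEmptyElim e, fun b => isEmptyElim b,
      by simp [totalLength]⟩
    ext v; exact isEmptyElim v
  have hcl : ∀ X, Cl p q P X → Cl p q Finset.univ X := by
    intro X hX e _
    by_cases he : e ∈ P
    · exact hX e he
    · refine reach_cl hX (hreach e ?_)
      rw [hP] at he; simpa using he
  obtain ⟨J₁, hJ₁, hJ₁b⟩ := join_exists (p := p) (q := q) (F := P) _ (bz p q M) rfl (by
    intro u
    rw [cut_parity, Finset.filter_false_of_mem]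
    · simp
    · intro e he h
      exact h (hcl _ (cl_rs p q P u) e (Finset.mem_univ _)))
  obtain ⟨J₀, hJ₀, hJ₀b, hJ₀c⟩ := half p q P J₁ hJ₁
  have hMJ : Disjoint M J₀ := Finset.disjoint_left.2 fun e he he' => by
    have h1 := hM e he
    have h2 := (hP e).1 (hJ₀ he')
    rw [h1] at h2; exact absurd h2 (by decide)
  have hMP : Disjoint M P := Finset.disjoint_left.2 fun e he he' => by
    have h1 := hM e he
    have h2 := (hP e).1 he'
    rw [h1] at h2; exact absurd h2 (by decide)
  have hJev : Ev p q (M ∪ J₀) := by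
    rw [Ev, bz_union p q hMJ, hJ₀b, hJ₁b, z2_add_self]
  refine ⟨J₀, hJ₀, hJev, ?_⟩
  obtain ⟨L₁, J', hJ'J, hJ'ev, hL₁, hodd, hcov, hlen, hnx⟩ := peel sgn _ (M ∪ J₀) rfl hJev
  obtain ⟨𝒟, h𝒟, hdis, hJ'⟩ := veblen J' hJ'ev
  have hDJ' : ∀ D ∈ 𝒟, D ⊆ J' := by
    intro D hD
    rw [hJ']; exact Finset.subset_biUnion_of_mem id hD
  have hr : ∀ D : Finset E, ∃ r, IsCircuit (en p q) D → r ∈ support (en p q) D := by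
    intro D
    by_cases h : IsCircuit (en p q) D
    · obtain ⟨r, hr⟩ := h.exists_mem
      exact ⟨r, fun _ => hr⟩
    · exact ⟨Classical.arbitrary V, fun h' => absurd h' h⟩
  choose r hr using hr
  have hpar : ∀ X, Cl p q (M ∪ J₀) X →
      ((𝒟.filter fun D => r D ∈ X).card : ZMod 2) = ((M.filter fun e => p e ∈ X).card : ZMod 2) := by
    intro X hX
    rw [← nx_neg hM (fun e he => (hP e).1 (hJ₀ he)) hMJ, hnx X hX, hJ', nx, Finset.sum_biUnion]
    · rw [Finset.card_filter]
      push_cast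
      refine Finset.sum_congr rfl fun D hD => ?_
      have := nx_circ (sgn := sgn) (h𝒟 D hD) (hX.mono ((hDJ' D hD).trans hJ'J)) (hr D (h𝒟 D hD))
      rw [nx] at this
      rw [id, this]
      have h1 : ((negEdges sgn D).card : ZMod 2) = 1 := by
        rw [ZMod.natCast_eq_one_iff_odd]; exact hodd D (hDJ' D hD) (h𝒟 D hD)
      rw [h1]
    · intro D hD D' hD' hne
      exact hdis D hD D' hD' hne
  obtain ⟨F, hF⟩ : ∃ F, F = P ∪ M := ⟨_, rfl⟩
  have hJF : M ∪ J₀ ⊆ F := by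
    rw [hF]; exact Finset.union_subset Finset.subset_union_right (hJ₀.trans Finset.subset_union_left)
  obtain ⟨Z₁, hZ₁, hZ₁b⟩ := join_exists (p := p) (q := q) (F := F) _
    (∑ D ∈ 𝒟, Pi.single (r D) 1) rfl (by
      intro u
      have h1 : Cl p q Finset.univ (rs p q F u) :=
        hcl _ ((cl_rs p q F u).mono (by rw [hF]; exact Finset.subset_union_left))
      have h2 := hpar _ (h1.mono (Finset.subset_univ _))
      have h3 : rs p q F u = rs p q Finset.univ u := by
        ext w
        constructor
        · intro h; exact mem_rs.2 (reach_mono (Finset.subset_univ _) (mem_rs.1 h))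
        · intro h; exact (reach_cl h1 (mem_rs.1 h)).1 self_mem_rs
      have h4 := heven u
      rw [← h3] at h4
      rw [(ZMod.natCast_eq_zero_iff_even).2 h4] at h2
      rw [← h2]
      simp only [Finset.sum_apply]
      rw [Finset.sum_comm, Finset.card_filter]
      push_cast
      refine Finset.sum_congr rfl fun D' _ => ?_
      simp [Pi.single_apply])
  obtain ⟨Z, hZ, hZb, hZc⟩ := half p q F Z₁ hZ₁
  obtain ⟨L₂, hL₂, hL₂c, hL₂l, hL₂p⟩ := pairing hodd r _ 𝒟 rfl
    (fun D hD => ⟨h𝒟 D hD, hDJ' D hD, hr D (h𝒟 D hD)⟩) hdis Z (hZb.trans hZ₁b)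
  have hcovJ : ∀ e ∈ M ∪ J₀, ∃ S ∈ L₁ ++ L₂, e ∈ S := by
    intro e he
    rcases hcov e he with h | ⟨C, hC, h⟩
    · rw [hJ', Finset.mem_biUnion] at h
      obtain ⟨D, hD, h⟩ := h
      obtain ⟨S, hS, hDS⟩ := hL₂c D hD
      exact ⟨S, by simp [hS], hDS h⟩
    · exact ⟨C, by simp [hC], h⟩
  refine ⟨L₁ ++ L₂, ?_, hcovJ, ?_, ?_⟩
  · intro S hS
    rcases List.mem_append.1 hS with h | h
    · exact Or.inl (hL₁ S h)
    · exact hL₂ S h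
  · intro b X hX hb
    have h1 := hL₂p b X hX fun S hS => hb S (by simp [hS])
    have h2 : Cl p q (M ∪ J₀) X := by
      refine hX.mono fun e he => Finset.mem_erase.2 ⟨?_, Finset.mem_univ _⟩
      rintro rfl
      obtain ⟨S, hS, h⟩ := hcovJ e he
      exact hb S hS h
    rw [← ZMod.natCast_eq_zero_iff_even] at h1 ⊢
    rw [← hpar X h2]; exact h1
  · have hsumD : ∑ D ∈ 𝒟, D.card = J'.card := by
      rw [hJ', Finset.card_biUnion]
      · rfl
      · intro D hD D' hD' hne; exact hdis D hD D' hD' hne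
    have htl : totalLength (L₁ ++ L₂) = totalLength L₁ + totalLength L₂ := by
      simp [totalLength]
    have c1 : (M ∪ J₀).card = M.card + J₀.card := Finset.card_union_of_disjoint hMJ
    have c2 : J₀.card = (J₀ ∩ nb p q P).card + (J₀ \ nb p q P).card :=
      (Finset.card_inter_add_card_sdiff _ _).symm
    have c3 : Z.card = (Z ∩ nb p q F).card + (Z \ nb p q F).card :=
      (Finset.card_inter_add_card_sdiff _ _).symm
    have hnbF : nb p q F ⊆ F := Finset.filter_subset _ _
    have hnbP : nb p q P ⊆ P := Finset.filter_subset _ _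
    have c4 := Finset.card_sdiff_add_card_eq_card hnbF
    have c5 := Finset.card_sdiff_add_card_eq_card hnbP
    have c6 : (Z \ nb p q F).card ≤ (F \ nb p q F).card :=
      Finset.card_le_card (Finset.sdiff_subset_sdiff hZ subset_rfl)
    have c7 : F.card = P.card + M.card := by
      rw [hF]; exact Finset.card_union_of_disjoint hMP.symm
    have c8 : F \ nb p q F ⊆ (P \ nb p q P) \ J₀ := by
      intro e he
      rw [Finset.mem_sdiff] at he
      have hb : ∀ C ⊆ F, Ev p q C → e ∉ C := by
        intro C hC hE heC
        exact he.2 (Finset.mem_filter.2 ⟨he.1, C, hC, hE, heC⟩)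
      have hJe := hb _ hJF hJev
      rw [Finset.mem_union, not_or] at hJe
      rw [Finset.mem_sdiff, Finset.mem_sdiff]
      have heP : e ∈ P := by
        have := he.1
        rw [hF, Finset.mem_union] at this
        exact this.resolve_right hJe.1
      refine ⟨⟨heP, fun h => ?_⟩, hJe.2⟩
      obtain ⟨C, hC, hE, heC⟩ := (Finset.mem_filter.1 h).2
      exact hb C (hC.trans (by rw [hF]; exact Finset.subset_union_left)) hE heC
    have c9 := Finset.card_le_card c8
    have c10 : J₀ \ nb p q P ⊆ P \ nb p q P := Finset.sdiff_subset_sdiff hJ₀ subset_rfl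
    have c11 : (P \ nb p q P) \ J₀ = (P \ nb p q P) \ (J₀ \ nb p q P) := by
      ext e; simp only [Finset.mem_sdiff]; tauto
    have c12 := Finset.card_sdiff_add_card_eq_card c10
    rw [← c11] at c12
    omega


/-! ### Labels -/

theorem laminar_label {α : Type} [DecidableEq α] (n : ℕ) (U : Finset α) (hn : U.card = n)
    (𝓛 : Finset α → Prop) (hsub : ∀ A, 𝓛 A → A ⊆ U ∧ A.Nonempty)
    (hlam : ∀ A B, 𝓛 A → 𝓛 B → A ⊆ B ∨ B ⊆ A ∨ Disjoint A B) :
    ∃ x : α → ZMod 2 × ZMod 2, (∀ u ∈ U, x u ≠ 0) ∧ ∀ A, 𝓛 A → ∑ u ∈ A, x u ≠ 0 := by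
  induction n using Nat.strong_induction_on generalizing U 𝓛 with
  | _ n ih =>
    by_cases h : ∃ A, 𝓛 A ∧ 2 ≤ A.card
    · obtain ⟨S, ⟨hS, hS2⟩, hmin⟩ := exists_minimalFor_of_wellFoundedLT
        (fun A : Finset α => 𝓛 A ∧ 2 ≤ A.card) Finset.card h
      obtain ⟨u, hu, v, hv, huv⟩ := Finset.one_lt_card.1 hS2
      have hone : ∀ A, 𝓛 A → (u ∈ A ↔ v ∉ A) → A = {u} ∨ A = {v} := by
        intro A hA hx
        have h1 : ∃ w ∈ A, w = u ∨ w = v := by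
          by_cases hh : u ∈ A
          · exact ⟨u, hh, Or.inl rfl⟩
          · exact ⟨v, by tauto, Or.inr rfl⟩
        obtain ⟨w, hw, hw'⟩ := h1
        have hwS : w ∈ S := by rcases hw' with rfl | rfl <;> assumption
        have hnS : ¬ S ⊆ A := fun h => by
          have := h hu; have := h hv; tauto
        have hAS : A ⊆ S := by
          rcases hlam A S hA hS with h | h | h
          · exact h
          · exact absurd h hnS
          · exact absurd hwS (Finset.disjoint_left.1 h hw)
        have hlt : A.card < S.card := Finset.card_lt_card ⟨hAS, hnS⟩
        have h1 : A.card = 1 := by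
          have hpos := Finset.card_pos.2 (hsub A hA).2
          by_contra hne
          have := hmin (j := A) ⟨hA, by omega⟩ hlt.le
          omega
        obtain ⟨y, rfl⟩ := Finset.card_eq_one.1 h1
        rw [Finset.mem_singleton] at hw
        subst hw
        rcases hw' with rfl | rfl
        · exact Or.inl rfl
        · exact Or.inr rfl
      have hvU := (hsub S hS).1 hv
      have huU := (hsub S hS).1 hu
      obtain ⟨x, hx1, hx2⟩ := ih (U.erase v).card
        (by rw [← hn]; exact Finset.card_erase_lt_of_mem hvU) (U.erase v) rfl
        (fun B => B.Nonempty ∧ ∃ A, 𝓛 A ∧ B = A.erase v)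
        (by
          rintro B ⟨hB, A, hA, rfl⟩
          exact ⟨Finset.erase_subset_erase _ (hsub A hA).1, hB⟩)
        (by
          rintro B B' ⟨-, A, hA, rfl⟩ ⟨-, A', hA', rfl⟩
          rcases hlam A A' hA hA' with h | h | h
          · exact Or.inl (Finset.erase_subset_erase _ h)
          · exact Or.inr (Or.inl (Finset.erase_subset_erase _ h))
          · right; right
            exact Finset.disjoint_of_subset_left (Finset.erase_subset _ _)
              (Finset.disjoint_of_subset_right (Finset.erase_subset _ _) h))
      have hc := hx1 u (Finset.mem_erase.2 ⟨huv, huU⟩)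
      have hpick : ∀ c : ZMod 2 × ZMod 2, ∃ a : ZMod 2 × ZMod 2, a ≠ 0 ∧ (c ≠ 0 → a + c ≠ 0) := by
        decide
      obtain ⟨a, ha, hac⟩ := hpick (x u)
      have hac := hac hc
      obtain ⟨y, hy⟩ : ∃ y : α → ZMod 2 × ZMod 2,
        y = fun w => if w = u then a else if w = v then a + x u else x w := ⟨_, rfl⟩
      have hyu : y u = a := by rw [hy]; simp
      have hyv : y v = a + x u := by rw [hy]; simp [huv.symm]
      have hyw : ∀ w, w ≠ u → w ≠ v → y w = x w := by
        intro w h1 h2; rw [hy]; simp [h1, h2]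
      refine ⟨y, ?_, ?_⟩
      · intro w hw
        by_cases h1 : w = u
        · rw [h1, hyu]; exact ha
        by_cases h2 : w = v
        · rw [h2, hyv]; exact hac
        rw [hyw w h1 h2]
        exact hx1 w (Finset.mem_erase.2 ⟨h2, hw⟩)
      · intro A hA
        by_cases hxo : u ∈ A ↔ v ∉ A
        · rcases hone A hA hxo with rfl | rfl
          · rw [Finset.sum_singleton, hyu]; exact ha
          · rw [Finset.sum_singleton, hyv]; exact hac
        by_cases huA : u ∈ A
        · have hvA : v ∈ A := by tauto
          have huA' : u ∈ A.erase v := Finset.mem_erase.2 ⟨huv, huA⟩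
          have := hx2 (A.erase v) ⟨⟨u, huA'⟩, A, hA, rfl⟩
          rw [← Finset.add_sum_erase _ _ huA'] at this
          rw [← Finset.add_sum_erase _ _ hvA, ← Finset.add_sum_erase _ _ huA', hyu, hyv,
            Finset.sum_congr rfl (g := x)]
          · have h2 : a + a = 0 := (by decide : ∀ a : ZMod 2 × ZMod 2, a + a = 0) a
            have h3 : a + x u + (a + ∑ w ∈ (A.erase v).erase u, x w) =
              x u + ∑ w ∈ (A.erase v).erase u, x w := by
              rw [add_comm a (x u), add_assoc, ← add_assoc a a, h2, zero_add]
            rw [h3]; exact this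
          · intro w hw
            simp only [Finset.mem_erase] at hw
            exact hyw w hw.1 hw.2.1
        · have hvA : v ∉ A := by tauto
          have he : A.erase v = A := Finset.erase_eq_of_notMem hvA
          have := hx2 A ⟨(hsub A hA).2, A, hA, he.symm⟩
          rw [Finset.sum_congr rfl (g := x)]
          · exact this
          · intro w hw
            exact hyw w (fun h => huA (h ▸ hw)) (fun h => hvA (h ▸ hw))
    · push Not at h
      refine ⟨fun _ => (1, 0), fun _ _ => (by decide : ((1, 0) : ZMod 2 × ZMod 2) ≠ 0), ?_⟩
      intro A hA
      have h1 := h A hA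
      have h2 := Finset.card_pos.2 (hsub A hA).2
      obtain ⟨y, rfl⟩ := Finset.card_eq_one.1 (by omega : A.card = 1)
      rw [Finset.sum_singleton]; decide

theorem rs_cases {p q : E → V} {F : Finset E} {c : V} {X : Finset V}
    (hX : ∀ w ∈ X, ∀ w' ∈ X, Reach (en p q) F w w') :
    X ⊆ rs p q F c ∨ Disjoint X (rs p q F c) := by
  by_cases h : ∃ w ∈ X, w ∈ rs p q F c
  · obtain ⟨w, hw, hw'⟩ := h
    left
    intro w' hw2
    exact mem_rs.2 ((mem_rs.1 hw').trans (hX w hw w' hw2))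
  · right
    refine Finset.disjoint_left.2 fun w hw hw' => h ⟨w, hw, hw'⟩

theorem rs_conn {p q : E → V} {F : Finset E} {c : V} :
    ∀ w ∈ rs p q F c, ∀ w' ∈ rs p q F c, Reach (en p q) F w w' := fun w hw w' hw' =>
  (reach_symm (mem_rs.1 hw)).trans (mem_rs.1 hw')

/-- A side of `b` not containing the ends of `b'` is connected without `b'`. -/
theorem side_avoid {p q : E → V} {b b' : E} {c : V}
    (h : p b' ∉ rs p q (Finset.univ.erase b) c) (hne : b' ≠ b) :
    ∀ w ∈ rs p q (Finset.univ.erase b) c, ∀ w' ∈ rs p q (Finset.univ.erase b) c,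
      Reach (en p q) (Finset.univ.erase b') w w' := by
  have key : ∀ w ∈ rs p q (Finset.univ.erase b) c, Reach (en p q) (Finset.univ.erase b') c w := by
    intro w hw
    have h1 := reach_rst (cl_rs p q (Finset.univ.erase b) c) self_mem_rs (mem_rs.1 hw)
    refine reach_mono ?_ h1
    intro e he
    refine Finset.mem_erase.2 ⟨?_, Finset.mem_univ _⟩
    rintro rfl
    exact h (rst_ends (cl_rs p q (Finset.univ.erase b) c) he).1
  intro w hw w' hw'
  exact (reach_symm (key w hw)).trans (key w' hw')

theorem comp_sides {p q : E → V} {b : E} {c d : V} (hcd : en p q b = s(c, d)) {w : V}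
    (h : Reach (en p q) Finset.univ c w) :
    w ∈ rs p q (Finset.univ.erase b) c ∨ w ∈ rs p q (Finset.univ.erase b) d := by
  have hcl : Cl p q Finset.univ (rs p q (Finset.univ.erase b) c ∪ rs p q (Finset.univ.erase b) d) := by
    intro e _
    by_cases he : e = b
    · subst he
      simp only [en, Sym2.eq_iff] at hcd
      simp only [Finset.mem_union]
      have h1 : c ∈ rs p q (Finset.univ.erase e) c := self_mem_rs
      have h2 : d ∈ rs p q (Finset.univ.erase e) d := self_mem_rs
      rcases hcd with ⟨rfl, rfl⟩ | ⟨rfl, rfl⟩ <;> simp [h1, h2]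
    · have he' : e ∈ Finset.univ.erase b := by simp [he]
      have h1 := cl_rs p q (Finset.univ.erase b) c e he'
      have h2 := cl_rs p q (Finset.univ.erase b) d e he'
      simp only [Finset.mem_union, h1, h2]
  have := (reach_cl hcl h).1 (Finset.mem_union_left _ self_mem_rs)
  simpa using this

/-- `b` is a bridge with ends `c`, `d`. -/
def Br (p q : E → V) (b : E) (c d : V) : Prop :=
  en p q b = s(c, d) ∧ ¬ Reach (en p q) (Finset.univ.erase b) c d

theorem Br.symm {p q : E → V} {b : E} {c d : V} (h : Br p q b c d) : Br p q b d c :=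
  ⟨by rw [h.1, Sym2.eq_swap], fun h' => h.2 (reach_symm h')⟩

theorem Br.p_mem {p q : E → V} {b : E} {c d : V} (h : Br p q b c d) : c = p b ∨ d = p b := by
  have := h.1
  simp only [en, Sym2.eq_iff] at this
  rcases this with ⟨h, -⟩ | ⟨h, -⟩ <;> simp [h]

theorem Br.q_mem {p q : E → V} {b : E} {c d : V} (h : Br p q b c d) :
    (c = p b ∧ d = q b) ∨ (c = q b ∧ d = p b) := by
  have := h.1
  simp only [en, Sym2.eq_iff] at this
  rcases this with ⟨h, h'⟩ | ⟨h, h'⟩ <;> simp [h, h']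

theorem sides_laminar {p q : E → V} {b b' : E} {c d c' d' : V} (hb : Br p q b c d)
    (hb' : Br p q b' c' d')
    (X X' : Finset V) (hX : X = rs p q (Finset.univ.erase b) c)
    (hX' : X' = rs p q (Finset.univ.erase b') c') (w : V) (hw : Reach (en p q) Finset.univ c w)
    (hwX : w ∉ X) (hwX' : w ∉ X') : X ⊆ X' ∨ X' ⊆ X ∨ Disjoint X X' := by
  by_cases hbb : b' = b
  · subst hbb
    have : ∀ w ∈ X, ∀ w' ∈ X, Reach (en p q) (Finset.univ.erase b') w w' := by
      rw [hX]; exact rs_conn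
    rcases rs_cases (c := c') this with h | h
    · left; rw [hX']; exact h
    · right; right; rw [hX']; exact h
  by_cases h1 : p b' ∈ X
  · by_cases h2 : p b ∈ X'
    · exfalso
      -- the other side of b lies in X'
      have hdX : ∀ y ∈ rs p q (Finset.univ.erase b) d, y ∉ X := by
        intro y hy hy'
        rw [hX] at hy'
        exact hb.2 ((mem_rs.1 hy').trans (reach_symm (mem_rs.1 hy)))
      have h3 := side_avoid (p := p) (q := q) (b := b) (b' := b') (c := d)
        (fun h => hdX _ h h1) hbb
      have hq : q b ∈ X' := by
        rw [hX'] at h2 ⊢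
        exact (cl_rs p q (Finset.univ.erase b') c' b (by simp [Ne.symm hbb])).1 h2
      have hd : d ∈ X' := by
        rcases hb.q_mem with h | h
        · rw [h.2]; exact hq
        · rw [h.2]; exact h2
      rcases comp_sides hb.1 hw with h | h
      · rw [hX] at hwX; exact hwX h
      · refine hwX' ?_
        rw [hX'] at hd ⊢
        exact mem_rs.2 ((mem_rs.1 hd).trans (h3 d self_mem_rs w h))
    · have h3 := side_avoid (p := p) (q := q) (b := b') (b' := b) (c := c') (hX' ▸ h2) (Ne.symm hbb)
      rcases rs_cases (c := c) h3 with h | h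
      · right; left; rw [hX, hX']; exact h
      · right; right; rw [hX, hX']; exact h.symm
  · have h3 := side_avoid (p := p) (q := q) (b := b) (b' := b') (c := c) (hX ▸ h1) hbb
    rcases rs_cases (c := c') h3 with h | h
    · left; rw [hX, hX']; exact h
    · right; right; rw [hX, hX']; exact h


theorem filter_laminar {p : E → V} {N : Finset E} {X Y : Finset V}
    (h : X ⊆ Y ∨ Y ⊆ X ∨ Disjoint X Y) :
    (N.filter fun e => p e ∈ X) ⊆ (N.filter fun e => p e ∈ Y) ∨
    (N.filter fun e => p e ∈ Y) ⊆ (N.filter fun e => p e ∈ X) ∨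
    Disjoint (N.filter fun e => p e ∈ X) (N.filter fun e => p e ∈ Y) := by
  rcases h with h | h | h
  · left
    intro e he
    rw [Finset.mem_filter] at he ⊢; exact ⟨he.1, h he.2⟩
  · right; left
    intro e he
    rw [Finset.mem_filter] at he ⊢; exact ⟨he.1, h he.2⟩
  · right; right
    refine Finset.disjoint_left.2 fun e he he' => ?_
    rw [Finset.mem_filter] at he he'
    exact Finset.disjoint_left.1 h he.2 he'.2

theorem labels (p q : E → V) (N : Finset E)
    (h1 : ∀ e ∈ N, ∃ e' ∈ N, e' ≠ e ∧ Reach (en p q) Finset.univ (p e) (p e'))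
    (h2 : ∀ b c d, Br p q b c d → ∃ e ∈ N, Reach (en p q) (Finset.univ.erase b) c (p e)) :
    ∃ x : E → ZMod 2 × ZMod 2, (∀ e ∈ N, x e ≠ 0) ∧
      (∀ u, ∑ e ∈ N.filter (fun e => p e ∈ rs p q Finset.univ u), x e = 0) ∧
      ∀ b c d, Br p q b c d →
        ∑ e ∈ N.filter (fun e => p e ∈ rs p q (Finset.univ.erase b) c), x e ≠ 0 := by
  obtain ⟨rt, hrt⟩ : ∃ rt : E → Prop, ∀ e, rt e ↔ e ∈ N ∧ ∀ e' ∈ N,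
      Reach (en p q) Finset.univ (p e) (p e') →
        Fintype.equivFin E e ≤ Fintype.equivFin E e' := ⟨_, fun _ => Iff.rfl⟩
  have rt_ex : ∀ e ∈ N, ∃ f, rt f ∧ Reach (en p q) Finset.univ (p e) (p f) := by
    intro e he
    obtain ⟨f, ⟨hf1, hf2⟩, hf3⟩ := exists_minimalFor_of_wellFoundedLT
      (fun f : E => f ∈ N ∧ Reach (en p q) Finset.univ (p e) (p f)) (Fintype.equivFin E)
      ⟨e, he, Relation.ReflTransGen.refl⟩
    refine ⟨f, (hrt f).2 ⟨hf1, fun e' he' hr => ?_⟩, hf2⟩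
    rcases le_total (Fintype.equivFin E f) (Fintype.equivFin E e') with h | h
    · exact h
    · exact hf3 (j := e') ⟨he', hf2.trans hr⟩ h
  have rt_un : ∀ e f, rt e → rt f → Reach (en p q) Finset.univ (p e) (p f) → e = f := by
    intro e f he hf hr
    rw [hrt] at he hf
    exact (Fintype.equivFin E).injective
      (le_antisymm (he.2 f hf.1 hr) (hf.2 e he.1 (reach_symm hr)))
  obtain ⟨N₀, hN₀⟩ : ∃ N₀ : Finset E, ∀ e, e ∈ N₀ ↔ e ∈ N ∧ ¬ rt e :=
    ⟨N.filter fun e => ¬ rt e, by simp⟩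
  obtain ⟨Fam, hFam⟩ : ∃ Fam : Finset V → Prop, ∀ X, Fam X ↔ (∃ u, X = rs p q Finset.univ u) ∨
      (∃ b c d, Br p q b c d ∧ X = rs p q (Finset.univ.erase b) c ∧ ∀ e, rt e → p e ∉ X) :=
    ⟨_, fun _ => Iff.rfl⟩
  have lam : ∀ X Y, Fam X → Fam Y → (∃ e ∈ N, p e ∈ X) → X ⊆ Y ∨ Y ⊆ X ∨ Disjoint X Y := by
    intro X Y hX hY hXN
    rw [hFam] at hX hY
    have comp : ∀ A : Finset V, (∀ w ∈ A, ∀ w' ∈ A, Reach (en p q) Finset.univ w w') → ∀ u,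
        A ⊆ rs p q Finset.univ u ∨ Disjoint A (rs p q Finset.univ u) := fun A hA u => rs_cases hA
    have up : ∀ b c, ∀ w ∈ rs p q (Finset.univ.erase b) c, ∀ w' ∈ rs p q (Finset.univ.erase b) c,
        Reach (en p q) Finset.univ w w' := fun b c w hw w' hw' =>
      reach_mono (Finset.subset_univ _) (rs_conn w hw w' hw')
    rcases hY with ⟨u', rfl⟩ | ⟨b', c', d', hb', hY, hr'⟩
    · rcases hX with ⟨u, rfl⟩ | ⟨b, c, d, hb, rfl, hr⟩
      · rcases comp _ (rs_conn (c := u)) u' with h | h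
        · exact Or.inl h
        · exact Or.inr (Or.inr h)
      · rcases comp _ (up b c) u' with h | h
        · exact Or.inl h
        · exact Or.inr (Or.inr h)
    · rcases hX with ⟨u, rfl⟩ | ⟨b, c, d, hb, hX, hr⟩
      · subst hY
        rcases comp _ (up b' c') u with h | h
        · exact Or.inr (Or.inl h)
        · exact Or.inr (Or.inr h.symm)
      · obtain ⟨e, heN, heX⟩ := hXN
        obtain ⟨f, hf, hef⟩ := rt_ex e heN
        refine sides_laminar hb hb' X Y hX hY (p f) ?_ (hr f hf) (hr' f hf)
        rw [hX, mem_rs] at heX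
        exact (reach_mono (Finset.subset_univ _) heX).trans hef
  obtain ⟨x, hx1, hx2⟩ := laminar_label _ N₀ rfl
    (fun A => A.Nonempty ∧ ∃ X, Fam X ∧ A = N₀.filter fun e => p e ∈ X)
    (by
      rintro A ⟨hA, X, hX, rfl⟩
      exact ⟨Finset.filter_subset _ _, hA⟩)
    (by
      rintro A B ⟨hA, X, hX, rfl⟩ ⟨hB, Y, hY, rfl⟩
      refine filter_laminar (lam X Y hX hY ?_)
      obtain ⟨e, he⟩ := hA
      rw [Finset.mem_filter, hN₀] at he
      exact ⟨e, he.1.1, he.2⟩)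
  obtain ⟨y, hy⟩ : ∃ y : E → ZMod 2 × ZMod 2, y = fun e => if rt e then
    ∑ f ∈ N₀.filter (fun f => p f ∈ rs p q Finset.univ (p e)), x f else x e := ⟨_, rfl⟩
  have hyr : ∀ e, rt e → y e = ∑ f ∈ N₀.filter (fun f => p f ∈ rs p q Finset.univ (p e)), x f := by
    intro e he; rw [hy]; simp only [he, if_true]
  have hyn : ∀ e, ¬ rt e → y e = x e := by
    intro e he; rw [hy]; simp only [he, if_false]
  have dbl : ∀ a : ZMod 2 × ZMod 2, a + a = 0 := by decide
  have hcomp : ∀ u, ∑ e ∈ N.filter (fun e => p e ∈ rs p q Finset.univ u), y e = 0 := by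
    intro u
    by_cases hne : ∃ e ∈ N, p e ∈ rs p q Finset.univ u
    · obtain ⟨e, heN, heu⟩ := hne
      obtain ⟨f, hf, hef⟩ := rt_ex e heN
      have hfu : Reach (en p q) Finset.univ u (p f) := (mem_rs.1 heu).trans hef
      have hfm : f ∈ N.filter (fun e => p e ∈ rs p q Finset.univ u) :=
        Finset.mem_filter.2 ⟨((hrt f).1 hf).1, mem_rs.2 hfu⟩
      have hset : (N.filter (fun e => p e ∈ rs p q Finset.univ u)).erase f =
          N₀.filter (fun g => p g ∈ rs p q Finset.univ (p f)) := by
        ext g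
        rw [Finset.mem_erase, Finset.mem_filter, Finset.mem_filter, hN₀, mem_rs, mem_rs]
        constructor
        · rintro ⟨hgf, hgN, hg⟩
          have hfg := (reach_symm hfu).trans hg
          exact ⟨⟨hgN, fun h => hgf (rt_un f g hf h hfg).symm⟩, hfg⟩
        · rintro ⟨⟨hgN, hgr⟩, hg⟩
          exact ⟨fun h => hgr (h ▸ hf), hgN, hfu.trans hg⟩
      rw [← Finset.add_sum_erase _ _ hfm, hset, hyr f hf]
      rw [Finset.sum_congr rfl (g := x) (fun g hg => hyn g
        ((hN₀ g).1 (Finset.mem_filter.1 hg).1).2)]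
      exact dbl _
    · refine Finset.sum_eq_zero fun e he => absurd ?_ hne
      rw [Finset.mem_filter] at he
      exact ⟨e, he.1, he.2⟩
  refine ⟨y, ?_, hcomp, ?_⟩
  · intro e he
    by_cases hr : rt e
    · rw [hyr e hr]
      refine hx2 _ ⟨?_, _, (hFam _).2 (Or.inl ⟨p e, rfl⟩), rfl⟩
      obtain ⟨e', he', hne, hre⟩ := h1 e he
      refine ⟨e', Finset.mem_filter.2 ⟨(hN₀ _).2 ⟨he', fun h => ?_⟩, mem_rs.2 hre⟩⟩
      exact hne (rt_un e e' hr h hre).symm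
    · rw [hyn e hr]; exact hx1 e ((hN₀ e).2 ⟨he, hr⟩)
  · have good : ∀ b c d, Br p q b c d → (∀ e, rt e → p e ∉ rs p q (Finset.univ.erase b) c) →
        ∑ e ∈ N.filter (fun e => p e ∈ rs p q (Finset.univ.erase b) c), y e ≠ 0 := by
      intro b c d hb hr
      have hset : N.filter (fun e => p e ∈ rs p q (Finset.univ.erase b) c) =
          N₀.filter (fun e => p e ∈ rs p q (Finset.univ.erase b) c) := by
        ext g
        rw [Finset.mem_filter, Finset.mem_filter, hN₀]
        constructor
        · rintro ⟨a, a'⟩; exact ⟨⟨a, fun h => hr g h a'⟩, a'⟩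
        · rintro ⟨a, a'⟩; exact ⟨a.1, a'⟩
      rw [hset, Finset.sum_congr rfl (g := x) (fun g hg => hyn g
        ((hN₀ g).1 (Finset.mem_filter.1 hg).1).2)]
      refine hx2 _ ⟨?_, _, (hFam _).2 (Or.inr ⟨b, c, d, hb, rfl, hr⟩), rfl⟩
      obtain ⟨e, he, hre⟩ := h2 b c d hb
      refine ⟨e, ?_⟩
      rw [← hset, Finset.mem_filter]
      exact ⟨he, mem_rs.2 hre⟩
    intro b c d hb
    by_cases hr : ∀ e, rt e → p e ∉ rs p q (Finset.univ.erase b) c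
    · exact good b c d hb hr
    · push Not at hr
      obtain ⟨f, hf, hfc⟩ := hr
      have hcd : Reach (en p q) Finset.univ c d :=
        Relation.ReflTransGen.single ⟨b, Finset.mem_univ _, hb.1⟩
      have hg := good b d c hb.symm (by
        intro g hgr hgd
        have hfg : f = g := by
          refine rt_un f g hf hgr ?_
          refine (reach_symm (reach_mono (Finset.subset_univ _) (mem_rs.1 hfc))).trans (hcd.trans ?_)
          exact reach_mono (Finset.subset_univ _) (mem_rs.1 hgd)
        subst hfg
        exact hb.2 ((mem_rs.1 hfc).trans (reach_symm (mem_rs.1 hgd))))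
      intro h0
      apply hg
      have hsplit : N.filter (fun e => p e ∈ rs p q Finset.univ c) =
          N.filter (fun e => p e ∈ rs p q (Finset.univ.erase b) c) ∪
          N.filter (fun e => p e ∈ rs p q (Finset.univ.erase b) d) := by
        ext g
        rw [Finset.mem_union, Finset.mem_filter, Finset.mem_filter, Finset.mem_filter, mem_rs]
        constructor
        · rintro ⟨a, a'⟩
          rcases comp_sides hb.1 a' with h | h
          · exact Or.inl ⟨a, h⟩
          · exact Or.inr ⟨a, h⟩
        · rintro (⟨a, a'⟩ | ⟨a, a'⟩)
          · exact ⟨a, reach_mono (Finset.subset_univ _) (mem_rs.1 a')⟩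
          · exact ⟨a, hcd.trans (reach_mono (Finset.subset_univ _) (mem_rs.1 a'))⟩
      have hdj : Disjoint (N.filter (fun e => p e ∈ rs p q (Finset.univ.erase b) c))
          (N.filter (fun e => p e ∈ rs p q (Finset.univ.erase b) d)) := by
        refine Finset.disjoint_left.2 fun g hg hg' => ?_
        rw [Finset.mem_filter, mem_rs] at hg hg'
        exact hb.2 (hg.2.trans (reach_symm hg'.2))
      have := hcomp c
      rw [hsplit, Finset.sum_union hdj, h0, zero_add] at this
      exact this

theorem label_sets (p q : E → V) (N : Finset E)
    (h1 : ∀ e ∈ N, ∃ e' ∈ N, e' ≠ e ∧ Reach (en p q) Finset.univ (p e) (p e'))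
    (h2 : ∀ b c d, Br p q b c d → ∃ e ∈ N, Reach (en p q) (Finset.univ.erase b) c (p e)) :
    ∃ M₁ ⊆ N, ∃ M₂ ⊆ N, (∀ e ∈ N, e ∈ M₁ ∨ e ∈ M₂) ∧ 3 * (M₁.card + M₂.card) ≤ 4 * N.card ∧
      (∀ u, Even (M₁.filter fun e => p e ∈ rs p q Finset.univ u).card) ∧
      (∀ u, Even (M₂.filter fun e => p e ∈ rs p q Finset.univ u).card) ∧
      ∀ b c d, Br p q b c d →
        ¬ Even (M₁.filter fun e => p e ∈ rs p q (Finset.univ.erase b) c).card ∨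
        ¬ Even (M₂.filter fun e => p e ∈ rs p q (Finset.univ.erase b) c).card := by
  obtain ⟨x, hx1, hx2, hx3⟩ := labels p q N h1 h2
  obtain ⟨M, hM⟩ : ∃ M : (ZMod 2 × ZMod 2 →+ ZMod 2) → Finset E,
    M = fun φ => N.filter fun e => φ (x e) ≠ 0 := ⟨_, rfl⟩
  have hsum : ∀ (φ : ZMod 2 × ZMod 2 →+ ZMod 2) (X : Finset V),
      (((M φ).filter fun e => p e ∈ X).card : ZMod 2) = φ (∑ e ∈ N.filter (fun e => p e ∈ X), x e) := by
    intro φ X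
    rw [map_sum, hM, Finset.filter_comm, Finset.card_filter]
    push_cast
    refine Finset.sum_congr rfl fun e _ => ?_
    exact (by decide : ∀ z : ZMod 2, (if z ≠ 0 then (1 : ZMod 2) else 0) = z) _
  have main : ∀ φ ψ : ZMod 2 × ZMod 2 →+ ZMod 2, (∀ z, φ z = 0 → ψ z = 0 → z = 0) →
      3 * ((M φ).card + (M ψ).card) ≤ 4 * N.card → ∃ M₁ ⊆ N, ∃ M₂ ⊆ N, (∀ e ∈ N, e ∈ M₁ ∨ e ∈ M₂) ∧
        3 * (M₁.card + M₂.card) ≤ 4 * N.card ∧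
      (∀ u, Even (M₁.filter fun e => p e ∈ rs p q Finset.univ u).card) ∧
      (∀ u, Even (M₂.filter fun e => p e ∈ rs p q Finset.univ u).card) ∧
      ∀ b c d, Br p q b c d →
        ¬ Even (M₁.filter fun e => p e ∈ rs p q (Finset.univ.erase b) c).card ∨
        ¬ Even (M₂.filter fun e => p e ∈ rs p q (Finset.univ.erase b) c).card := by
    intro φ ψ hinj hcard
    have hsub : ∀ φ, M φ ⊆ N := fun φ => by rw [hM]; exact Finset.filter_subset _ _
    refine ⟨M φ, hsub φ, M ψ, hsub ψ, ?_, hcard, ?_, ?_, ?_⟩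
    · intro e he
      by_contra hh
      rw [not_or, hM] at hh
      have a1 : φ (x e) = 0 := by
        by_contra h; exact hh.1 (Finset.mem_filter.2 ⟨he, h⟩)
      have a2 : ψ (x e) = 0 := by
        by_contra h; exact hh.2 (Finset.mem_filter.2 ⟨he, h⟩)
      exact hx1 e he (hinj _ a1 a2)
    · intro u
      rw [← ZMod.natCast_eq_zero_iff_even, hsum, hx2, map_zero]
    · intro u
      rw [← ZMod.natCast_eq_zero_iff_even, hsum, hx2, map_zero]
    · intro b c d hb
      by_contra hh
      push Not at hh
      rw [← ZMod.natCast_eq_zero_iff_even, ← ZMod.natCast_eq_zero_iff_even, hsum, hsum] at hh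
      exact hx3 b c d hb (hinj _ hh.1 hh.2)
  obtain ⟨f, hf⟩ : ∃ f : ZMod 2 × ZMod 2 →+ ZMod 2, ∀ z, f z = z.1 := ⟨AddMonoidHom.fst _ _, fun _ => rfl⟩
  obtain ⟨g, hg⟩ : ∃ f : ZMod 2 × ZMod 2 →+ ZMod 2, ∀ z, f z = z.2 := ⟨AddMonoidHom.snd _ _, fun _ => rfl⟩
  obtain ⟨h, hh⟩ : ∃ f : ZMod 2 × ZMod 2 →+ ZMod 2, ∀ z, f z = z.1 + z.2 :=
    ⟨AddMonoidHom.fst _ _ + AddMonoidHom.snd _ _, fun _ => rfl⟩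
  have tot : (M f).card + (M g).card + (M h).card = 2 * N.card := by
    rw [hM]
    simp only [Finset.card_filter]
    rw [← Finset.sum_add_distrib, ← Finset.sum_add_distrib, Finset.sum_congr rfl (g := fun _ => 2)]
    · simp [mul_comm]
    · intro e he
      rw [hf, hg, hh]
      exact (by decide : ∀ z : ZMod 2 × ZMod 2, z ≠ 0 → ((if z.1 ≠ 0 then 1 else 0) +
        (if z.2 ≠ 0 then 1 else 0) + (if z.1 + z.2 ≠ 0 then 1 else 0) : ℕ) = 2) _ (hx1 e he)
  have i1 : ∀ z, f z = 0 → g z = 0 → z = 0 := by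
    intro z; rw [hf, hg]; revert z; decide
  have i2 : ∀ z, f z = 0 → h z = 0 → z = 0 := by
    intro z; rw [hf, hh]; revert z; decide
  have i3 : ∀ z, g z = 0 → h z = 0 → z = 0 := by
    intro z; rw [hg, hh]; revert z; decide
  by_cases c1 : 3 * ((M f).card + (M g).card) ≤ 4 * N.card
  · exact main f g i1 c1
  by_cases c2 : 3 * ((M f).card + (M h).card) ≤ 4 * N.card
  · exact main f h i2 c2
  exact main g h i3 (by omega)


/-! ### Minimum signatures, flow-admissibility, assembly -/

theorem crosses_iff {p q : E → V} {U : Finset V} {e : E} : crosses (en p q) U e ↔ cr p q U e := by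
  rw [cr_swap]
  constructor
  · rintro ⟨a, b, h, h'⟩
    simp only [en, Sym2.eq_iff] at h
    rcases h with ⟨rfl, rfl⟩ | ⟨rfl, rfl⟩
    · exact h'
    · tauto
  · intro h; exact ⟨p e, q e, rfl, h⟩

theorem switch_apply {p q : E → V} {U : Finset V} {sgn : E → Bool} {e : E} :
    switch (en p q) U sgn e = if cr p q U e then ! (sgn e) else sgn e := by
  rw [switch]; simp only [crosses_iff]

theorem min_cut {p q : E → V} {sgn : E → Bool} (h : IsMinSignature (en p q) sgn) (X : Finset V) :
    (Finset.univ.filter fun e => sgn e = true ∧ cr p q X e).card ≤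
      (Finset.univ.filter fun e => sgn e = false ∧ cr p q X e).card := by
  have h1 := h X
  have e1 : negCount sgn = (Finset.univ.filter fun e => sgn e = true ∧ ¬ cr p q X e).card +
      (Finset.univ.filter fun e => sgn e = true ∧ cr p q X e).card := by
    rw [negCount]
    simp only [Finset.card_filter]
    rw [← Finset.sum_add_distrib]
    refine Finset.sum_congr rfl fun e _ => ?_
    by_cases a : cr p q X e <;> cases hs : sgn e <;> simp [a]
  have e2 : negCount (switch (en p q) X sgn) =
      (Finset.univ.filter fun e => sgn e = true ∧ ¬ cr p q X e).card +
      (Finset.univ.filter fun e => sgn e = false ∧ cr p q X e).card := by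
    rw [negCount]
    simp only [Finset.card_filter]
    rw [← Finset.sum_add_distrib]
    refine Finset.sum_congr rfl fun e _ => ?_
    rw [switch_apply]
    by_cases a : cr p q X e <;> cases hs : sgn e <;> simp [a]
  omega

theorem isPath_bz {p q : E → V} {P : Finset E} {u v : V} (h : IsPath (en p q) P u v) :
    bz p q P = Pi.single u 1 + Pi.single v 1 := by
  obtain ⟨-, -, huv, hu, hv, du, dv, dw⟩ := h
  ext w
  rw [← degree_cast]
  by_cases h1 : w = u
  · subst h1; rw [du]; simp [Pi.single_apply, huv]
  by_cases h2 : w = v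
  · subst h2; rw [dv]; simp [Pi.single_apply, h1]
  by_cases h3 : w ∈ support (en p q) P
  · rw [dw w h3 h1 h2]; simp [Pi.single_apply, h1, h2]; decide
  · rw [← degree_pos] at h3
    rw [Nat.eq_zero_of_not_pos h3]; simp [Pi.single_apply, h1, h2]

theorem conn_union {p q : E → V} {A B : Finset E} {w : V} (hA : ConnectedOn (en p q) A)
    (hB : ConnectedOn (en p q) B) (hwA : w ∈ support (en p q) A) (hwB : w ∈ support (en p q) B) :
    ConnectedOn (en p q) (A ∪ B) := by
  have key : ∀ x ∈ support (en p q) (A ∪ B), Reach (en p q) (A ∪ B) x w := by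
    intro x hx
    rw [support_union, Finset.mem_union] at hx
    rcases hx with h | h
    · exact reach_mono Finset.subset_union_left (hA x h w hwA)
    · exact reach_mono Finset.subset_union_right (hB x h w hwB)
  intro x hx y hy
  exact (key x hx).trans (reach_symm (key y hy))

theorem signed_conn {p q : E → V} {sgn : E → Bool} {S : Finset E}
    (h : IsSignedCircuit (en p q) sgn S) : ConnectedOn (en p q) S := by
  rcases h with h | ⟨C₁, C₂, -, rfl, h1, h2, v, hv⟩ |
    ⟨C₁, C₂, P, u, v, -, -, -, rfl, h1, h2, -, hP, hu, hv⟩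
  · exact h.1.2.1
  · have : v ∈ support (en p q) C₁ ∩ support (en p q) C₂ := by rw [hv]; simp
    rw [Finset.mem_inter] at this
    exact conn_union h1.1.2.1 h2.1.2.1 this.1 this.2
  · have a : u ∈ support (en p q) P ∩ support (en p q) C₁ := by rw [hu]; simp
    have b : v ∈ support (en p q) P ∩ support (en p q) C₂ := by rw [hv]; simp
    rw [Finset.mem_inter] at a b
    have c1 := conn_union h1.1.2.1 hP.2.1 a.2 a.1
    have c2 := conn_union c1 h2.1.2.1 (w := v)
      (support_mono Finset.subset_union_right b.1) b.2
    have : C₁ ∪ C₂ ∪ P = C₁ ∪ P ∪ C₂ := by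
      ext e; simp only [Finset.mem_union]; tauto
    rw [this]; exact c2

theorem odd_exists {sgn : E → Bool} {C : Finset E} (h : Odd (negEdges sgn C).card) :
    ∃ e ∈ C, sgn e = true := by
  have : (negEdges sgn C).Nonempty := by
    rw [← Finset.card_pos]; exact h.pos
  obtain ⟨e, he⟩ := this
  rw [negEdges, Finset.mem_filter] at he
  exact ⟨e, he⟩

theorem signed_two {p q : E → V} {sgn : E → Bool} {S : Finset E}
    (h : IsSignedCircuit (en p q) sgn S) {e : E} (he : e ∈ S) (hs : sgn e = true) :
    ∃ e' ∈ S, e' ≠ e ∧ sgn e' = true := by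
  have bar : ∀ C₁ C₂ : Finset E, Disjoint C₁ C₂ → C₁ ⊆ S → C₂ ⊆ S →
      IsUnbalancedCircuit (en p q) sgn C₁ → IsUnbalancedCircuit (en p q) sgn C₂ →
      ∃ e' ∈ S, e' ≠ e ∧ sgn e' = true := by
    intro C₁ C₂ hd s1 s2 h1 h2
    obtain ⟨e₁, a, a'⟩ := odd_exists h1.2
    obtain ⟨e₂, b, b'⟩ := odd_exists h2.2
    by_cases h : e₁ = e
    · refine ⟨e₂, s2 b, ?_, b'⟩
      intro h'
      exact Finset.disjoint_left.1 hd a (by rw [h, ← h']; exact b)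
    · exact ⟨e₁, s1 a, h, a'⟩
  rcases h with h | ⟨C₁, C₂, hd, hS, h1, h2, -⟩ | ⟨C₁, C₂, P, u, v, hd, -, -, hS, h1, h2, -⟩
  · by_contra hh; push Not at hh
    have : negEdges sgn S = {e} := by
      rw [Finset.eq_singleton_iff_unique_mem, negEdges, Finset.mem_filter]
      refine ⟨⟨he, hs⟩, fun e' he' => ?_⟩
      rw [Finset.mem_filter] at he'
      by_contra hne
      exact hh e' he'.1 hne he'.2
    have h2 := h.2
    rw [this] at h2; simp at h2
  · exact bar C₁ C₂ hd (by rw [hS]; exact Finset.subset_union_left)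
      (by rw [hS]; exact Finset.subset_union_right) h1 h2
  · exact bar C₁ C₂ hd
      (by rw [hS]; exact Finset.subset_union_left.trans Finset.subset_union_left)
      (by rw [hS]; exact Finset.subset_union_right.trans Finset.subset_union_left) h1 h2

theorem bridge_side {p q : E → V} {sgn : E → Bool} (hfa : FlowAdmissible (en p q) sgn) {b : E}
    {c d : V} (hb : Br p q b c d) :
    ∃ e, sgn e = true ∧ Reach (en p q) (Finset.univ.erase b) c (p e) := by
  have hnr : ¬ Reach (en p q) (Finset.univ.erase b) (p b) (q b) := by
    rcases hb.q_mem with h | h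
    · rw [← h.1, ← h.2]; exact hb.2
    · rw [← h.1, ← h.2]; exact hb.symm.2
  have hnc : ∀ C, IsCircuit (en p q) C → b ∉ C := fun C hC =>
    not_ev_of_cut hnr (Finset.subset_univ C) hC.ev
  obtain ⟨S, hS, hbS⟩ := hfa b
  rcases hS with h | ⟨C₁, C₂, -, rfl, h1, h2, -⟩ |
    ⟨C₁, C₂, P, u, v, -, -, -, rfl, h1, h2, -, hP, hu, hv⟩
  · exact absurd hbS (hnc _ h.1)
  · rcases Finset.mem_union.1 hbS with h | h
    · exact absurd h (hnc _ h1.1)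
    · exact absurd h (hnc _ h2.1)
  · have hbP : b ∈ P := by
      rcases Finset.mem_union.1 hbS with h | h
      · rcases Finset.mem_union.1 h with h | h
        · exact absurd h (hnc _ h1.1)
        · exact absurd h (hnc _ h2.1)
      · exact h
    have a : u ∈ support (en p q) P ∩ support (en p q) C₁ := by rw [hu]; simp
    have a' : v ∈ support (en p q) P ∩ support (en p q) C₂ := by rw [hv]; simp
    rw [Finset.mem_inter] at a a'
    have fin : ∀ (C : Finset E) (w : V), IsUnbalancedCircuit (en p q) sgn C →
        w ∈ support (en p q) C → w ∈ rs p q (Finset.univ.erase b) c →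
        ∃ e, sgn e = true ∧ Reach (en p q) (Finset.univ.erase b) c (p e) := by
      intro C w hC hw hwc
      obtain ⟨e, he, hs⟩ := odd_exists hC.2
      refine ⟨e, hs, (mem_rs.1 hwc).trans (reach_mono ?_
        (hC.1.2.1 w hw (p e) (mem_support.2 ⟨e, he, Or.inl rfl⟩)))⟩
      intro f hf
      refine Finset.mem_erase.2 ⟨?_, Finset.mem_univ _⟩
      rintro rfl; exact hnc C hC.1 hf
    have hcut := cut_parity p q P (rs p q (Finset.univ.erase b) c)
    have hone : P.filter (cr p q (rs p q (Finset.univ.erase b) c)) = {b} := by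
      rw [Finset.eq_singleton_iff_unique_mem, Finset.mem_filter]
      refine ⟨⟨hbP, ?_⟩, ?_⟩
      · have m1 : c ∈ rs p q (Finset.univ.erase b) c := self_mem_rs
        have m2 : d ∉ rs p q (Finset.univ.erase b) c := fun h => hb.2 (mem_rs.1 h)
        unfold cr
        rcases hb.q_mem with h | h
        · rw [← h.1, ← h.2]; tauto
        · rw [← h.1, ← h.2]; tauto
      · intro e he
        rw [Finset.mem_filter] at he
        by_contra hne
        exact he.2 (cl_rs p q (Finset.univ.erase b) c e (by simp [hne]))
    rw [hone, isPath_bz hP] at hcut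
    simp only [Pi.add_apply, Finset.sum_add_distrib, Finset.sum_pi_single', Finset.card_singleton,
      Nat.cast_one] at hcut
    by_cases h3 : u ∈ rs p q (Finset.univ.erase b) c
    · exact fin C₁ u h1 a.2 h3
    by_cases h4 : v ∈ rs p q (Finset.univ.erase b) c
    · exact fin C₂ v h2 a'.2 h4
    · rw [if_neg h3, if_neg h4] at hcut
      exact absurd hcut (by decide)

theorem cover_bridge {p q : E → V} {sgn : E → Bool} {P M J₀ : Finset E}
    (hP : ∀ e, e ∈ P ↔ sgn e = false) {t : E} (ht : t ∈ P) {X : Finset V}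
    (hX : Cl p q (P.erase t) X) {e : E} (he : e ∈ M) (hec : cr p q X e)
    (hun : ∀ e', sgn e' = true → cr p q X e' → e' = e)
    (hes : sgn e = true) (hE : Ev p q (M ∪ J₀)) : t ∈ M ∪ J₀ := by
  by_contra hn
  have h1 := cut_even hE X
  have : (M ∪ J₀).filter (cr p q X) = {e} := by
    rw [Finset.eq_singleton_iff_unique_mem, Finset.mem_filter]
    refine ⟨⟨Finset.mem_union_left _ he, hec⟩, fun f hf => ?_⟩
    rw [Finset.mem_filter] at hf
    by_cases hs : sgn f = true
    · exact hun f hs hf.2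
    · exfalso
      refine hf.2 (hX f (Finset.mem_erase.2 ⟨?_, (hP f).2 (by simpa using hs)⟩))
      rintro rfl; exact hn hf.1
  rw [this] at h1; simp at h1

set_option maxHeartbeats 1000000 in
theorem part_one (p q : E → V) (sgn : E → Bool) (hfa : FlowAdmissible (en p q) sgn)
    (hmin : IsMinSignature (en p q) sgn) :
    ∃ 𝒞 : List (Finset E), (∀ C ∈ 𝒞, IsSignedCircuit (en p q) sgn C) ∧ CoversAll 𝒞 ∧
      3 * totalLength 𝒞 + 5 * negCount sgn ≤ 11 * Fintype.card E := by
  obtain ⟨P, hP⟩ : ∃ P : Finset E, ∀ e, e ∈ P ↔ sgn e = false :=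
    ⟨Finset.univ.filter fun e => sgn e = false, by simp⟩
  obtain ⟨N, hN⟩ : ∃ N : Finset E, ∀ e, e ∈ N ↔ sgn e = true :=
    ⟨Finset.univ.filter fun e => sgn e = true, by simp⟩
  have hNc : negCount sgn = N.card := by
    rw [negCount]; congr 1; ext e; simp [hN]
  have hPN : P.card + N.card = Fintype.card E := by
    rw [← Finset.card_union_of_disjoint]
    · rw [← Finset.card_univ]; congr 1
      ext e; rw [Finset.mem_union, hP, hN]; cases sgn e <;> simp
    · refine Finset.disjoint_left.2 fun e he he' => ?_
      rw [hP] at he; rw [hN, he] at he'; exact absurd he' (by decide)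
  have hreach : ∀ e, sgn e = true → Reach (en p q) P (p e) (q e) := by
    intro e he
    by_contra hn
    have h1 := min_cut hmin (rs p q P (p e))
    have h2 : (Finset.univ.filter fun f => sgn f = false ∧ cr p q (rs p q P (p e)) f) = ∅ := by
      ext f
      simp only [Finset.mem_filter, Finset.mem_univ, true_and, Finset.notMem_empty, iff_false]
      rintro ⟨a, b⟩
      exact b (cl_rs p q P (p e) f ((hP f).2 a))
    have h3 : 0 < (Finset.univ.filter fun f => sgn f = true ∧ cr p q (rs p q P (p e)) f).card := by
      refine Finset.card_pos.2 ⟨e, ?_⟩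
      simp only [Finset.mem_filter, Finset.mem_univ, true_and]
      refine ⟨he, ?_⟩
      have m1 : p e ∈ rs p q P (p e) := self_mem_rs
      have m2 : q e ∉ rs p q P (p e) := fun h => hn (mem_rs.1 h)
      unfold cr; tauto
    rw [h2, Finset.card_empty] at h1
    omega
  obtain ⟨M₁, hM₁, M₂, hM₂, hcov, hcard, hev₁, hev₂, hbr⟩ := label_sets p q N
    (by
      intro e he
      obtain ⟨S, hS, heS⟩ := hfa e
      obtain ⟨e', he', hne, hs⟩ := signed_two hS heS ((hN e).1 he)
      refine ⟨e', (hN e').2 hs, hne, reach_mono (Finset.subset_univ _)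
        (signed_conn hS _ (mem_support.2 ⟨e, heS, Or.inl rfl⟩) _
          (mem_support.2 ⟨e', he', Or.inl rfl⟩))⟩)
    (by
      intro b c d hb
      obtain ⟨e, he, hr⟩ := bridge_side hfa hb
      exact ⟨e, (hN e).2 he, hr⟩)
  obtain ⟨J₁, hJ₁, hJ₁e, L₁, hL₁, hL₁c, hL₁b, hL₁l⟩ := lemA hP hreach
    (fun e he => (hN e).1 (hM₁ he)) hev₁
  obtain ⟨J₂, hJ₂, hJ₂e, L₂, hL₂, hL₂c, hL₂b, hL₂l⟩ := lemA hP hreach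
    (fun e he => (hN e).1 (hM₂ he)) hev₂
  have hnbP : nb p q P ⊆ P := Finset.filter_subset _ _
  obtain ⟨L₀, hL₀, hL₀c, hL₀l⟩ := fivethirds p q (nb p q P) (by
    intro e he
    obtain ⟨C, hC, hE, heC⟩ := (Finset.mem_filter.1 he).2
    exact ⟨C, fun f hf => Finset.mem_filter.2 ⟨hC hf, C, hC, hE, hf⟩, hE, heC⟩)
  have hPm : ∀ e, sgn e = true → e ∈ M₁ ∨ e ∈ M₂ := fun e he => hcov e ((hN e).2 he)
  have hcard' := Finset.card_sdiff_add_card_eq_card hnbP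
  refine ⟨L₀ ++ (L₁ ++ L₂), ?_, ?_, ?_⟩
  · intro C hC
    rw [List.mem_append, List.mem_append] at hC
    rcases hC with h | h | h
    · refine Or.inl ⟨(hL₀ C h).1, ?_⟩
      have : negEdges sgn C = ∅ := by
        rw [negEdges, Finset.filter_eq_empty_iff]
        intro e he
        rw [(hP e).1 (hnbP ((hL₀ C h).2 he))]; decide
      rw [this]; simp
    · exact hL₁ C h
    · exact hL₂ C h
  · have hJcov : ∀ e, e ∈ M₁ ∪ J₁ ∨ e ∈ M₂ ∪ J₂ → ∃ C ∈ L₀ ++ (L₁ ++ L₂), e ∈ C := by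
      rintro e (h | h)
      · obtain ⟨S, hS, h⟩ := hL₁c e h
        exact ⟨S, by simp [hS], h⟩
      · obtain ⟨S, hS, h⟩ := hL₂c e h
        exact ⟨S, by simp [hS], h⟩
    intro t
    by_cases htP : t ∈ P
    swap
    · have hs : sgn t = true := by rw [hP] at htP; simpa using htP
      rcases hPm t hs with h | h
      · exact hJcov t (Or.inl (Finset.mem_union_left _ h))
      · exact hJcov t (Or.inr (Finset.mem_union_left _ h))
    by_cases htQ : t ∈ nb p q P
    · obtain ⟨C, hC, h⟩ := hL₀c t htQ
      exact ⟨C, by simp [hC], h⟩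
    have hnr : ¬ Reach (en p q) (P.erase t) (p t) (q t) := by
      rcases even_or_cut p q P t htP with ⟨C, hC, hE, htC⟩ | h
      · exact absurd (Finset.mem_filter.2 ⟨htP, C, hC, hE, htC⟩) htQ
      · exact h
    obtain ⟨X, hX⟩ : ∃ X, X = rs p q (P.erase t) (p t) := ⟨_, rfl⟩
    have hXcl : Cl p q (P.erase t) X := by rw [hX]; exact cl_rs _ _ _ _
    have hpX : p t ∈ X := by rw [hX]; exact self_mem_rs
    have hqX : q t ∉ X := by rw [hX]; exact fun h => hnr (mem_rs.1 h)
    have hle : (Finset.univ.filter fun f => sgn f = true ∧ cr p q X f).card ≤ 1 := by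
      refine (min_cut hmin X).trans ?_
      rw [Finset.card_le_one]
      have : ∀ f ∈ Finset.univ.filter (fun f => sgn f = false ∧ cr p q X f), f = t := by
        intro f hf
        simp only [Finset.mem_filter, Finset.mem_univ, true_and] at hf
        by_contra hne
        exact hf.2 (hXcl f (Finset.mem_erase.2 ⟨hne, (hP f).2 hf.1⟩))
      intro f hf g hg
      rw [this f hf, this g hg]
    by_cases hex : ∃ e, sgn e = true ∧ cr p q X e
    · obtain ⟨e, hes, hec⟩ := hex
      have hun : ∀ e', sgn e' = true → cr p q X e' → e' = e := by
        intro e' h1 h2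
        rw [Finset.card_le_one] at hle
        exact hle e' (by simp [h1, h2]) e (by simp [hes, hec])
      rcases hPm e hes with h | h
      · exact hJcov t (Or.inl (cover_bridge hP htP hXcl h hec hun hes hJ₁e))
      · exact hJcov t (Or.inr (cover_bridge hP htP hXcl h hec hun hes hJ₂e))
    · push Not at hex
      have hcl : Cl p q (Finset.univ.erase t) X := by
        intro f hf
        by_cases hfs : sgn f = true
        · have := hex f hfs
          unfold cr at this; tauto
        · refine hXcl f (Finset.mem_erase.2 ⟨(Finset.mem_erase.1 hf).1, (hP f).2 (by simpa using hfs)⟩)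
      have hB : Br p q t (p t) (q t) := ⟨rfl, fun h => hqX ((reach_cl hcl h).1 hpX)⟩
      by_contra hno
      push Not at hno
      rcases hbr t _ _ hB with h | h
      · exact h (hL₁b t _ (cl_rs _ _ _ _) fun S hS => hno S (by simp [hS]))
      · exact h (hL₂b t _ (cl_rs _ _ _ _) fun S hS => hno S (by simp [hS]))
  · have : totalLength (L₀ ++ (L₁ ++ L₂)) = totalLength L₀ + (totalLength L₁ + totalLength L₂) := by
      simp [totalLength]
    rw [this, hNc]
    omega

/-! ### Switching -/

theorem neg_switch {p q : E → V} {sgn : E → Bool} {U : Finset V} {C : Finset E} (hC : Ev p q C) :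
    Even (negEdges (switch (en p q) U sgn) C).card ↔ Even (negEdges sgn C).card := by
  rw [← ZMod.natCast_eq_zero_iff_even, ← ZMod.natCast_eq_zero_iff_even]
  have h1 := (ZMod.natCast_eq_zero_iff_even).2 (cut_even hC U)
  have : ((negEdges (switch (en p q) U sgn) C).card : ZMod 2) =
      ((negEdges sgn C).card : ZMod 2) + ((C.filter (cr p q U)).card : ZMod 2) := by
    rw [negEdges, negEdges]
    simp only [Finset.card_filter]
    push_cast
    rw [← Finset.sum_add_distrib]
    refine Finset.sum_congr rfl fun e _ => ?_
    rw [switch_apply]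
    by_cases a : cr p q U e <;> cases hs : sgn e <;> simp [a]
    decide
  rw [this, h1, add_zero]

theorem unb_switch {p q : E → V} {sgn : E → Bool} {U : Finset V} {C : Finset E} :
    IsUnbalancedCircuit (en p q) (switch (en p q) U sgn) C ↔ IsUnbalancedCircuit (en p q) sgn C := by
  unfold IsUnbalancedCircuit
  refine and_congr_right fun h => ?_
  rw [← Nat.not_even_iff_odd, ← Nat.not_even_iff_odd, neg_switch h.ev]

theorem signed_switch {p q : E → V} {sgn : E → Bool} {U : Finset V} {C : Finset E} :
    IsSignedCircuit (en p q) (switch (en p q) U sgn) C ↔ IsSignedCircuit (en p q) sgn C := by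
  unfold IsSignedCircuit IsShortBarbell IsLongBarbell
  simp only [unb_switch]
  refine or_congr ?_ Iff.rfl
  unfold IsBalancedCircuit
  exact and_congr_right fun h => neg_switch h.ev

theorem switch_switch {p q : E → V} {sgn : E → Bool} {U W : Finset V} :
    switch (en p q) W (switch (en p q) U sgn) = switch (en p q) (symmDiff U W) sgn := by
  ext e
  simp only [switch_apply]
  have : cr p q (symmDiff U W) e ↔ ¬ (cr p q U e ↔ cr p q W e) := by
    unfold cr
    simp only [Finset.mem_symmDiff]
    by_cases a : p e ∈ U <;> by_cases b : q e ∈ U <;> by_cases c : p e ∈ W <;>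
      by_cases d : q e ∈ W <;> simp [a, b, c, d]
  by_cases a : cr p q U e <;> by_cases b : cr p q W e <;> simp [a, b, this]

theorem part_two (p q : E → V) (sgn : E → Bool) (hfa : FlowAdmissible (en p q) sgn) :
    ∃ 𝒞 : List (Finset E), (∀ C ∈ 𝒞, IsSignedCircuit (en p q) sgn C) ∧ CoversAll 𝒞 ∧
      3 * totalLength 𝒞 ≤ 11 * Fintype.card E := by
  obtain ⟨U, -, hU⟩ := Finset.exists_min_image (Finset.univ : Finset (Finset V))
    (fun U => negCount (switch (en p q) U sgn)) ⟨∅, Finset.mem_univ _⟩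
  obtain ⟨𝒞, h1, h2, h3⟩ := part_one p q (switch (en p q) U sgn)
    (fun e => by
      obtain ⟨C, hC, he⟩ := hfa e
      exact ⟨C, signed_switch.2 hC, he⟩)
    (fun W => by rw [switch_switch]; exact hU _ (Finset.mem_univ _))
  exact ⟨𝒞, fun C hC => signed_switch.1 (h1 C hC), h2, by omega⟩

theorem exists_pq (ends : E → Sym2 V) : ∃ p q : E → V, ends = en p q := by
  have : ∀ e, ∃ ab : V × V, ends e = s(ab.1, ab.2) := by
    intro e
    induction h : ends e using Sym2.ind with
    | _ a b => exact ⟨(a, b), rfl⟩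
  choose f hf using this
  exact ⟨fun e => (f e).1, fun e => (f e).2, funext fun e => hf e⟩

/-- Every flow-admissible signed graph with `m` edges and `ε_N`
negative edges in a minimum signature has a signed circuit cover of length at
most 11/3·m − 5/3·ε_N; in particular of length at most 11/3·m. -/
theorem statement16 {V E : Type} [Fintype V] [Fintype E] [DecidableEq V] [DecidableEq E]
    (ends : E → Sym2 V) (sgn : E → Bool)
    (hfa : FlowAdmissible ends sgn) :
    (IsMinSignature ends sgn →
      ∃ 𝒞 : List (Finset E),
        (∀ C ∈ 𝒞, IsSignedCircuit ends sgn C) ∧ CoversAll 𝒞 ∧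
        3 * totalLength 𝒞 + 5 * negCount sgn ≤ 11 * Fintype.card E) ∧
    (∃ 𝒞 : List (Finset E),
      (∀ C ∈ 𝒞, IsSignedCircuit ends sgn C) ∧ CoversAll 𝒞 ∧
      3 * totalLength 𝒞 ≤ 11 * Fintype.card E) := by
  obtain ⟨p, q, rfl⟩ := exists_pq ends
  exact ⟨part_one p q sgn hfa, part_two p q sgn hfa⟩

end SignedCircuitCover
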